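/- arXiv:1407.2380 — 2 statements merged into one kernel-verified Lean document; each statement's English description precedes it below -/
import Mathlib

section
/- Let b_1,…,b_s ≥ 2 be pairwise coprime integers and let (x_n)_{n≥0} be the Halton sequence in [0,1)^s in bases b_1,…,b_s. Then for Lebesgue-almost every α = (α_1,…,α_t) ∈ ℝ^t and every ε > 0 there exists a constant C > 0 such that the discrepancy D_N of the (s+t)-dimensional Halton–Kronecker hybrid sequence z_n = (x_n, {nα_1},…,{nα_t}) satisfies D_N ≤ C · (log N)^{s+t+ε} / N for all N ≥ 2. -/
open MeasureTheory Real

/-- The discrepancy of the first `N` points of a sequence `z` in `[0,1)^ι`. -/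
noncomputable def disc {ι : Type*} [Fintype ι] (z : ℕ → ι → ℝ) (N : ℕ) : ℝ :=
  sSup { r : ℝ | ∃ u v : ι → ℝ,
    (∀ i, 0 ≤ u i ∧ u i ≤ v i ∧ v i ≤ 1) ∧
    r = |(Nat.card {n : ℕ // n < N ∧ ∀ i, u i ≤ z n i ∧ z n i < v i} : ℝ) / N
          - ∏ i, (v i - u i)| }

/-- The radical inverse function in base `b`. -/
noncomputable def radInv (b n : ℕ) : ℝ :=
  ∑ i ∈ Finset.range (Nat.digits b n).length,
    (((Nat.digits b n).getD i 0 : ℕ) : ℝ) / (b : ℝ) ^ (i + 1)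

/-- The Faber hat function of half-width `2⁻ᵏ`, with peak at `2⁻ᵏ`, extended with period one. -/
noncomputable def faberHat (k : ℕ) (x : ℝ) : ℝ := max 0 (1 - |2 ^ k * Int.fract x - 1|)

/-- The sawtooth piece of width `2⁻ᵏ` to the right of `0`, extended with period one. -/
noncomputable def sawPiece (k : ℕ) (x : ℝ) : ℝ := max 0 (1 - 2 ^ k * Int.fract x)

lemma sawPiece_succ (k : ℕ) (x : ℝ) :
    sawPiece k x = sawPiece (k + 1) x + 2⁻¹ * faberHat (k + 1) x := by
  unfold sawPiece faberHat
  have h0 : 0 ≤ 2 ^ k * Int.fract x := mul_nonneg (by positivity) (Int.fract_nonneg x)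
  have h1 : (2 : ℝ) ^ (k + 1) * Int.fract x = 2 * (2 ^ k * Int.fract x) := by ring
  rw [h1]
  generalize 2 ^ k * Int.fract x = A at *
  rcases abs_cases (2 * A - 1) with h | h <;> rcases max_cases 0 (1 - A) with h2 | h2 <;>
  rcases max_cases 0 (1 - 2 * A) with h3 | h3 <;>
  rcases max_cases 0 (1 - |2 * A - 1|) with h4 | h4 <;> linarith

lemma sawPiece_zero_eq_sum (K : ℕ) (x : ℝ) :
    1 - Int.fract x = sawPiece K x + ∑ k ∈ Finset.range K, 2⁻¹ * faberHat (k + 1) x := by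
  induction K with
  | zero =>
    have := Int.fract_lt_one x
    simp [sawPiece]
    linarith
  | succ K ih => rw [Finset.sum_range_succ, ih, sawPiece_succ K x]; ring

lemma fract_sub_eq_ite (x : ℝ) {w : ℝ} (h0 : 0 ≤ w) (h1 : w ≤ 1) : Int.fract (x - w) =
    if w ≤ Int.fract x then Int.fract x - w else Int.fract x - w + 1 := by
  have hx := Int.floor_add_fract x
  have hx0 := Int.fract_nonneg x
  have hx1 := Int.fract_lt_one x
  split_ifs with h
  · rw [Int.fract_eq_iff]
    exact ⟨by linarith, by linarith, ⌊x⌋, by linarith⟩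
  · rw [Int.fract_eq_iff]
    push Not at h
    exact ⟨by linarith, by linarith, ⌊x⌋ - 1, by push_cast; linarith⟩

lemma indicator_eq_fract {u v : ℝ} (hu : 0 ≤ u) (huv : u ≤ v) (hv : v ≤ 1) (x : ℝ) :
    (if u ≤ Int.fract x ∧ Int.fract x < v then (1 : ℝ) else 0)
      = (v - u) + (1 - Int.fract (x - u)) - (1 - Int.fract (x - v)) := by
  rw [fract_sub_eq_ite x hu (huv.trans hv), fract_sub_eq_ite x (hu.trans huv) hv]
  by_cases h1 : u ≤ Int.fract x <;> by_cases h2 : v ≤ Int.fract x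
  · simp [h1, h2, not_lt.mpr h2]; ring
  · simp [h1, h2, not_le.mp h2]; ring
  · exact absurd (huv.trans h2) h1
  · simp [h1, h2]

/-- A one-periodic function living at scale `2⁻ᵏ`, with mean `m`, and with quadratically decaying
Fourier coefficients when `k ≤ K`. -/
structure IsPiece (K k : ℕ) (g : ℝ → ℝ) (m : ℝ) : Prop where
  bound : ∀ x, |g x| ≤ 1
  mean : |m| ≤ (2 ^ k)⁻¹
  supp : ∃ c, ∀ x, g x ≠ 0 → Int.fract (x - c) < 2 * (2 ^ k)⁻¹
  fourier : k ≤ K → ∃ a : ℤ → ℂ, a 0 = m ∧ (∀ h, ‖a h‖ ≤ (2 ^ k)⁻¹) ∧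
    (∀ h : ℤ, ‖a h‖ * (h : ℝ) ^ 2 ≤ 2 ^ k) ∧
    ∀ x : ℝ, HasSum (fun h => a h * fourier h (x : UnitAddCircle)) (g x : ℂ)

lemma IsPiece.neg {K k : ℕ} {g : ℝ → ℝ} {m : ℝ} (h : IsPiece K k g m) :
    IsPiece K k (fun x => - g x) (-m) := by
  obtain ⟨h1, h2, ⟨c, h3⟩, h4⟩ := h
  refine ⟨fun x => by simpa using h1 x, by simpa using h2, ⟨c, fun x hx => h3 x (by simpa using hx)⟩,
    fun hk => ?_⟩
  obtain ⟨a, ha0, ha1, ha2, ha3⟩ := h4 hk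
  refine ⟨fun h => - a h, by simp [ha0], fun h => by simpa using ha1 h,
    fun h => by simpa using ha2 h, fun x => ?_⟩
  simpa using (ha3 x).neg

lemma isPiece_zero (K k : ℕ) : IsPiece K k (fun _ => 0) 0 :=
  ⟨by simp, by simp, ⟨0, by simp⟩, fun _ => ⟨0, by simp, by simp, by simp, fun x => by
    simp⟩⟩

lemma isPiece_const (K : ℕ) {r : ℝ} (h0 : 0 ≤ r) (h1 : r ≤ 1) : IsPiece K 0 (fun _ => r) r := by
  refine ⟨fun _ => by rwa [abs_of_nonneg h0], by simpa [abs_of_nonneg h0] using h1,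
    ⟨0, fun x _ => (Int.fract_lt_one _).trans (by norm_num)⟩, fun _ =>
    ⟨fun h => if h = 0 then (r : ℂ) else 0, by simp, ?_, ?_, ?_⟩⟩
  · intro h
    by_cases hh : h = 0
    · simpa [hh, abs_of_nonneg h0] using h1
    · simp [hh]
  · intro h
    by_cases hh : h = 0 <;> simp [hh]
  · intro x
    convert hasSum_ite_eq (0 : ℤ) (r : ℂ) using 2 with h
    by_cases hh : h = 0
    · subst hh; simp
    · simp [hh]

lemma isPiece_saw (K : ℕ) (u : ℝ) :
    IsPiece K (K + 1) (fun x => sawPiece K (x - u)) (2 ^ (K + 1))⁻¹ := by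
  have hp : (0 : ℝ) < 2 ^ K := by positivity
  refine ⟨fun x => ?_, by rw [abs_of_nonneg (by positivity)], ⟨u, fun x hx => ?_⟩, fun h => by omega⟩
  · have : 0 ≤ 2 ^ K * Int.fract (x - u) := mul_nonneg hp.le (Int.fract_nonneg _)
    simp only [sawPiece]
    rw [abs_of_nonneg (le_max_left _ _)]
    exact max_le (by norm_num) (by linarith)
  · simp only [sawPiece] at hx
    by_contra hc
    push Not at hc
    apply hx
    apply max_eq_left
    have : 2 * ((2 : ℝ) ^ (K + 1))⁻¹ = (2 ^ K)⁻¹ := by rw [pow_succ]; field_simp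
    rw [this] at hc
    have := mul_le_mul_of_nonneg_left hc hp.le
    rw [mul_inv_cancel₀ hp.ne'] at this
    linarith

lemma hasSum_fourier_quadratic (x : ℝ) :
    HasSum (fun h : ℤ => 1 / (h : ℂ) ^ 2 * fourier h (x : UnitAddCircle))
      ((2 * π ^ 2 * (Int.fract x ^ 2 - Int.fract x + 1 / 6) : ℝ) : ℂ) := by
  have h := hasSum_one_div_pow_mul_fourier_mul_bernoulliFun (k := 2) le_rfl (x := Int.fract x)
    ⟨Int.fract_nonneg x, (Int.fract_lt_one x).le⟩
  have h2 : ∀ y : ℝ, bernoulliFun 2 y = y ^ 2 - y + 1 / 6 := by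
    intro y
    simp [bernoulliFun, Polynomial.bernoulli]
    norm_num [Finset.sum_range_succ, bernoulli_two]
    ring
  rw [AddCircle.coe_fract, h2] at h
  convert h using 1
  push_cast
  rw [mul_pow, Complex.I_sq, show ((Nat.factorial 2 : ℕ) : ℂ) = 2 by norm_num [Nat.factorial]]
  ring

lemma faberHat_eq {k : ℕ} (hk : 1 ≤ k) (x : ℝ) :
    faberHat k x = (2 ^ k)⁻¹ - 2 ^ k / 2 * ((Int.fract x ^ 2 - Int.fract x + 1 / 6)
      - 2 * (Int.fract (x - (2 ^ k)⁻¹) ^ 2 - Int.fract (x - (2 ^ k)⁻¹) + 1 / 6)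
      + (Int.fract (x - 2 * (2 ^ k)⁻¹) ^ 2 - Int.fract (x - 2 * (2 ^ k)⁻¹) + 1 / 6)) := by
  have h2 : (2 : ℝ) ≤ 2 ^ k := by
    calc (2 : ℝ) = 2 ^ 1 := by norm_num
      _ ≤ 2 ^ k := pow_le_pow_right₀ (by norm_num) hk
  have hp : (0 : ℝ) < 2 ^ k := by positivity
  unfold faberHat
  generalize (2 : ℝ) ^ k = A at *
  have hA : A * A⁻¹ = 1 := mul_inv_cancel₀ hp.ne'
  have hw : 2 * A⁻¹ ≤ 1 := by nlinarith [inv_pos.mpr hp]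
  have hw0 : 0 < A⁻¹ := inv_pos.mpr hp
  rw [fract_sub_eq_ite x hw0.le (by linarith), fract_sub_eq_ite x (by linarith) hw]
  have hf0 := Int.fract_nonneg x
  generalize Int.fract x = f at *
  split_ifs with h1 h3 h3
  · rw [max_eq_left]
    · field_simp
      ring
    · have : 2 ≤ A * f := by nlinarith
      rw [abs_of_nonneg (by linarith)]
      linarith
  · push Not at h3
    have h4 : 1 ≤ A * f := by nlinarith
    have h5 : A * f < 2 := by nlinarith
    rw [abs_of_nonneg (by linarith), max_eq_right (by linarith)]
    field_simp
    ring
  · exfalso; linarith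
  · push Not at h1
    have h4 : A * f < 1 := by nlinarith
    have h5 : 0 ≤ A * f := by positivity
    rw [abs_of_nonpos (by linarith), max_eq_right (by linarith)]
    field_simp
    ring

lemma isPiece_hat (K : ℕ) {k : ℕ} (hk : 1 ≤ k) (u : ℝ) :
    IsPiece K k (fun x => 2⁻¹ * faberHat k (x - u)) (2⁻¹ * (2 ^ k)⁻¹) := by
  have hp : (0 : ℝ) < 2 ^ k := by positivity
  have hpi : (0 : ℝ) < (2 ^ k)⁻¹ := by positivity
  refine ⟨fun x => ?_, by rw [abs_of_nonneg (by positivity)]; linarith, ⟨u, fun x hx => ?_⟩,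
    fun _ => ?_⟩
  · have h0 : 0 ≤ faberHat k (x - u) := le_max_left _ _
    have h1 : faberHat k (x - u) ≤ 1 :=
      max_le (by norm_num) (by linarith [abs_nonneg (2 ^ k * Int.fract (x - u) - 1)])
    rw [abs_of_nonneg (by positivity)]
    linarith
  · by_contra hc
    push Not at hc
    apply hx
    have := mul_le_mul_of_nonneg_left hc hp.le
    have h3 : (2 : ℝ) ^ k * (2 * (2 ^ k)⁻¹) = 2 := by field_simp
    rw [h3] at this
    unfold faberHat
    rw [max_eq_left, mul_zero]
    rw [abs_of_nonneg (by linarith)]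
    linarith
  · set w : ℝ := (2 ^ k)⁻¹ with hw
    let E : ℤ → ℝ → ℂ := fun h y => fourier h (y : UnitAddCircle)
    have hE : ∀ h y, E h y = Complex.exp (2 * π * Complex.I * h * y) := by
      intro h y; simp [E]
    have hEadd : ∀ h y z, E h (y + z) = E h y * E h z := by
      intro h y z; rw [hE, hE, hE, ← Complex.exp_add]; congr 1; push_cast; ring
    have hEn : ∀ h y, ‖E h y‖ = 1 := by
      intro h y
      rw [hE, show 2 * (π : ℂ) * Complex.I * h * y = ((2 * π * h * y : ℝ) : ℂ) * Complex.I by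
        push_cast; ring]
      exact Complex.norm_exp_ofReal_mul_I _
    have hE1 : ∀ h y, ‖E h y - 1‖ ≤ 2 * π * |(h : ℝ)| * |y| := by
      intro h y
      rw [hE, show 2 * (π : ℂ) * Complex.I * h * y = Complex.I * ((2 * π * h * y : ℝ) : ℂ) by
        push_cast; ring]
      refine Real.norm_exp_I_mul_ofReal_sub_one_le.trans ?_
      rw [Real.norm_eq_abs, abs_mul, abs_mul, abs_of_nonneg (by positivity)]
    let a : ℤ → ℂ := fun h => (if h = 0 then ((2⁻¹ * w : ℝ) : ℂ) else 0)
      - ((2 ^ k / 4 / (2 * π ^ 2) : ℝ) : ℂ) * (1 / (h : ℂ) ^ 2 * ((E h (-w) - 1) ^ 2 * E h (-u)))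
    have ha : ∀ h : ℤ, h ≠ 0 → ‖a h‖ = 2 ^ k / 4 / (2 * π ^ 2) * (1 / (h : ℝ) ^ 2 * ‖E h (-w) - 1‖ ^ 2) := by
      intro h hh
      simp only [a, hh, if_false, zero_sub, norm_neg, norm_mul, norm_pow, hEn, mul_one, norm_div,
        norm_one, Complex.norm_intCast, Complex.norm_real, sq_abs, Real.norm_eq_abs]
      simp only [Nat.abs_ofNat]
    have hpi2 : (1 : ℝ) ≤ π := by linarith [Real.pi_gt_three]
    refine ⟨a, ?_, ?_, ?_, ?_⟩
    · simp [a]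
    · intro h
      by_cases hh : h = 0
      · subst hh
        simp only [a, Int.cast_zero, if_true]
        norm_num
        rw [abs_of_pos hpi]
        linarith
      · rw [ha h hh]
        have h1 : ‖E h (-w) - 1‖ ^ 2 ≤ (2 * π * |(h : ℝ)| * w) ^ 2 := by
          have := hE1 h (-w)
          rw [abs_neg, abs_of_pos hpi] at this
          gcongr
        have hh2 : 0 < (h : ℝ) ^ 2 := by positivity
        calc _ ≤ 2 ^ k / 4 / (2 * π ^ 2) * (1 / (h : ℝ) ^ 2 * (2 * π * |(h : ℝ)| * w) ^ 2) := by gcongr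
          _ = w / 2 := by
              rw [mul_pow, mul_pow, sq_abs, hw]
              field_simp
              norm_num
          _ ≤ w := by linarith
    · intro h
      by_cases hh : h = 0
      · subst hh; simp
      · rw [ha h hh]
        have h1 : ‖E h (-w) - 1‖ ^ 2 ≤ 2 ^ 2 := by
          have : ‖E h (-w) - 1‖ ≤ 2 := by
            refine (norm_sub_le _ _).trans ?_
            rw [hEn]; norm_num
          gcongr
        have hh2 : 0 < (h : ℝ) ^ 2 := by positivity
        calc _ ≤ 2 ^ k / 4 / (2 * π ^ 2) * (1 / (h : ℝ) ^ 2 * 2 ^ 2) * (h : ℝ) ^ 2 := by gcongr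
          _ = 2 ^ k / (2 * π ^ 2) := by field_simp; norm_num
          _ ≤ 2 ^ k := by
              apply div_le_self hp.le
              nlinarith
    · intro x
      have h0 := hasSum_fourier_quadratic (x - u)
      have h1 := hasSum_fourier_quadratic (x - u - w)
      have h2 := hasSum_fourier_quadratic (x - u - 2 * w)
      have h3 := hasSum_ite_eq (0 : ℤ) ((2⁻¹ * w : ℝ) : ℂ)
      have h4 := h3.sub (((h0.sub (h1.mul_left 2)).add h2).mul_left ((2 ^ k / 4 / (2 * π ^ 2) : ℝ) : ℂ))
      have hf : ∀ h : ℤ, a h * fourier h (x : UnitAddCircle) =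
          (if h = 0 then ((2⁻¹ * w : ℝ) : ℂ) else 0)
          - ((2 ^ k / 4 / (2 * π ^ 2) : ℝ) : ℂ) * (1 / (h : ℂ) ^ 2 * E h (x - u)
            - 2 * (1 / (h : ℂ) ^ 2 * E h (x - u - w)) + 1 / (h : ℂ) ^ 2 * E h (x - u - 2 * w)) := by
        intro h
        change a h * E h x = _
        rw [show x - u - 2 * w = x + -u + -w + -w by ring, show x - u - w = x + -u + -w by ring,
          show x - u = x + -u by ring]
        simp only [hEadd, a]
        by_cases hh : h = 0
        · subst hh
          simp [E]
        · simp only [hh, if_false]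
          ring
      have hv : 2⁻¹ * faberHat k (x - u) = 2⁻¹ * w - 2 ^ k / 4 / (2 * π ^ 2) *
          (2 * π ^ 2 * (Int.fract (x - u) ^ 2 - Int.fract (x - u) + 1 / 6)
          - 2 * (2 * π ^ 2 * (Int.fract (x - u - w) ^ 2 - Int.fract (x - u - w) + 1 / 6))
          + 2 * π ^ 2 * (Int.fract (x - u - 2 * w) ^ 2 - Int.fract (x - u - 2 * w) + 1 / 6)) := by
        rw [faberHat_eq hk, ← hw]
        have hw2 : (2 : ℝ) ^ k = w⁻¹ := by rw [hw, inv_inv]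
        field_simp
        ring
      rw [funext hf, hv]
      push_cast at h4 ⊢
      exact h4

lemma exists_torus_pieces (K : ℕ) {u v : ℝ} (hu : 0 ≤ u) (huv : u ≤ v) (hv : v ≤ 1) :
    ∃ (g : ℕ → Bool → ℝ → ℝ) (m : ℕ → Bool → ℝ), (∀ k r, IsPiece K k (g k r) (m k r)) ∧
      (∀ x, (if u ≤ Int.fract x ∧ Int.fract x < v then (1 : ℝ) else 0)
        = ∑ k ∈ Finset.range (K + 2), ∑ r, g k r x) ∧
      v - u = ∑ k ∈ Finset.range (K + 2), ∑ r, m k r := by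
  let c : Bool → ℝ := fun r => if r then v else u
  let sg : Bool → ℝ := fun r => if r then -1 else 1
  let g : ℕ → Bool → ℝ → ℝ := fun k r x =>
    if k = 0 then (if r then 0 else v - u) else if k ≤ K then sg r * (2⁻¹ * faberHat k (x - c r))
    else if k = K + 1 then sg r * sawPiece K (x - c r) else 0
  let m : ℕ → Bool → ℝ := fun k r =>
    if k = 0 then (if r then 0 else v - u) else if k ≤ K then sg r * (2⁻¹ * (2 ^ k)⁻¹)
    else if k = K + 1 then sg r * (2 ^ (K + 1))⁻¹ else 0
  refine ⟨g, m, ?_, ?_, ?_⟩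
  · intro k r
    by_cases h0 : k = 0
    · subst h0
      cases r
      · simpa [g, m] using isPiece_const K (sub_nonneg.mpr huv) (by linarith)
      · simpa [g, m] using isPiece_zero K 0
    by_cases h1 : k ≤ K
    · cases r
      · simpa [g, m, h0, h1, c, sg] using isPiece_hat K (Nat.one_le_iff_ne_zero.mpr h0) u
      · simpa [g, m, h0, h1, c, sg] using (isPiece_hat K (Nat.one_le_iff_ne_zero.mpr h0) v).neg
    by_cases h2 : k = K + 1
    · subst h2
      cases r
      · simpa [g, m, c, sg] using isPiece_saw K u
      · simpa [g, m, c, sg] using (isPiece_saw K v).neg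
    · simpa [g, m, h0, h1, h2] using isPiece_zero K k
  · intro x
    rw [indicator_eq_fract hu huv hv, sawPiece_zero_eq_sum K, sawPiece_zero_eq_sum K,
      Finset.sum_range_succ, Finset.sum_range_succ']
    have : ∀ k ∈ Finset.range K, ∑ r, g (k + 1) r x =
        2⁻¹ * faberHat (k + 1) (x - u) - 2⁻¹ * faberHat (k + 1) (x - v) := by
      intro k hk
      have : k + 1 ≤ K := by simpa using hk
      simp [g, this, sg, c]
      ring
    rw [Finset.sum_congr rfl this, Finset.sum_sub_distrib]
    simp [g, sg, c]
    ring
  · rw [Finset.sum_range_succ, Finset.sum_range_succ', Finset.sum_eq_zero]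
    · simp [m, sg]
    · intro k hk
      have : k + 1 ≤ K := by simpa using hk
      simp [m, this, sg]

lemma radInv_eq {b : ℕ} (hb : 2 ≤ b) (n : ℕ) :
    radInv b n = ((n % b : ℕ) + radInv b (n / b)) / b := by
  rcases Nat.eq_zero_or_pos n with rfl | hn
  · simp [radInv]
  · have hb0 : (b : ℝ) ≠ 0 := by positivity
    unfold radInv
    rw [Nat.digits_def' (by omega) hn, List.length_cons, Finset.sum_range_succ', add_div,
      Finset.sum_div, add_comm]
    congr 1
    · simp
    · refine Finset.sum_congr rfl fun i _ => ?_
      rw [List.getD_cons_succ, pow_succ (b : ℝ) (i + 1), div_div]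

lemma radInv_mem {b : ℕ} (hb : 2 ≤ b) (n : ℕ) : 0 ≤ radInv b n ∧ radInv b n < 1 := by
  have hb0 : (0 : ℝ) < b := by positivity
  induction n using Nat.strong_induction_on with
  | _ n ih =>
    rcases Nat.eq_zero_or_pos n with rfl | hn
    · simp [radInv]
    · obtain ⟨h1, h2⟩ := ih (n / b) (Nat.div_lt_self hn (by omega))
      rw [radInv_eq hb]
      refine ⟨by positivity, ?_⟩
      rw [div_lt_one hb0]
      have : ((n % b : ℕ) : ℝ) + 1 ≤ b := by exact_mod_cast Nat.mod_lt n (by omega)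
      linarith

lemma sum_range_mul_eq {M : Type*} [AddCommMonoid M] (b m : ℕ) (F : ℕ → M) :
    ∑ a ∈ Finset.range (b * m), F a
      = ∑ q ∈ Finset.range m, ∑ r ∈ Finset.range b, F (b * q + r) := by
  induction m with
  | zero => simp
  | succ m ih => rw [Nat.mul_succ, Finset.sum_range_add, ih, Finset.sum_range_succ]

/-- The indicator of `radInv b n < v`, restricted to `n < b ^ K`, as a sum of functions of the
residues of `n` modulo `b ^ k`. -/
lemma exists_radInv_lt_pieces {b : ℕ} (hb : 2 ≤ b) (K : ℕ) {v : ℝ} (h0 : 0 ≤ v) (h1 : v ≤ 1) :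
    ∃ c : ℕ → ℕ → ℝ, |c 0 0| ≤ 1 ∧ (∀ k, ∑ a ∈ Finset.range (b ^ k), |c k a| ≤ b) ∧
      (∀ n < b ^ K, (if radInv b n < v then (1 : ℝ) else 0)
        = ∑ k ∈ Finset.range (K + 1), c k (n % b ^ k)) ∧
      |v - ∑ k ∈ Finset.range (K + 1), ∑ a ∈ Finset.range (b ^ k), c k a / b ^ k|
        ≤ ((b : ℝ) ^ K)⁻¹ := by
  have hbR : (2 : ℝ) ≤ b := by exact_mod_cast hb
  have hb0 : (0 : ℝ) < b := by linarith
  induction K generalizing v with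
  | zero =>
    refine ⟨fun k _ => if k = 0 then (if 0 < v then 1 else 0) else 0, ?_, ?_, ?_, ?_⟩
    · split_ifs <;> simp_all
    · intro k
      by_cases hk : k = 0
      · subst hk
        by_cases hv : 0 < v <;> simp [hv]
        linarith
      · simp [hk]
    · intro n hn
      have : n = 0 := by simpa using hn
      subst this
      simp [radInv]
    · by_cases hv : 0 < v
      · simp [hv, abs_le]
        constructor <;> linarith
      · have : v = 0 := by linarith
        simp [this]
  | succ K ih =>
    rcases h1.eq_or_lt with rfl | h1
    · refine ⟨fun k _ => if k = 0 then 1 else 0, by simp, ?_, ?_, ?_⟩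
      · intro k
        by_cases hk : k = 0
        · subst hk; simp; linarith
        · simp [hk]
      · intro n _
        simp [(radInv_mem hb n).2]
      · rw [Finset.sum_range_succ']
        simp
    · set A : ℕ := ⌊b * v⌋₊ with hA
      have hbv : 0 ≤ b * v := by positivity
      have hA1 : (A : ℝ) ≤ b * v := Nat.floor_le hbv
      have hA2 : b * v < A + 1 := Nat.lt_floor_add_one _
      have hAb : A < b := by
        rw [hA, Nat.floor_lt hbv]
        nlinarith
      obtain ⟨c', hc0, hc1, hc2, hc3⟩ := ih (v := b * v - A) (by linarith) (by linarith)
      let d : ℕ → ℕ → ℝ := fun k a =>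
        if a % b = A then c' k (a / b) else if k = 0 ∧ a < A then 1 else 0
      have hd : ∀ k q r, r < b → d k (b * q + r) =
          if r = A then c' k q else if k = 0 ∧ b * q + r < A then 1 else 0 := by
        intro k q r hr
        have e1 : (b * q + r) % b = r := by rw [Nat.mul_add_mod, Nat.mod_eq_of_lt hr]
        have e2 : (b * q + r) / b = q := by
          rw [Nat.mul_add_div (by omega), Nat.div_eq_of_lt hr, add_zero]
        simp only [d, e1, e2]
      have hsum : ∀ F : ℝ → ℝ, F 0 = 0 → ∀ k, ∑ a ∈ Finset.range (b ^ (k + 1)), F (d k a)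
          = ∑ a ∈ Finset.range (b ^ k), F (c' k a) + if k = 0 then A * F 1 else 0 := by
        intro F hF k
        rw [pow_succ, mul_comm (b ^ k) b, sum_range_mul_eq]
        by_cases hk : k = 0
        · subst hk
          simp only [pow_zero, Finset.range_one, Finset.sum_singleton, if_true]
          have : ∀ r ∈ Finset.range b, F (d 0 (b * 0 + r)) =
              (if r = A then F (c' 0 0) else 0) + if r < A then F 1 else 0 := by
            intro r hr
            rw [hd _ _ _ (by simpa using hr)]
            by_cases h2 : r = A
            · simp [h2]
            · by_cases h3 : r < A <;> simp [h2, h3, hF]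
          rw [Finset.sum_congr rfl this, Finset.sum_add_distrib]
          congr 1
          · simp [hAb]
          · rw [← Finset.sum_filter]
            have : (Finset.range b).filter (fun r => r < A) = Finset.range A := by
              ext r; simp; omega
            simp [this]
        · simp only [hk, if_false, add_zero]
          refine Finset.sum_congr rfl fun q _ => ?_
          have : ∀ r ∈ Finset.range b, F (d k (b * q + r)) =
              (if r = A then F (c' k q) else 0) := by
            intro r hr
            rw [hd _ _ _ (by simpa using hr)]
            by_cases h2 : r = A <;> simp [h2, hk, hF]
          rw [Finset.sum_congr rfl this]
          simp [hAb]
      refine ⟨fun k a => if k = 0 then 0 else d (k - 1) a, by simp, ?_, ?_, ?_⟩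
      · rintro (_ | k)
        · simp
        · simp only [Nat.succ_ne_zero, if_false, Nat.add_sub_cancel]
          rw [hsum (fun x => |x|) abs_zero]
          by_cases hk : k = 0
          · subst hk
            have : (A : ℝ) + 1 ≤ b := by exact_mod_cast hAb
            simp
            linarith
          · simpa [hk] using hc1 k
      · intro n hn
        rw [Finset.sum_range_succ']
        simp only [Nat.succ_ne_zero, if_false, if_true, add_zero, Nat.add_sub_cancel]
        have e1 : ∀ k, n % b ^ (k + 1) % b = n % b := fun k =>
          Nat.mod_mod_of_dvd _ (dvd_pow_self b (by omega))
        have e2 : ∀ k, n % b ^ (k + 1) / b = n / b % b ^ k := by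
          intro k
          rw [pow_succ, mul_comm, Nat.mod_mul_right_div_self]
        have hψ := radInv_mem hb (n / b)
        have hlt : radInv b n < v ↔ ((n % b : ℕ) : ℝ) + radInv b (n / b) < b * v := by
          rw [radInv_eq hb n, div_lt_iff₀ hb0, mul_comm v]
        simp only [d, e1, e2]
        by_cases h2 : n % b = A
        · simp only [h2, if_true]
          rw [← hc2 (n / b) (Nat.div_lt_of_lt_mul (by rwa [pow_succ, mul_comm] at hn))]
          refine if_congr ?_ rfl rfl
          rw [hlt, h2]
          constructor <;> intro h <;> linarith
        · simp only [h2, if_false]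
          rw [Finset.sum_range_succ', Finset.sum_eq_zero (by simp)]
          simp only [zero_add, pow_one, true_and]
          refine if_congr ?_ rfl rfl
          rw [hlt]
          constructor
          · intro h
            by_contra h3
            have : (A : ℝ) + 1 ≤ (n % b : ℕ) := by exact_mod_cast (by omega : A + 1 ≤ n % b)
            linarith
          · intro h
            have : ((n % b : ℕ) : ℝ) + 1 ≤ A := by exact_mod_cast h
            linarith
      · rw [Finset.sum_range_succ']
        simp only [Nat.succ_ne_zero, if_false, if_true, Nat.add_sub_cancel, zero_div,
          Finset.sum_const_zero, add_zero]
        have e : ∀ k ∈ Finset.range (K + 1), ∑ a ∈ Finset.range (b ^ (k + 1)), d k a / (b : ℝ) ^ (k + 1)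
            = (∑ a ∈ Finset.range (b ^ k), c' k a / (b : ℝ) ^ k + if k = 0 then (A : ℝ) else 0) / b := by
          intro k _
          rw [← Finset.sum_div, ← Finset.sum_div, hsum (fun x => x) rfl]
          by_cases hk : k = 0
          · subst hk; simp
          · simp only [hk, if_false, add_zero, pow_succ, div_div]
        rw [Finset.sum_congr rfl e, ← Finset.sum_div, Finset.sum_add_distrib]
        have e3 : ∑ k ∈ Finset.range (K + 1), (if k = 0 then (A : ℝ) else 0) = A := by simp
        rw [e3, show v - (∑ k ∈ Finset.range (K + 1), ∑ a ∈ Finset.range (b ^ k), c' k a / (b : ℝ) ^ k + A) / b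
          = (b * v - A - ∑ k ∈ Finset.range (K + 1), ∑ a ∈ Finset.range (b ^ k), c' k a / (b : ℝ) ^ k) / b by
            field_simp
            ring, abs_div, abs_of_pos hb0, pow_succ, mul_inv, ← div_eq_mul_inv]
        gcongr

lemma exists_halton_pieces {b : ℕ} (hb : 2 ≤ b) (K : ℕ) {u v : ℝ} (hu : 0 ≤ u) (huv : u ≤ v)
    (hv : v ≤ 1) :
    ∃ c : ℕ → ℕ → ℝ, (∀ k, ∑ a ∈ Finset.range (b ^ k), |c k a| ≤ 2 * b) ∧
      (∀ n < b ^ K, (if u ≤ radInv b n ∧ radInv b n < v then (1 : ℝ) else 0)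
        = ∑ k ∈ Finset.range (K + 1), c k (n % b ^ k)) ∧
      |(v - u) - ∑ k ∈ Finset.range (K + 1), ∑ a ∈ Finset.range (b ^ k), c k a / b ^ k|
        ≤ 2 * ((b : ℝ) ^ K)⁻¹ := by
  obtain ⟨c, -, hc1, hc2, hc3⟩ := exists_radInv_lt_pieces hb K hu (huv.trans hv)
  obtain ⟨d, -, hd1, hd2, hd3⟩ := exists_radInv_lt_pieces hb K (hu.trans huv) hv
  refine ⟨fun k a => d k a - c k a, fun k => ?_, fun n hn => ?_, ?_⟩
  · calc _ ≤ ∑ a ∈ Finset.range (b ^ k), (|d k a| + |c k a|) :=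
        Finset.sum_le_sum fun a _ => abs_sub _ _
      _ ≤ 2 * b := by rw [Finset.sum_add_distrib]; linarith [hc1 k, hd1 k]
  · rw [Finset.sum_sub_distrib, ← hc2 n hn, ← hd2 n hn]
    by_cases h1 : radInv b n < u
    · simp [h1, h1.trans_le huv, not_le.mpr h1]
    · simp [h1, not_lt.mp h1]
  · simp only [sub_div, Finset.sum_sub_distrib]
    rw [abs_le] at *
    constructor <;> linarith [hc3.1, hc3.2, hd3.1, hd3.2]

open scoped ENNReal

/-- A bound for `H⁻¹ |D_M(x) D_H(x)|`, where `D` is the exponential-sum Dirichlet kernel. -/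
noncomputable def kernelBound (H : ℕ) (x : UnitAddCircle) : ℝ≥0∞ :=
  ‖x‖ₑ⁻¹ * min 1 (H * ‖x‖ₑ)⁻¹

/-- The decay, in units of `2 ^ k`, of the Fourier coefficients of a piece of level `k`. -/
noncomputable def profile (m : ℕ) : ℝ≥0∞ := min 1 ((m : ℝ≥0∞) ^ 2)⁻¹

/-- A bound for the `h`-th Fourier coefficient of a piece of level `k`. -/
noncomputable def coefBound (k : ℕ) (h : ℤ) : ℝ≥0∞ :=
  (2 ^ k)⁻¹ * profile (h.natAbs / 2 ^ k)

/-- A bound for the number of returns of the orbit of `β` to a box of side lengths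
`2 * 2 ^ (-k i)` within time `2 ^ ∑ i, k i`. -/
noncomputable def returnCount {t : ℕ} (k : Fin t → ℕ) (β : Fin t → UnitAddCircle) : ℝ≥0∞ :=
  ∑ m ∈ Finset.Ioo (-(2 ^ ∑ i, k i : ℕ) : ℤ) (2 ^ ∑ i, k i : ℕ),
    {γ : Fin t → UnitAddCircle | ∀ i, ‖m • γ i‖ ≤ 2 * (2 ^ k i)⁻¹}.indicator 1 β

/-- A bound for the contribution of the nontrivial frequencies. -/
noncomputable def frequencySum {t : ℕ} (k : Fin t → ℕ) (β : Fin t → UnitAddCircle) : ℝ≥0∞ :=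
  ∑' h : Fin t → ℤ, if h = 0 then 0 else
    (∏ i, coefBound (k i) (h i)) * kernelBound (2 ^ ∑ i, k i) (∑ i, h i • β i)

lemma four_mul_norm_le_norm_fourier_sub_one (x : UnitAddCircle) :
    4 * ‖x‖ ≤ ‖(fourier 1 x : ℂ) - 1‖ := by
  induction x using QuotientAddGroup.induction_on with
  | H x =>
    have h0 : ((x : ℝ) : UnitAddCircle) = ((x - round x : ℝ) : UnitAddCircle) := by
      rw [AddCircle.coe_sub]
      have : ((round x : ℝ) : UnitAddCircle) = 0 := by
        have := AddCircle.coe_zsmul (p := (1 : ℝ)) (n := round x) (x := 1)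
        simp
      rw [this, sub_zero]
    rw [show (QuotientAddGroup.mk x : UnitAddCircle) = ((x : ℝ) : UnitAddCircle) from rfl,
      UnitAddCircle.norm_eq, h0, fourier_coe_apply]
    set y := x - round x
    have hy : |y| ≤ 1 / 2 := abs_sub_round x
    have h1 := Complex.norm_exp_I_mul_ofReal_sub_one (2 * π * y)
    have h2 : (2 * π * Complex.I * ((1 : ℤ) : ℂ) * (y : ℂ) / ((1 : ℝ) : ℂ)) =
        Complex.I * ((2 * π * y : ℝ) : ℂ) := by push_cast; ring
    rw [h2, h1]
    have h3 := Real.mul_abs_le_abs_sin (x := π * y) (by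
      rw [abs_mul, abs_of_pos pi_pos]; nlinarith [pi_pos])
    rw [abs_mul, abs_of_pos pi_pos] at h3
    have : 2 / π * (π * |y|) = 2 * |y| := by field_simp
    rw [norm_mul, show 2 * π * y / 2 = π * y by ring, Real.norm_eq_abs, Real.norm_eq_abs]
    rw [abs_two]
    linarith

lemma norm_fourier_apply (n : ℤ) (x : UnitAddCircle) : ‖(fourier n x : ℂ)‖ = 1 :=
  Circle.norm_coe _

lemma enorm_geom_sum_mul_le (x : UnitAddCircle) (M : ℕ) :
    ‖∑ n ∈ Finset.range M, (fourier 1 x : ℂ) ^ n‖ₑ * ‖x‖ₑ ≤ 1 := by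
  set z : ℂ := fourier 1 x
  have hz : ‖z‖ = 1 := norm_fourier_apply 1 x
  have h1 : ‖∑ n ∈ Finset.range M, z ^ n‖ * ‖z - 1‖ ≤ 2 := by
    rw [← norm_mul, geom_sum_mul]
    refine (norm_sub_le _ _).trans ?_
    simp [hz]; norm_num
  have h2 := four_mul_norm_le_norm_fourier_sub_one x
  have h3 : ‖∑ n ∈ Finset.range M, z ^ n‖ * ‖x‖ ≤ 1 := by
    have := mul_le_mul_of_nonneg_left h2 (norm_nonneg (∑ n ∈ Finset.range M, z ^ n))
    linarith
  rw [← ofReal_norm, ← ofReal_norm x, ← ENNReal.ofReal_mul (norm_nonneg _)]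
  exact ENNReal.ofReal_le_one.2 h3

lemma dirichlet_le_kernelBound (x : UnitAddCircle) (M : ℕ) {H : ℕ} (hH : 0 < H) :
    (H : ENNReal)⁻¹ * ‖∑ n ∈ Finset.range M, (fourier 1 x : ℂ) ^ n‖ₑ *
      ‖∑ n ∈ Finset.range H, (fourier 1 x : ℂ) ^ n‖ₑ ≤ kernelBound H x := by
  have hH0 : (H : ENNReal) ≠ 0 := by exact_mod_cast hH.ne'
  have hHt : (H : ENNReal) ≠ ⊤ := ENNReal.natCast_ne_top H
  have hxt : ‖x‖ₑ ≠ ⊤ := enorm_ne_top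
  have inv (L : ℕ) : ‖∑ n ∈ Finset.range L, (fourier 1 x : ℂ) ^ n‖ₑ ≤ ‖x‖ₑ⁻¹ := by
    rw [ENNReal.le_inv_iff_mul_le]
    exact enorm_geom_sum_mul_le x L
  have triv : (H : ENNReal)⁻¹ * ‖∑ n ∈ Finset.range H, (fourier 1 x : ℂ) ^ n‖ₑ ≤ 1 := by
    rw [mul_comm, ← div_eq_mul_inv]
    refine ENNReal.div_le_of_le_mul ?_
    rw [one_mul, ← ofReal_norm, ← ENNReal.ofReal_natCast]
    refine ENNReal.ofReal_le_ofReal ((norm_sum_le _ _).trans ?_)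
    simp only [norm_pow, norm_fourier_apply]
    simp
  unfold kernelBound
  rw [mul_right_comm, mul_comm]
  refine mul_le_mul' (inv M) (le_min triv ?_)
  rw [ENNReal.mul_inv (Or.inl hH0) (Or.inl hHt)]
  exact mul_le_mul_right (inv H) _

lemma hasSum_pi_prod {t : ℕ} (f : Fin t → ℤ → ℂ) (S : Fin t → ℂ) (hf : ∀ i, HasSum (f i) (S i)) :
    HasSum (fun h : Fin t → ℤ => ∏ i, f i (h i)) (∏ i, S i) := by
  induction t with
  | zero =>
    simp only [Finset.univ_eq_empty, Finset.prod_empty]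
    convert hasSum_fintype (fun _ : Fin 0 → ℤ => (1 : ℂ))
    simp
  | succ t ih =>
    have h1 := ih (fun i => f i.succ) (fun i => S i.succ) (fun i => hf _)
    have h0 := hf 0
    have hs := summable_mul_of_summable_norm h0.summable.norm h1.summable.norm
    have := h0.mul h1 hs
    rw [Fin.prod_univ_succ, ← (Fin.consEquiv (fun _ : Fin (t + 1) => ℤ)).hasSum_iff]
    have e : (fun h : Fin (t + 1) → ℤ => ∏ i, f i (h i)) ∘ Fin.consEquiv (fun _ => ℤ) =
        fun x : ℤ × (Fin t → ℤ) => f 0 x.1 * ∏ i, f i.succ (x.2 i) := by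
      funext x
      simp [Fin.prod_univ_succ, Fin.consEquiv]
    rw [e]
    exact this

lemma enorm_le_coefBound {k : ℕ} {h : ℤ} {a : ℂ} (h1 : ‖a‖ ≤ (2 ^ k)⁻¹)
    (h2 : ‖a‖ * (h : ℝ) ^ 2 ≤ 2 ^ k) : ‖a‖ₑ ≤ coefBound k h := by
  have e1 : ((2 : ENNReal) ^ k)⁻¹ = ENNReal.ofReal ((2 ^ k)⁻¹) := by
    rw [ENNReal.ofReal_inv_of_pos (by positivity), ENNReal.ofReal_pow (by norm_num)]
    simp
  unfold coefBound profile
  rw [← ofReal_norm, e1]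
  set q := h.natAbs / 2 ^ k with hq
  rcases Nat.eq_zero_or_pos q with h0 | h0
  · rw [h0]; simpa using ENNReal.ofReal_le_ofReal h1
  · have hq0 : (0 : ℝ) < q := by exact_mod_cast h0
    have e2 : (((q : ℕ) : ENNReal) ^ 2)⁻¹ = ENNReal.ofReal (((q : ℝ) ^ 2)⁻¹) := by
      rw [ENNReal.ofReal_inv_of_pos (by positivity), ENNReal.ofReal_pow hq0.le]
      simp
    have h3 : (q : ℝ) * 2 ^ k ≤ |(h : ℝ)| := by
      have : q * 2 ^ k ≤ h.natAbs := Nat.div_mul_le_self _ _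
      have h4 : ((h.natAbs : ℕ) : ℝ) = |(h : ℝ)| := by
        rw [Nat.cast_natAbs, Int.cast_abs]
      rw [← h4]; exact_mod_cast this
    rw [e2, min_eq_right, ← ENNReal.ofReal_mul (by positivity)]
    · apply ENNReal.ofReal_le_ofReal
      have h5 : ((q : ℝ) * 2 ^ k) ^ 2 ≤ (h : ℝ) ^ 2 := by
        rw [← sq_abs (h : ℝ)]; gcongr
      have h6 := (mul_le_mul_of_nonneg_left h5 (norm_nonneg a)).trans h2
      rw [← mul_inv, ← one_div, le_div_iff₀ (by positivity)]
      have : (0 : ℝ) < 2 ^ k := by positivity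
      nlinarith
    · apply ENNReal.ofReal_le_one.2
      apply inv_le_one_of_one_le₀
      have : (1 : ℝ) ≤ q := by exact_mod_cast h0
      nlinarith

/-- A product of pieces, evaluated along an arithmetic progression. -/
noncomputable def pieceProd {t : ℕ} (g : Fin t → ℝ → ℝ) (β θ : Fin t → ℝ) (n : ℕ) : ℝ :=
  ∏ i, g i (n * β i + θ i)

lemma norm_coe_le_abs (x : ℝ) : ‖(x : UnitAddCircle)‖ ≤ |x| := by
  rw [UnitAddCircle.norm_eq]
  simpa using round_le x 0

lemma enorm_sum_window_le {t K : ℕ} {k : Fin t → ℕ} {g : Fin t → ℝ → ℝ} {m : Fin t → ℝ}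
    (hg : ∀ i, IsPiece K (k i) (g i) (m i)) (β θ : Fin t → ℝ) (s L : ℕ)
    (hL : L ≤ 2 ^ ∑ i, k i) :
    ‖∑ n ∈ Finset.Ico s (s + L), pieceProd g β θ n‖ₑ ≤ returnCount k (fun i => (β i : UnitAddCircle)) := by
  classical
  set H := 2 ^ ∑ i, k i with hH
  set S := (Finset.Ico s (s + L)).filter (fun n => pieceProd g β θ n ≠ 0) with hS
  have h1 : ‖∑ n ∈ Finset.Ico s (s + L), pieceProd g β θ n‖ₑ ≤ S.card := by
    rw [← Finset.sum_filter_ne_zero, ← ofReal_norm, ← ENNReal.ofReal_natCast]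
    refine ENNReal.ofReal_le_ofReal ((norm_sum_le _ _).trans ?_)
    refine (Finset.sum_le_card_nsmul _ _ 1 fun n _ => ?_).trans (by simp [hS])
    unfold pieceProd
    rw [norm_prod]
    exact Finset.prod_le_one (fun _ _ => norm_nonneg _) (fun i _ => (hg i).bound _)
  refine h1.trans ?_
  rcases S.eq_empty_or_nonempty with h0 | ⟨n₀, hn₀⟩
  · simp [h0]
  set W := (Finset.Ioo (-(H : ℕ) : ℤ) (H : ℕ)).filter
    (fun d : ℤ => ∀ i, ‖d • (β i : UnitAddCircle)‖ ≤ 2 * (2 ^ k i)⁻¹) with hW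
  have h2 : S.card ≤ W.card := by
    refine Finset.card_le_card_of_injOn (fun n => (n : ℤ) - n₀) ?_ ?_
    · intro n hn
      have hn : n ∈ S := hn
      simp only [hS, Finset.mem_filter, Finset.mem_Ico] at hn hn₀
      simp only [hW, Finset.coe_filter, Finset.mem_Ioo, Set.mem_ofPred_eq]
      refine ⟨by omega, fun i => ?_⟩
      obtain ⟨c, hc⟩ := (hg i).supp
      have a1 := hc _ (Finset.prod_ne_zero_iff.1 hn.2 i (Finset.mem_univ i))
      have a2 := hc _ (Finset.prod_ne_zero_iff.1 hn₀.2 i (Finset.mem_univ i))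
      set x := (n : ℝ) * β i + θ i - c
      set y := (n₀ : ℝ) * β i + θ i - c
      have e : ((n : ℤ) - n₀) • (β i : UnitAddCircle) =
          ((Int.fract x - Int.fract y : ℝ) : UnitAddCircle) := by
        rw [AddCircle.coe_sub, AddCircle.coe_fract, AddCircle.coe_fract, ← AddCircle.coe_sub,
          ← AddCircle.coe_zsmul]
        congr 1
        simp only [x, y, zsmul_eq_mul]
        push_cast; ring
      rw [e]
      refine (norm_coe_le_abs _).trans ?_
      have := Int.fract_nonneg x
      have := Int.fract_nonneg y
      rw [abs_le]; constructor <;> linarith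
    · intro a _ b _ h
      simpa using h
  calc (S.card : ENNReal) ≤ W.card := by exact_mod_cast h2
    _ = _ := by
      rw [hW, Finset.card_filter]
      push_cast
      unfold returnCount
      refine Finset.sum_congr (by simp [hH]) fun d _ => ?_
      simp [Set.indicator_apply]

lemma one_le_returnCount {t : ℕ} (k : Fin t → ℕ) (β : Fin t → UnitAddCircle) :
    1 ≤ returnCount k β := by
  unfold returnCount
  refine le_trans ?_ (Finset.single_le_sum (fun _ _ => zero_le) (a := (0 : ℤ)) ?_)
  · rw [Set.indicator_of_mem]
    · simp
    · intro i; simp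
  · simp

lemma fourier_one_sum {ι : Type*} (s : Finset ι) (x : ι → UnitAddCircle) :
    (fourier 1 (∑ i ∈ s, x i) : ℂ) = ∏ i ∈ s, (fourier 1 (x i) : ℂ) := by
  classical
  induction s using Finset.induction_on with
  | empty => simp
  | insert i s hi ih =>
    rw [Finset.sum_insert hi, Finset.prod_insert hi, ← ih]
    simp [fourier_apply, AddCircle.toCircle_add]

lemma fourier_natCast_mul_add (h : ℤ) (n : ℕ) (β θ : ℝ) :
    (fourier h ((n * β + θ : ℝ) : UnitAddCircle) : ℂ) =
      fourier h (θ : UnitAddCircle) * (fourier 1 (h • (β : UnitAddCircle)) : ℂ) ^ n := by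
  have : ((n * β + θ : ℝ) : UnitAddCircle) = n • (β : UnitAddCircle) + (θ : UnitAddCircle) := by
    rw [AddCircle.coe_add, ← nsmul_eq_mul, AddCircle.coe_nsmul]
  rw [this]
  simp only [fourier_apply, smul_add, AddCircle.toCircle_add, smul_comm h n,
    AddCircle.toCircle_nsmul, one_smul]
  push_cast
  ring

lemma hasSum_pieceProd {t : ℕ} {g : Fin t → ℝ → ℝ} {a : Fin t → ℤ → ℂ}
    (ha : ∀ i (x : ℝ), HasSum (fun h => a i h * fourier h (x : UnitAddCircle)) (g i x : ℂ))
    (β θ : Fin t → ℝ) (n : ℕ) :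
    HasSum (fun h : Fin t → ℤ => (∏ i, a i (h i) * fourier (h i) (θ i : UnitAddCircle)) *
      (fourier 1 (∑ i, h i • (β i : UnitAddCircle)) : ℂ) ^ n) (pieceProd g β θ n : ℂ) := by
  have := hasSum_pi_prod _ _ (fun i => ha i (n * β i + θ i))
  unfold pieceProd
  rw [Complex.ofReal_prod]
  convert this using 2 with h
  rw [fourier_one_sum, ← Finset.prod_pow, ← Finset.prod_mul_distrib]
  refine Finset.prod_congr rfl fun i _ => ?_
  rw [fourier_natCast_mul_add, mul_assoc]

lemma enorm_average_sub_le {t K : ℕ} {k : Fin t → ℕ} {g : Fin t → ℝ → ℝ} {m : Fin t → ℝ}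
    (hg : ∀ i, IsPiece K (k i) (g i) (m i)) (hk : ∀ i, k i ≤ K) (β θ : Fin t → ℝ) (M : ℕ) :
    ‖(((2 ^ ∑ i, k i : ℕ) : ℝ))⁻¹ * ∑ l ∈ Finset.range (2 ^ ∑ i, k i), ∑ n ∈ Finset.range M,
      pieceProd g β θ (n + l) - M * ∏ i, m i‖ₑ ≤
      frequencySum k (fun i => (β i : UnitAddCircle)) := by
  choose a ha0 ha1 ha2 ha using fun i => (hg i).fourier (hk i)
  set H := 2 ^ ∑ i, k i with hH
  have hHpos : 0 < H := by positivity
  set P : (Fin t → ℤ) → ℂ := fun h => ∏ i, a i (h i) * fourier (h i) (θ i : UnitAddCircle)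
  set w : (Fin t → ℤ) → UnitAddCircle := fun h => ∑ i, h i • (β i : UnitAddCircle)
  have h1 : HasSum (fun h => ((H : ℝ) : ℂ)⁻¹ * ∑ l ∈ Finset.range H, ∑ n ∈ Finset.range M,
      P h * (fourier 1 (w h) : ℂ) ^ (n + l))
      (((H : ℝ)⁻¹ * ∑ l ∈ Finset.range H, ∑ n ∈ Finset.range M,
        pieceProd g β θ (n + l) : ℝ) : ℂ) := by
    push_cast
    exact (hasSum_sum fun l _ => hasSum_sum fun n _ => hasSum_pieceProd ha β θ (n + l)).mul_left _
  have h2 := h1.sub (hasSum_ite_eq (0 : Fin t → ℤ) ((M : ℂ) * ∏ i, (m i : ℂ)))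
  have hC : ‖(H : ℝ)⁻¹ * ∑ l ∈ Finset.range H, ∑ n ∈ Finset.range M,
      pieceProd g β θ (n + l) - M * ∏ i, m i‖ₑ =
      ‖((((H : ℝ)⁻¹ * ∑ l ∈ Finset.range H, ∑ n ∈ Finset.range M,
        pieceProd g β θ (n + l) : ℝ) : ℂ) - (M : ℂ) * ∏ i, (m i : ℂ))‖ₑ := by
    rw [← ofReal_norm, ← ofReal_norm, ← Complex.norm_real]
    push_cast
    rfl
  rw [hC, ← h2.tsum_eq]
  refine (enorm_tsum_le_tsum_enorm).trans ?_
  unfold frequencySum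
  refine ENNReal.tsum_le_tsum fun h => ?_
  split_ifs with h0
  · subst h0
    have : ((H : ℝ) : ℂ) ≠ 0 := by exact_mod_cast hHpos.ne'
    simp only [P, w]
    have e1 : (fourier 1 (∑ i, (0 : Fin t → ℤ) i • (β i : UnitAddCircle)) : ℂ) = 1 := by simp
    have e2 : ∏ i, a i ((0 : Fin t → ℤ) i) * (fourier ((0 : Fin t → ℤ) i) (θ i : UnitAddCircle) : ℂ)
        = ∏ i, (m i : ℂ) := by
      refine Finset.prod_congr rfl fun i _ => ?_
      simp [ha0]
    simp_rw [e1, e2, one_pow, mul_one, Finset.sum_const, Finset.card_range, nsmul_eq_mul]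
    rw [Complex.ofReal_natCast] at this ⊢
    rw [inv_mul_cancel_left₀ this, sub_self, enorm_zero]
  · rw [sub_zero]
    have e : ((H : ℝ) : ℂ)⁻¹ * ∑ l ∈ Finset.range H, ∑ n ∈ Finset.range M,
        P h * (fourier 1 (w h) : ℂ) ^ (n + l) = P h * (((H : ℝ) : ℂ)⁻¹ *
          (∑ n ∈ Finset.range M, (fourier 1 (w h) : ℂ) ^ n) *
          ∑ n ∈ Finset.range H, (fourier 1 (w h) : ℂ) ^ n) := by
      simp_rw [pow_add, ← mul_assoc, ← Finset.sum_mul, ← Finset.mul_sum]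
      ring
    rw [e, enorm_mul]
    refine mul_le_mul' ?_ ?_
    · simp only [P]
      rw [← ofReal_norm, norm_prod, ENNReal.ofReal_prod_of_nonneg fun _ _ => norm_nonneg _]
      refine Finset.prod_le_prod' fun i _ => ?_
      rw [norm_mul, norm_fourier_apply, mul_one, ofReal_norm]
      exact enorm_le_coefBound (ha1 i _) (ha2 i _)
    · rw [enorm_mul, enorm_mul]
      refine le_trans (le_of_eq ?_) (dirichlet_le_kernelBound (w h) M hHpos)
      congr 2
      rw [← ofReal_norm, norm_inv, Complex.norm_real, Real.norm_natCast,
        ENNReal.ofReal_inv_of_pos (by exact_mod_cast hHpos), ENNReal.ofReal_natCast]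

lemma enorm_sum_sub_le {t K : ℕ} {k : Fin t → ℕ} {g : Fin t → ℝ → ℝ} {m : Fin t → ℝ}
    (hg : ∀ i, IsPiece K (k i) (g i) (m i)) (β θ : Fin t → ℝ) {M : ℕ} (hM : M ≤ 2 ^ K) :
    ‖∑ n ∈ Finset.range M, pieceProd g β θ n - M * ∏ i, m i‖ₑ ≤
      2 * (returnCount k (fun i => (β i : UnitAddCircle)) +
        frequencySum k (fun i => (β i : UnitAddCircle))) := by
  set Y := returnCount k (fun i => (β i : UnitAddCircle)) with hY
  set Z := frequencySum k (fun i => (β i : UnitAddCircle)) with hZ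
  set F := pieceProd g β θ
  have hwin := enorm_sum_window_le hg β θ
  have hY1 : 1 ≤ Y := one_le_returnCount _ _
  rcases le_or_gt M (2 ^ ∑ i, k i) with hle | hlt
  · have h1 : ‖∑ n ∈ Finset.range M, F n‖ₑ ≤ Y := by
      have := hwin 0 M hle
      rwa [zero_add, ← Finset.range_eq_Ico] at this
    have h2 : ‖(M : ℝ) * ∏ i, m i‖ₑ ≤ Y := by
      refine le_trans ?_ hY1
      rw [← ofReal_norm]
      refine ENNReal.ofReal_le_one.2 ?_
      rw [norm_mul, norm_prod, Real.norm_natCast]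
      calc (M : ℝ) * ∏ i, ‖m i‖ ≤ (2 ^ ∑ i, k i : ℕ) * ∏ i, ((2 : ℝ) ^ k i)⁻¹ := by
            refine mul_le_mul (by exact_mod_cast hle)
              (Finset.prod_le_prod (fun _ _ => norm_nonneg _) fun i _ => (hg i).mean)
              (Finset.prod_nonneg fun _ _ => norm_nonneg _) (by positivity)
        _ = 1 := by
            rw [Finset.prod_inv_distrib, Finset.prod_pow_eq_pow_sum]
            push_cast
            exact mul_inv_cancel₀ (by positivity)
    calc _ ≤ Y + Y := enorm_sub_le.trans (add_le_add h1 h2)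
      _ = 2 * Y := by ring
      _ ≤ _ := by gcongr; exact le_self_add
  · have hk : ∀ i, k i ≤ K := by
      intro i
      have h1 : 2 ^ k i ≤ 2 ^ ∑ i, k i :=
        Nat.pow_le_pow_right (by norm_num)
          (Finset.single_le_sum (f := k) (fun _ _ => Nat.zero_le _) (Finset.mem_univ i))
      exact (Nat.pow_le_pow_iff_right (by norm_num : 1 < 2)).1 (h1.trans (hlt.le.trans hM))
    set H := 2 ^ ∑ i, k i with hH
    have hHpos : (0 : ℝ) < H := by positivity
    set A := ((H : ℕ) : ℝ)⁻¹ * ∑ l ∈ Finset.range H, ∑ n ∈ Finset.range M, F (n + l) with hA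
    have h1 : ‖A - M * ∏ i, m i‖ₑ ≤ Z := enorm_average_sub_le hg hk β θ M
    have hshift (l : ℕ) (hl : l ∈ Finset.range H) :
        ‖∑ n ∈ Finset.range M, F n - ∑ n ∈ Finset.range M, F (n + l)‖ₑ ≤ 2 * Y := by
      have hl := (Finset.mem_range.1 hl).le
      have e : ∑ n ∈ Finset.range M, F n - ∑ n ∈ Finset.range M, F (n + l) =
          ∑ n ∈ Finset.Ico 0 (0 + l), F n - ∑ n ∈ Finset.Ico M (M + l), F n := by
        have e1 : ∑ n ∈ Finset.range M, F (n + l) = ∑ n ∈ Finset.Ico l (M + l), F n := by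
          rw [Finset.sum_Ico_eq_sum_range, Nat.add_sub_cancel]
          simp_rw [add_comm l]
        rw [e1, zero_add, Finset.sum_Ico_eq_sub _ (by omega), Finset.sum_Ico_eq_sub _ (by omega),
          Finset.sum_Ico_eq_sub _ (by omega)]
        simp
        ring
      rw [e]
      calc _ ≤ Y + Y := enorm_sub_le.trans (add_le_add (hwin _ _ hl) (hwin _ _ hl))
        _ = 2 * Y := by ring
    have h2 : ‖∑ n ∈ Finset.range M, F n - A‖ₑ ≤ 2 * Y := by
      have e : ∑ n ∈ Finset.range M, F n - A = (H : ℝ)⁻¹ * ∑ l ∈ Finset.range H,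
          (∑ n ∈ Finset.range M, F n - ∑ n ∈ Finset.range M, F (n + l)) := by
        rw [Finset.sum_sub_distrib, mul_sub, Finset.sum_const, Finset.card_range, nsmul_eq_mul,
          inv_mul_cancel_left₀ hHpos.ne']
      rw [e, enorm_mul]
      calc _ ≤ ‖(H : ℝ)⁻¹‖ₑ * ((H : ENNReal) * (2 * Y)) := by
            gcongr
            refine (enorm_sum_le _ _).trans ((Finset.sum_le_sum hshift).trans ?_)
            simp
        _ = 2 * Y := by
            rw [← mul_assoc, ← ofReal_norm, norm_inv, Real.norm_natCast,
              ENNReal.ofReal_inv_of_pos hHpos, ENNReal.ofReal_natCast,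
              ENNReal.inv_mul_cancel (by simp [hH]) (ENNReal.natCast_ne_top _), one_mul]
    calc _ = ‖(∑ n ∈ Finset.range M, F n - A) + (A - M * ∏ i, m i)‖ₑ := by congr 1; ring
      _ ≤ 2 * Y + Z := (enorm_add_le _ _).trans (add_le_add h2 h1)
      _ ≤ 2 * Y + 2 * Z := by gcongr; exact le_mul_of_one_le_left zero_le (by norm_num)
      _ = _ := by ring

lemma rpow_sum_le_sum_rpow {ι : Type*} (s : Finset ι) (f : ι → ℝ≥0∞) {p : ℝ} (hp : 0 < p)
    (hp1 : p ≤ 1) : (∑ i ∈ s, f i) ^ p ≤ ∑ i ∈ s, f i ^ p := by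
  classical
  induction s using Finset.induction_on with
  | empty => simp [hp]
  | insert i s hi ih =>
    rw [Finset.sum_insert hi, Finset.sum_insert hi]
    exact (ENNReal.rpow_add_le_add_rpow _ _ hp.le hp1).trans (by gcongr)

lemma rpow_tsum_le_tsum_rpow {ι : Type*} (f : ι → ℝ≥0∞) {p : ℝ} (hp : 0 < p) (hp1 : p ≤ 1) :
    (∑' i, f i) ^ p ≤ ∑' i, f i ^ p :=
  le_of_tendsto' (((ENNReal.continuous_rpow_const (y := p)).tendsto _).comp
    (ENNReal.summable (f := f)).hasSum)
    fun s => (rpow_sum_le_sum_rpow s f hp hp1).trans (ENNReal.sum_le_tsum s)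

lemma tsum_pi_prod {α : Type*} {t : ℕ} (f : Fin t → α → ℝ≥0∞) :
    ∑' h : Fin t → α, ∏ i, f i (h i) = ∏ i, ∑' n, f i n := by
  induction t with
  | zero => simp [tsum_fintype]
  | succ t ih =>
    rw [← (Fin.consEquiv (fun _ : Fin (t + 1) => α)).tsum_eq, Fin.prod_univ_succ, ← ih,
      ENNReal.tsum_prod']
    simp [Fin.prod_univ_succ, Fin.consEquiv, ENNReal.tsum_mul_left, ENNReal.tsum_mul_right]

lemma tsum_natAbs_le (f : ℕ → ℝ≥0∞) : ∑' h : ℤ, f h.natAbs ≤ 2 * ∑' n, f n := by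
  have h1 : HasSum (fun n : ℕ => f (n : ℤ).natAbs) (∑' n, f n) := by
    simpa using ENNReal.summable.hasSum
  have h2 : HasSum (fun n : ℕ => f (-((n : ℤ) + 1)).natAbs) (∑' n, f (n + 1)) := by
    convert (ENNReal.summable (f := fun n => f (n + 1))).hasSum using 3 with n
    omega
  rw [(HasSum.of_nat_of_neg_add_one (f := fun h : ℤ => f h.natAbs) h1 h2).tsum_eq, two_mul]
  refine add_le_add_right ?_ _
  exact ENNReal.tsum_comp_le_tsum_of_injective (add_left_injective 1) f

lemma tsum_profile_lt_top {p : ℝ} (hp : 1 / 2 < p) : ∑' m, profile m ^ p < ⊤ := by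
  rw [tsum_eq_zero_add' ENNReal.summable]
  refine ENNReal.add_lt_top.2 ⟨?_, ?_⟩
  · refine ENNReal.rpow_lt_top_of_nonneg (by linarith) (ne_top_of_le_ne_top ENNReal.one_ne_top ?_)
    exact min_le_left _ _
  · have hs : Summable fun n : ℕ => 1 / ((n : ℝ) + 1) ^ (2 * p) := by
      have := (Real.summable_one_div_nat_rpow (p := 2 * p)).2 (by linarith)
      simpa using (summable_nat_add_iff 1).2 this
    refine lt_of_le_of_lt (ENNReal.tsum_le_tsum fun n => ?_) hs.tsum_ofReal_lt_top
    have hn : (0 : ℝ) < (n : ℝ) + 1 := by positivity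
    calc profile (n + 1) ^ p ≤ ((((n + 1 : ℕ) : ℝ≥0∞) ^ 2)⁻¹) ^ p := by
          gcongr; exact min_le_right _ _
      _ = _ := by
          rw [one_div, ENNReal.ofReal_inv_of_pos (by positivity),
            ← ENNReal.ofReal_rpow_of_pos hn, ← ENNReal.rpow_natCast, ENNReal.inv_rpow,
            ← ENNReal.rpow_mul]
          congr 2
          rw [ENNReal.ofReal_add (by positivity) (by norm_num)]
          simp

lemma tsum_coefBound_le {p : ℝ} (hp : 0 < p) (k : ℕ) :
    ∑' h, coefBound k h ^ p ≤ ((2 ^ k : ℝ≥0∞) ^ (1 - p)) * (2 * ∑' m, profile m ^ p) := by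
  unfold coefBound
  have h2 : (2 : ℝ≥0∞) ^ k ≠ 0 := by simp
  have h2t : (2 : ℝ≥0∞) ^ k ≠ ⊤ := by simp
  refine (tsum_natAbs_le (fun n => ((2 ^ k)⁻¹ * profile (n / 2 ^ k)) ^ p)).trans (le_of_eq ?_)
  have : NeZero (2 ^ k) := ⟨by positivity⟩
  simp_rw [ENNReal.mul_rpow_of_nonneg _ _ hp.le]
  rw [ENNReal.tsum_mul_left, ← (Nat.divModEquiv (2 ^ k)).symm.tsum_eq, ENNReal.tsum_prod']
  have e : ∀ (m : ℕ) (r : Fin (2 ^ k)),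
      (Nat.divModEquiv (2 ^ k)).symm (m, r) / 2 ^ k = m := by
    intro m r
    have := congrArg Prod.fst ((Nat.divModEquiv (2 ^ k)).apply_symm_apply (m, r))
    simpa [Nat.divModEquiv] using this
  simp only [e, tsum_fintype, Finset.sum_const, Finset.card_univ, Fintype.card_fin, nsmul_eq_mul]
  rw [ENNReal.tsum_mul_left, ENNReal.rpow_sub _ _ h2 h2t, ENNReal.inv_rpow, ENNReal.rpow_one,
    div_eq_mul_inv]
  push_cast
  ring

lemma measurable_kernelBound (H : ℕ) : Measurable (kernelBound H) := by
  unfold kernelBound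
  fun_prop

/-- The normalised `p`-th moment of `kernelBound`. -/
noncomputable def kernelMoment (p : ℝ) : ℝ≥0∞ := ∫⁻ y : ℝ, (‖y‖ₑ⁻¹ * min 1 ‖y‖ₑ⁻¹) ^ p

lemma kernelMoment_lt_top {p : ℝ} (hp : 1 / 2 < p) (hp1 : p < 1) : kernelMoment p < ⊤ := by
  unfold kernelMoment
  set F : ℝ → ℝ≥0∞ := fun y => (‖y‖ₑ⁻¹ * min 1 ‖y‖ₑ⁻¹) ^ p with hF
  have hpos : ∀ y : ℝ, 0 < y → ‖y‖ₑ⁻¹ = ENNReal.ofReal y⁻¹ := by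
    intro y hy
    rw [ENNReal.ofReal_inv_of_pos hy, ← ofReal_norm, Real.norm_of_nonneg hy.le]
  have h1 : ∫⁻ y in Set.Ioc 0 1, F y < ⊤ := by
    have hi : IntegrableOn (fun y : ℝ => y ^ (-p)) (Set.Ioc 0 1) := by
      have := intervalIntegral.intervalIntegrable_rpow' (a := 0) (b := 1) (r := -p) (by linarith)
      rwa [intervalIntegrable_iff_integrableOn_Ioc_of_le zero_le_one] at this
    refine lt_of_le_of_lt (setLIntegral_mono' measurableSet_Ioc fun y hy => ?_)
      hi.lintegral_lt_top
    calc F y ≤ (‖y‖ₑ⁻¹ * 1) ^ p := by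
          simp only [hF]; gcongr; exact min_le_left _ _
      _ = _ := by
          rw [mul_one, hpos y hy.1, ENNReal.ofReal_rpow_of_pos (inv_pos.2 hy.1),
            Real.inv_rpow hy.1.le, Real.rpow_neg hy.1.le]
  have h2 : ∫⁻ y in Set.Ioi 1, F y < ⊤ := by
    have hi := integrableOn_Ioi_rpow_of_lt (a := -(2 * p)) (by linarith) (zero_lt_one (α := ℝ))
    refine lt_of_le_of_lt (setLIntegral_mono' measurableSet_Ioi fun y hy => ?_)
      hi.lintegral_lt_top
    have hy : (0 : ℝ) < y := zero_lt_one.trans hy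
    calc F y ≤ (‖y‖ₑ⁻¹ * ‖y‖ₑ⁻¹) ^ p := by
          simp only [hF]; gcongr; exact min_le_right _ _
      _ = _ := by
          rw [hpos y hy, ← ENNReal.ofReal_mul (by positivity),
            ENNReal.ofReal_rpow_of_pos (by positivity), Real.mul_rpow (by positivity) (by positivity),
            ← Real.rpow_add (by positivity), Real.inv_rpow hy.le, ← Real.rpow_neg hy.le]
          ring_nf
  have h3 : ∫⁻ y in Set.Ioi 0, F y < ⊤ := by
    rw [← Set.Ioc_union_Ioi_eq_Ioi zero_le_one]
    exact (lintegral_union_le _ _ _).trans_lt (ENNReal.add_lt_top.2 ⟨h1, h2⟩)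
  have h4 : ∫⁻ y in Set.Iio 0, F y < ⊤ := by
    have := (Measure.measurePreserving_neg (volume : Measure ℝ)).setLIntegral_comp_preimage
      (s := Set.Ioi 0) measurableSet_Ioi (f := F) (by simp only [hF]; fun_prop)
    simp only [hF, enorm_neg] at this h3 ⊢
    rw [← this] at h3
    simpa using h3
  rw [← lintegral_add_compl F (measurableSet_Ioi (a := (0 : ℝ))), Set.compl_Ioi,
    setLIntegral_congr Iio_ae_eq_Iic.symm]
  exact ENNReal.add_lt_top.2 ⟨h3, h4⟩

lemma lintegral_kernelBound_rpow_le {p : ℝ} (hp : 0 < p) {H : ℕ} (hH : 0 < H) :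
    ∫⁻ x, kernelBound H x ^ p ≤ ((H : ℝ≥0∞) ^ (1 - p))⁻¹ * kernelMoment p := by
  have hH0 : (H : ℝ≥0∞) ≠ 0 := by exact_mod_cast hH.ne'
  have hHt : (H : ℝ≥0∞) ≠ ⊤ := ENNReal.natCast_ne_top H
  have hHr : (H : ℝ) ≠ 0 := by exact_mod_cast hH.ne'
  set F : ℝ → ℝ≥0∞ := fun y => (‖y‖ₑ⁻¹ * min 1 ‖y‖ₑ⁻¹) ^ p with hF
  have hFm : Measurable F := by simp only [hF]; fun_prop
  have hscale : ∫⁻ y : ℝ, F (H * y) = (H : ℝ≥0∞)⁻¹ * kernelMoment p := by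
    rw [← lintegral_map (f := F) hFm (measurable_const_mul (H : ℝ)), Real.map_volume_mul_left hHr,
      lintegral_smul_measure]
    rw [abs_of_nonneg (by positivity), ENNReal.ofReal_inv_of_pos (by positivity),
      ENNReal.ofReal_natCast]
    rfl
  rw [← UnitAddCircle.lintegral_preimage (-(1 / 2))]
  calc ∫⁻ a in Set.Ioc (-(1 / 2) : ℝ) (-(1 / 2) + 1), kernelBound H (a : UnitAddCircle) ^ p
      ≤ ∫⁻ a in Set.Ioc (-(1 / 2) : ℝ) (-(1 / 2) + 1), (H : ℝ≥0∞) ^ p * F (H * a) := by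
        refine setLIntegral_mono' measurableSet_Ioc fun a ha => le_of_eq ?_
        have hn : ‖(a : UnitAddCircle)‖ₑ = ‖a‖ₑ := by
          rw [← ofReal_norm, ← ofReal_norm]
          congr 1
          rw [(AddCircle.norm_coe_eq_abs_iff 1 one_ne_zero).2, Real.norm_eq_abs]
          rw [abs_le, abs_one]; constructor <;> linarith [ha.1, ha.2]
        simp only [hF]
        rw [kernelBound, hn, ← ENNReal.mul_rpow_of_nonneg _ _ hp.le, enorm_mul]
        have : ‖(H : ℝ)‖ₑ = H := by simp
        rw [this, ENNReal.mul_inv (Or.inl hH0) (Or.inl hHt), ← mul_assoc, ← mul_assoc,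
          ENNReal.mul_inv_cancel hH0 hHt, one_mul]
    _ ≤ ∫⁻ a : ℝ, (H : ℝ≥0∞) ^ p * F (H * a) := setLIntegral_le_lintegral _ _
    _ = _ := by
      rw [lintegral_const_mul _ (by simp only [hF]; fun_prop), hscale, ← mul_assoc,
        ENNReal.rpow_sub _ _ hH0 hHt, ENNReal.rpow_one, ENNReal.inv_div (Or.inl (by
          exact ENNReal.rpow_ne_top_of_nonneg hp.le hHt)) (Or.inl (by
          simp [hH0, hHt])), div_eq_mul_inv]

lemma measurePreserving_zsmul_sum {t : ℕ} {h : Fin t → ℤ} (hh : h ≠ 0) :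
    MeasurePreserving (fun β : Fin t → UnitAddCircle => ∑ i, h i • β i) := by
  obtain ⟨j, hj⟩ := Function.ne_iff.1 hh
  let φ : (Fin t → UnitAddCircle) →+ UnitAddCircle :=
    { toFun := fun β => ∑ i, h i • β i
      map_zero' := by simp
      map_add' := fun x y => by simp [Finset.sum_add_distrib] }
  have hc : Continuous φ := by
    change Continuous fun β : Fin t → UnitAddCircle => ∑ i, h i • β i
    fun_prop
  refine AddMonoidHom.measurePreserving (f := φ) hc ?_ (by
    simp [volume_pi, Measure.pi_univ, AddCircle.measure_univ])
  intro y
  obtain ⟨x, rfl⟩ := QuotientAddGroup.mk_surjective y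
  refine ⟨Pi.single j ((x / h j : ℝ) : UnitAddCircle), ?_⟩
  change ∑ i, h i • (Pi.single j ((x / h j : ℝ) : UnitAddCircle) : Fin t → UnitAddCircle) i = _
  rw [Finset.sum_eq_single j (fun i _ hi => by simp [hi]) (by simp), Pi.single_eq_same,
    ← AddCircle.coe_zsmul, zsmul_eq_mul, mul_div_cancel₀ _ (by exact_mod_cast hj)]

lemma measurePreserving_zsmul_pi (t : ℕ) {m : ℤ} (hm : m ≠ 0) :
    MeasurePreserving (fun β : Fin t → UnitAddCircle => m • β) := by
  let φ : (Fin t → UnitAddCircle) →+ (Fin t → UnitAddCircle) := zsmulAddGroupHom m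
  have hc : Continuous φ := by
    change Continuous fun β : Fin t → UnitAddCircle => m • β
    fun_prop
  refine AddMonoidHom.measurePreserving (f := φ) hc ?_ rfl
  intro y
  choose x hx using fun i => QuotientAddGroup.mk_surjective (y i)
  refine ⟨fun i => ((x i / m : ℝ) : UnitAddCircle), ?_⟩
  funext i
  change m • ((x i / m : ℝ) : UnitAddCircle) = _
  rw [← hx i, ← AddCircle.coe_zsmul, zsmul_eq_mul, mul_div_cancel₀ _ (by exact_mod_cast hm)]

lemma measurableSet_norm_zsmul_le {t : ℕ} (r : Fin t → ℝ) (m : ℤ) :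
    MeasurableSet {γ : Fin t → UnitAddCircle | ∀ i, ‖m • γ i‖ ≤ r i} := by
  refine IsClosed.measurableSet ?_
  simp only [Set.ofPred_forall]
  exact isClosed_iInter fun i => isClosed_le (by fun_prop) continuous_const

lemma measurable_returnCount {t : ℕ} (k : Fin t → ℕ) : Measurable (returnCount k) := by
  unfold returnCount
  exact Finset.measurable_sum _ fun m _ =>
    measurable_one.indicator (measurableSet_norm_zsmul_le _ m)

lemma measurable_frequencySum {t : ℕ} (k : Fin t → ℕ) : Measurable (frequencySum k) := by
  unfold frequencySum
  refine Measurable.tsum fun h => ?_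
  split_ifs
  · exact measurable_const
  · exact ((measurable_kernelBound _).comp (by fun_prop)).const_mul _

lemma measure_norm_zsmul_le {t : ℕ} (k : Fin t → ℕ) (m : ℤ) :
    volume {γ : Fin t → UnitAddCircle | ∀ i, ‖m • γ i‖ ≤ 2 * (2 ^ k i)⁻¹} ≤
      (if m = 0 then 1 else 0) + 4 ^ t * (2 ^ ∑ i, k i)⁻¹ := by
  split_ifs with hm
  · refine le_trans (measure_mono (Set.subset_univ _)) (le_trans (le_of_eq ?_) le_self_add)
    simp [volume_pi, Measure.pi_univ, AddCircle.measure_univ]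
  · have h1 := (measurePreserving_zsmul_pi t hm).measure_preimage
      (measurableSet_norm_zsmul_le (fun i => 2 * (2 ^ k i)⁻¹) 1).nullMeasurableSet
    have e1 : (fun β : Fin t → UnitAddCircle => m • β) ⁻¹'
        {γ | ∀ i, ‖(1 : ℤ) • γ i‖ ≤ 2 * (2 ^ k i)⁻¹} =
        {γ | ∀ i, ‖m • γ i‖ ≤ 2 * (2 ^ k i)⁻¹} := by
      ext; simp
    have e2 : {γ : Fin t → UnitAddCircle | ∀ i, ‖(1 : ℤ) • γ i‖ ≤ 2 * (2 ^ k i)⁻¹} =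
        Set.univ.pi fun i => Metric.closedBall (0 : UnitAddCircle) (2 * (2 ^ k i)⁻¹) := by
      ext; simp
    rw [e1, e2] at h1
    rw [h1, volume_pi, Measure.pi_pi, zero_add]
    calc ∏ i, volume (Metric.closedBall (0 : UnitAddCircle) (2 * (2 ^ k i)⁻¹))
        ≤ ∏ i, (4 * (2 ^ k i : ℝ≥0∞)⁻¹) := by
          refine Finset.prod_le_prod' fun i _ => ?_
          rw [AddCircle.volume_closedBall]
          refine (ENNReal.ofReal_le_ofReal (min_le_right _ _)).trans (le_of_eq ?_)
          rw [← mul_assoc, ENNReal.ofReal_mul (by norm_num), ENNReal.ofReal_inv_of_pos (by positivity),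
            ENNReal.ofReal_pow (by norm_num)]
          norm_num
      _ = _ := by
          rw [Finset.prod_mul_distrib, Finset.prod_const, Finset.card_univ, Fintype.card_fin,
            ← Finset.prod_pow_eq_pow_sum, ENNReal.prod_inv_distrib]
          intro i _ j _ _
          simp

lemma lintegral_returnCount_le {t : ℕ} (k : Fin t → ℕ) :
    ∫⁻ β, returnCount k β ≤ 1 + 2 * 4 ^ t := by
  unfold returnCount
  rw [lintegral_finsetSum _ fun m _ =>
    measurable_one.indicator (measurableSet_norm_zsmul_le _ m)]
  simp_rw [lintegral_indicator_one (measurableSet_norm_zsmul_le _ _)]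
  refine (Finset.sum_le_sum fun m _ => measure_norm_zsmul_le k m).trans ?_
  rw [Finset.sum_add_distrib]
  refine add_le_add ?_ ?_
  · rw [Finset.sum_ite_eq']
    split_ifs <;> simp
  · rw [Finset.sum_const, nsmul_eq_mul, Int.card_Ioo]
    set H := 2 ^ ∑ i, k i with hH
    calc (((((H : ℕ) : ℤ) - -((H : ℕ) : ℤ) - 1).toNat : ℕ) : ℝ≥0∞) * (4 ^ t * (2 ^ ∑ i, k i)⁻¹)
        ≤ (2 * H : ℕ) * (4 ^ t * (2 ^ ∑ i, k i)⁻¹) := by gcongr; omega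
      _ = 2 * 4 ^ t * ((2 ^ ∑ i, k i) * (2 ^ ∑ i, k i)⁻¹) := by
          rw [hH]; push_cast; ring
      _ = 2 * 4 ^ t := by
          rw [ENNReal.mul_inv_cancel (by simp) (by simp), mul_one]

lemma lintegral_frequencySum_rpow_le {t : ℕ} (k : Fin t → ℕ) {p : ℝ} (hp : 0 < p) (hp1 : p < 1) :
    ∫⁻ β, frequencySum k β ^ p ≤ kernelMoment p * (2 * ∑' m, profile m ^ p) ^ t := by
  set H := 2 ^ ∑ i, k i with hH
  have hm (h : Fin t → ℤ) : Measurable fun β : Fin t → UnitAddCircle =>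
      kernelBound H (∑ i, h i • β i) ^ p :=
    ((measurable_kernelBound _).comp (by fun_prop)).pow_const _
  set f : (Fin t → ℤ) → (Fin t → UnitAddCircle) → ℝ≥0∞ := fun h β => if h = 0 then 0 else
    (∏ i, coefBound (k i) (h i)) ^ p * kernelBound H (∑ i, h i • β i) ^ p with hf
  calc ∫⁻ β, frequencySum k β ^ p ≤ ∫⁻ β, ∑' h, f h β := by
        refine lintegral_mono fun β => ?_
        refine (rpow_tsum_le_tsum_rpow _ hp hp1.le).trans (ENNReal.tsum_le_tsum fun h => ?_)
        simp only [hf]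
        split_ifs
        · simp [hp]
        · rw [ENNReal.mul_rpow_of_nonneg _ _ hp.le]
    _ = ∑' h, ∫⁻ β, f h β := by
        refine lintegral_tsum fun h => ?_
        simp only [hf]
        split_ifs
        · exact aemeasurable_const
        · exact ((hm h).const_mul _).aemeasurable
    _ ≤ ∑' h : Fin t → ℤ, (∏ i, coefBound (k i) (h i) ^ p) *
          (((H : ℝ≥0∞) ^ (1 - p))⁻¹ * kernelMoment p) := by
        refine ENNReal.tsum_le_tsum fun h => ?_
        simp only [hf]
        split_ifs with h0
        · simp
        · rw [lintegral_const_mul _ (hm h), ENNReal.prod_rpow_of_nonneg hp.le]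
          gcongr
          rw [(measurePreserving_zsmul_sum h0).lintegral_comp
            (f := fun x => kernelBound H x ^ p) ((measurable_kernelBound H).pow_const _)]
          exact lintegral_kernelBound_rpow_le hp (by positivity)
    _ = (∏ i, ∑' n, coefBound (k i) n ^ p) * (((H : ℝ≥0∞) ^ (1 - p))⁻¹ * kernelMoment p) := by
        rw [ENNReal.tsum_mul_right, tsum_pi_prod (fun i n => coefBound (k i) n ^ p)]
    _ ≤ (∏ i, ((2 ^ k i : ℝ≥0∞) ^ (1 - p)) * (2 * ∑' m, profile m ^ p)) *
          (((H : ℝ≥0∞) ^ (1 - p))⁻¹ * kernelMoment p) := by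
        gcongr
        exact tsum_coefBound_le hp _
    _ = ((H : ℝ≥0∞) ^ (1 - p) * ((H : ℝ≥0∞) ^ (1 - p))⁻¹) *
          (kernelMoment p * (2 * ∑' m, profile m ^ p) ^ t) := by
        rw [Finset.prod_mul_distrib, Finset.prod_const, Finset.card_univ, Fintype.card_fin,
          ENNReal.prod_rpow_of_nonneg (by linarith), Finset.prod_pow_eq_pow_sum]
        have : ((H : ℕ) : ℝ≥0∞) = 2 ^ ∑ i, k i := by simp [hH]
        rw [this]
        ring
    _ = _ := by
        rw [ENNReal.mul_inv_cancel, one_mul]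
        · simp [hH]
        · exact ENNReal.rpow_ne_top_of_nonneg (by linarith) (ENNReal.natCast_ne_top _)

/-- The random bound attached to the scales `k`. -/
noncomputable def levelBound {t : ℕ} (k : Fin t → ℕ) (β : Fin t → UnitAddCircle) : ℝ≥0∞ :=
  returnCount k β + frequencySum k β

lemma measurable_levelBound {t : ℕ} (k : Fin t → ℕ) : Measurable (levelBound k) :=
  (measurable_returnCount k).add (measurable_frequencySum k)

lemma exists_lintegral_levelBound_rpow_le (t : ℕ) {p : ℝ} (hp : 1 / 2 < p) (hp1 : p < 1) :
    ∃ C < ⊤, ∀ (k : Fin t → ℕ) (q : ℕ), 0 < q → ∫⁻ β, levelBound k (q • β) ^ p ≤ C := by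
  have hp0 : 0 < p := by linarith
  refine ⟨1 + 2 * 4 ^ t + kernelMoment p * (2 * ∑' m, profile m ^ p) ^ t, ?_, ?_⟩
  · refine ENNReal.add_lt_top.2 ⟨?_, ENNReal.mul_lt_top (kernelMoment_lt_top hp hp1)
      (ENNReal.pow_lt_top (ENNReal.mul_lt_top (by simp) (tsum_profile_lt_top hp)))⟩
    exact ENNReal.add_lt_top.2 ⟨by simp, ENNReal.mul_lt_top (by simp)
      (ENNReal.pow_lt_top (by simp))⟩
  · intro k q hq
    have h1 := (measurePreserving_zsmul_pi t (m := q) (by exact_mod_cast hq.ne')).lintegral_comp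
      (f := fun β => levelBound k β ^ p) ((measurable_levelBound k).pow_const p)
    simp only [natCast_zsmul] at h1
    rw [h1]
    calc ∫⁻ β, levelBound k β ^ p ≤ ∫⁻ β, (returnCount k β + frequencySum k β ^ p) := by
          refine lintegral_mono fun β => ?_
          refine (ENNReal.rpow_add_le_add_rpow _ _ hp0.le hp1.le).trans ?_
          gcongr
          calc returnCount k β ^ p ≤ returnCount k β ^ (1 : ℝ) :=
                ENNReal.rpow_le_rpow_of_exponent_le (one_le_returnCount k β) hp1.le
            _ = _ := ENNReal.rpow_one _
      _ = _ := lintegral_add_left (measurable_returnCount k) _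
      _ ≤ _ := add_le_add (lintegral_returnCount_le k) (lintegral_frequencySum_rpow_le k hp0 hp1)

/-- A summable weight on multi-indices. -/
noncomputable def indexWeight (η : ℝ) {s : ℕ} (κ : Fin s → ℕ) : ℝ≥0∞ :=
  ∏ j, (((κ j + 1 : ℕ) : ℝ≥0∞) ^ (1 + η))⁻¹

lemma tsum_indexWeight_lt_top {η : ℝ} (hη : 0 < η) (s : ℕ) :
    ∑' κ : Fin s → ℕ, indexWeight η κ < ⊤ := by
  unfold indexWeight
  rw [tsum_pi_prod fun _ n => (((n + 1 : ℕ) : ℝ≥0∞) ^ (1 + η))⁻¹]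
  refine ENNReal.prod_lt_top fun _ _ => ?_
  have hs : Summable fun n : ℕ => 1 / ((n : ℝ) + 1) ^ (1 + η) := by
    have := (Real.summable_one_div_nat_rpow (p := 1 + η)).2 (by linarith)
    simpa using (summable_nat_add_iff 1).2 this
  refine lt_of_le_of_lt (ENNReal.tsum_le_tsum fun n => le_of_eq ?_) hs.tsum_ofReal_lt_top
  have hn : (0 : ℝ) < (n : ℝ) + 1 := by positivity
  rw [one_div, ENNReal.ofReal_inv_of_pos (by positivity), ← ENNReal.ofReal_rpow_of_pos hn,
    ENNReal.ofReal_add (by positivity) (by norm_num)]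
  simp

lemma one_le_indexWeight_mul {η : ℝ} (hη : 0 < η) {s K : ℕ} {κ : Fin s → ℕ}
    (hκ : ∀ j, κ j < K) :
    1 ≤ indexWeight η κ * (((K : ℕ) : ℝ≥0∞) ^ (1 + η)) ^ s := by
  unfold indexWeight
  have e : (((K : ℕ) : ℝ≥0∞) ^ (1 + η)) ^ s = ∏ _j : Fin s, ((K : ℕ) : ℝ≥0∞) ^ (1 + η) := by simp
  rw [e, ← Finset.prod_mul_distrib]
  refine Finset.one_le_prod' fun j _ => ?_
  rw [mul_comm, ← div_eq_mul_inv, ENNReal.le_div_iff_mul_le, one_mul]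
  · gcongr
    exact_mod_cast hκ j
  · left
    rw [Ne, ENNReal.rpow_eq_zero_iff]
    simp
  · right
    simp [ENNReal.rpow_eq_top_iff]
    have := hκ j
    omega

lemma ae_exists_sum_le {Ω : Type*} [MeasurableSpace Ω] (μ : Measure Ω) {s t : ℕ}
    (X : (Fin s → ℕ) → (Fin t → ℕ) → Ω → ℝ≥0∞) (hXm : ∀ κ k, Measurable (X κ k))
    (hX : ∀ p : ℝ, 1 / 2 < p → p < 1 → ∃ C < ⊤, ∀ κ k, ∫⁻ ω, X κ k ω ^ p ∂μ ≤ C) :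
    ∀ᵐ ω ∂μ, ∀ ε > (0 : ℝ), ∃ C < ⊤, ∀ K : ℕ,
      ∑ κ ∈ Fintype.piFinset fun _ : Fin s => Finset.range (K + 1),
        ∑ k ∈ Fintype.piFinset fun _ : Fin t => Finset.range (K + 2), X κ k ω ≤
      C * ((K + 2 : ℕ) : ℝ≥0∞) ^ ((s : ℝ) + t + ε) := by
  set δ : ℕ → ℝ := fun n => 1 / ((n : ℝ) + 3) with hδ
  have hδ0 (n) : 0 < δ n := by simp only [hδ]; positivity
  have hδ1 (n) : δ n ≤ 1 / 3 := by
    simp only [hδ]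
    exact one_div_le_one_div_of_le (by norm_num) (by linarith [(Nat.cast_nonneg n : (0 : ℝ) ≤ n)])
  have hfin (n : ℕ) : ∀ᵐ ω ∂μ, ∑' κ : Fin s → ℕ, ∑' k : Fin t → ℕ,
      X κ k ω ^ (1 - δ n) * (indexWeight (δ n) κ * indexWeight (δ n) k) < ⊤ := by
    obtain ⟨C, hC, hXC⟩ := hX (1 - δ n) (by linarith [hδ1 n]) (by linarith [hδ0 n])
    have hm (κ k) : Measurable fun ω =>
        X κ k ω ^ (1 - δ n) * (indexWeight (δ n) κ * indexWeight (δ n) k) :=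
      ((hXm κ k).pow_const _).mul_const _
    refine ae_lt_top (Measurable.tsum fun κ => Measurable.tsum fun k => hm κ k) (ne_of_lt ?_)
    rw [lintegral_tsum fun κ => (Measurable.tsum fun k => hm κ k).aemeasurable]
    simp_rw [lintegral_tsum fun k => (hm _ k).aemeasurable]
    calc _ ≤ ∑' κ : Fin s → ℕ, ∑' k : Fin t → ℕ,
          C * (indexWeight (δ n) κ * indexWeight (δ n) k) := by
          refine ENNReal.tsum_le_tsum fun κ => ENNReal.tsum_le_tsum fun k => ?_
          rw [lintegral_mul_const _ ((hXm κ k).pow_const _)]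
          gcongr
          exact hXC κ k
      _ = C * ((∑' κ : Fin s → ℕ, indexWeight (δ n) κ) * ∑' k : Fin t → ℕ, indexWeight (δ n) k) := by
          simp_rw [ENNReal.tsum_mul_left, ENNReal.tsum_mul_right]
      _ < ⊤ := ENNReal.mul_lt_top hC (ENNReal.mul_lt_top (tsum_indexWeight_lt_top (hδ0 n) s)
          (tsum_indexWeight_lt_top (hδ0 n) t))
  filter_upwards [ae_all_iff.2 hfin] with ω hω ε hε
  obtain ⟨n, hn⟩ := exists_nat_ge (3 * ((s : ℝ) + t) / ε)
  set d := δ n with hd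
  have hd0 := hδ0 n
  have hd1 := hδ1 n
  have hp : 0 < 1 - d := by linarith
  have hexp : ((s : ℝ) + t) * (1 + d) * (1 - d)⁻¹ ≤ s + t + ε := by
    have h1 : (1 + d) * (1 - d)⁻¹ ≤ 1 + 3 * d := by
      rw [← div_eq_mul_inv, div_le_iff₀ hp]; nlinarith
    have h2 : 3 * ((s : ℝ) + t) * d ≤ ε := by
      rw [div_le_iff₀ hε] at hn
      rw [hd]; simp only [hδ]
      rw [mul_one_div, div_le_iff₀ (by positivity)]
      nlinarith
    have h3 : 0 ≤ (s : ℝ) + t := by positivity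
    nlinarith [mul_le_mul_of_nonneg_left h1 h3]
  set T := ∑' κ : Fin s → ℕ, ∑' k : Fin t → ℕ,
      X κ k ω ^ (1 - d) * (indexWeight d κ * indexWeight d k) with hT
  refine ⟨T ^ (1 - d)⁻¹, ENNReal.rpow_lt_top_of_nonneg (by positivity) (hω n).ne, fun K => ?_⟩
  set L : ℝ≥0∞ := ((K + 2 : ℕ) : ℝ≥0∞) with hL
  have hL1 : 1 ≤ L := by rw [hL]; exact_mod_cast (by omega : 1 ≤ K + 2)
  set A := Fintype.piFinset fun _ : Fin s => Finset.range (K + 1)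
  set B := Fintype.piFinset fun _ : Fin t => Finset.range (K + 2)
  have key : (∑ κ ∈ A, ∑ k ∈ B, X κ k ω) ^ (1 - d) ≤ T * L ^ (((s : ℝ) + t) * (1 + d)) := by
    calc (∑ κ ∈ A, ∑ k ∈ B, X κ k ω) ^ (1 - d) ≤ ∑ κ ∈ A, ∑ k ∈ B, X κ k ω ^ (1 - d) :=
          (rpow_sum_le_sum_rpow _ _ hp (by linarith)).trans
            (Finset.sum_le_sum fun κ _ => rpow_sum_le_sum_rpow _ _ hp (by linarith))
      _ ≤ ∑ κ ∈ A, ∑ k ∈ B, X κ k ω ^ (1 - d) * (indexWeight d κ * indexWeight d k) *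
            L ^ (((s : ℝ) + t) * (1 + d)) := by
          refine Finset.sum_le_sum fun κ hκ => Finset.sum_le_sum fun k hk => ?_
          have h1 := one_le_indexWeight_mul hd0 (K := K + 2) (κ := κ) fun j => by
            have := Finset.mem_range.1 (Fintype.mem_piFinset.1 hκ j); omega
          have h2 := one_le_indexWeight_mul hd0 (K := K + 2) (κ := k) fun j =>
            Finset.mem_range.1 (Fintype.mem_piFinset.1 hk j)
          have h3 := mul_le_mul' h1 h2
          rw [one_mul, mul_mul_mul_comm, ← pow_add, ← ENNReal.rpow_natCast, ← ENNReal.rpow_mul,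
            mul_comm (1 + d)] at h3
          push_cast at h3 hL
          rw [← hL] at h3
          calc X κ k ω ^ (1 - d) = X κ k ω ^ (1 - d) * 1 := (mul_one _).symm
            _ ≤ _ := by rw [mul_assoc]; gcongr
      _ = (∑ κ ∈ A, ∑ k ∈ B, X κ k ω ^ (1 - d) * (indexWeight d κ * indexWeight d k)) *
            L ^ (((s : ℝ) + t) * (1 + d)) := by
          simp_rw [Finset.sum_mul]
      _ ≤ _ := by
          gcongr
          exact (Finset.sum_le_sum fun κ _ => ENNReal.sum_le_tsum B).trans (ENNReal.sum_le_tsum A)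
  calc _ = ((∑ κ ∈ A, ∑ k ∈ B, X κ k ω) ^ (1 - d)) ^ (1 - d)⁻¹ := by
        rw [← ENNReal.rpow_mul, mul_inv_cancel₀ hp.ne', ENNReal.rpow_one]
    _ ≤ (T * L ^ (((s : ℝ) + t) * (1 + d))) ^ (1 - d)⁻¹ := by gcongr
    _ = T ^ (1 - d)⁻¹ * L ^ (((s : ℝ) + t) * (1 + d) * (1 - d)⁻¹) := by
        rw [ENNReal.mul_rpow_of_nonneg _ _ (by positivity), ← ENNReal.rpow_mul]
    _ ≤ _ := by
        gcongr

lemma sum_range_prod_mod {s : ℕ} (Q : Fin s → ℕ) (hQ : ∀ j, 0 < Q j)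
    (hcop : ∀ i j, i ≠ j → Nat.Coprime (Q i) (Q j)) (f : Fin s → ℕ → ℝ) :
    ∑ a ∈ Finset.range (∏ j, Q j), ∏ j, f j (a % Q j) = ∏ j, ∑ a ∈ Finset.range (Q j), f j a := by
  classical
  rw [Finset.prod_univ_sum]
  have hinj : Set.InjOn (fun (n : ℕ) (j : Fin s) => n % Q j) (Finset.range (∏ j, Q j)) := by
    intro n hn m hm h
    have h1 : ∀ j, (Q j : ℤ) ∣ (m : ℤ) - n := fun j =>
      (Nat.modEq_iff_dvd).1 (congrFun h j)
    have h2 : (∏ j, (Q j : ℤ)) ∣ (m : ℤ) - n :=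
      Fintype.prod_dvd_of_coprime (fun i j hij => (hcop i j hij).isCoprime) h1
    have h3 : n ≡ m [MOD ∏ j, Q j] := by
      rw [Nat.modEq_iff_dvd]; exact_mod_cast h2
    exact Nat.ModEq.eq_of_lt_of_lt h3 (by simpa using hn) (by simpa using hm)
  have himg : (Finset.range (∏ j, Q j)).image (fun (n : ℕ) (j : Fin s) => n % Q j) =
      Fintype.piFinset fun j => Finset.range (Q j) := by
    refine Finset.eq_of_subset_of_card_le ?_ ?_
    · intro x hx
      obtain ⟨n, -, rfl⟩ := Finset.mem_image.1 hx
      exact Fintype.mem_piFinset.2 fun j => Finset.mem_range.2 (Nat.mod_lt _ (hQ j))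
    · rw [Finset.card_image_of_injOn hinj]
      simp
  rw [← himg, Finset.sum_image hinj]

lemma sum_filter_mod_eq (N q a : ℕ) (ha : a < q) (G : ℕ → ℝ) :
    ∑ n ∈ (Finset.range N).filter (fun n => n % q = a), G n =
      ∑ m ∈ Finset.range ((N + (q - 1 - a)) / q), G (a + q * m) := by
  have hq : 0 < q := by omega
  have key (m : ℕ) : m < (N + (q - 1 - a)) / q ↔ a + q * m < N := by
    rw [← Nat.succ_le_iff, Nat.le_div_iff_mul_le hq, Nat.succ_mul, mul_comm m]
    omega
  refine Finset.sum_nbij' (fun n => n / q) (fun m => a + q * m) ?_ ?_ ?_ ?_ ?_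
  · intro n hn
    simp only [Finset.mem_filter, Finset.mem_range] at hn ⊢
    rw [key, ← hn.2, Nat.mod_add_div]
    exact hn.1
  · intro m hm
    simp only [Finset.mem_filter, Finset.mem_range] at hm ⊢
    exact ⟨(key m).1 hm, by rw [Nat.add_mul_mod_self_left, Nat.mod_eq_of_lt ha]⟩
  · intro n hn
    simp only [Finset.mem_filter, Finset.mem_range] at hn
    rw [← hn.2, Nat.mod_add_div]
  · intro m _
    rw [Nat.add_mul_div_left _ _ hq, Nat.div_eq_of_lt ha, zero_add]
  · intro n hn
    simp only [Finset.mem_filter, Finset.mem_range] at hn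
    rw [← hn.2, Nat.mod_add_div]

lemma abs_sum_progression_sub_le {t K : ℕ} {k : Fin t → ℕ} {g : Fin t → ℝ → ℝ} {m : Fin t → ℝ}
    (hg : ∀ i, IsPiece K (k i) (g i) (m i)) (α : Fin t → ℝ) {N q a : ℕ} (hN : N ≤ 2 ^ K)
    (ha : a < q) {E : ℝ} (hE1 : 1 ≤ E)
    (hE : levelBound k (q • fun i => (α i : UnitAddCircle)) ≤ ENNReal.ofReal E) :
    |∑ n ∈ (Finset.range N).filter (fun n => n % q = a), pieceProd g α 0 n -
      (N : ℝ) / q * ∏ i, m i| ≤ 3 * E := by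
  have hq : 0 < q := by omega
  have hq' : (0 : ℝ) < q := by exact_mod_cast hq
  rw [sum_filter_mod_eq N q a ha]
  set M := (N + (q - 1 - a)) / q with hM
  have hM1 : M * q ≤ N + (q - 1 - a) := Nat.div_mul_le_self _ _
  have hM2 : N + (q - 1 - a) < (M + 1) * q := by
    rw [mul_comm]; exact Nat.lt_mul_div_succ _ hq
  have hMN : M ≤ N := by
    by_contra h
    have : (N + 1) * q ≤ M * q := Nat.mul_le_mul_right _ (by omega)
    rw [Nat.add_mul, one_mul] at this
    have := Nat.le_mul_of_pos_right N hq
    omega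
  have e : ∀ n, pieceProd g α 0 (a + q * n) =
      pieceProd g (fun i => q * α i) (fun i => a * α i) n := by
    intro n
    unfold pieceProd
    refine Finset.prod_congr rfl fun i _ => ?_
    congr 1
    push_cast
    simp; ring
  simp_rw [e]
  have h1 := enorm_sum_sub_le hg (fun i => q * α i) (fun i => a * α i) (hMN.trans hN)
  have e2 : (fun i => ((q * α i : ℝ) : UnitAddCircle)) =
      q • fun i => (α i : UnitAddCircle) := by
    funext i
    rw [Pi.smul_apply, ← AddCircle.coe_nsmul, nsmul_eq_mul]
  rw [e2] at h1
  have h2 : |∑ n ∈ Finset.range M, pieceProd g (fun i => q * α i) (fun i => a * α i) n -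
      M * ∏ i, m i| ≤ 2 * E := by
    have := h1.trans (mul_le_mul_right hE 2)
    rw [← ofReal_norm, ← ENNReal.ofReal_ofNat 2, ← ENNReal.ofReal_mul (by norm_num),
      ENNReal.ofReal_le_ofReal_iff (by positivity)] at this
    exact this
  have h3 : |(M : ℝ) - N / q| ≤ 1 := by
    have a1 : (M : ℝ) * q ≤ N + q := by exact_mod_cast (by omega : M * q ≤ N + q)
    have a2 : (N : ℝ) ≤ (M + 1) * q := by exact_mod_cast (by omega : N ≤ (M + 1) * q)
    rw [abs_le]
    constructor
    · have : (N : ℝ) / q ≤ M + 1 := by rw [div_le_iff₀ hq']; exact a2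
      linarith
    · have : (M : ℝ) - 1 ≤ N / q := by rw [le_div_iff₀ hq']; linarith
      linarith
  have h4 : |∏ i, m i| ≤ 1 := by
    rw [Finset.abs_prod]
    refine Finset.prod_le_one (fun _ _ => abs_nonneg _) fun i _ => (hg i).mean.trans ?_
    exact inv_le_one_of_one_le₀ (one_le_pow₀ (by norm_num))
  have h5 : |((M : ℝ) - N / q) * ∏ i, m i| ≤ 1 := by
    rw [abs_mul]; exact mul_le_one₀ h3 (abs_nonneg _) h4
  have := abs_add_le (∑ n ∈ Finset.range M, pieceProd g (fun i => q * α i) (fun i => a * α i) n -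
      M * ∏ i, m i) (((M : ℝ) - N / q) * ∏ i, m i)
  rw [show ∀ S P : ℝ, S - M * P + ((M : ℝ) - N / q) * P = S - N / q * P by intros; ring] at this
  linarith

lemma abs_sum_mod_mul_sub_le {s t K : ℕ} (Q : Fin s → ℕ) (hQ : ∀ j, 0 < Q j)
    (hcop : ∀ i j, i ≠ j → Nat.Coprime (Q i) (Q j)) (f : Fin s → ℕ → ℝ)
    {k : Fin t → ℕ} {g : Fin t → ℝ → ℝ} {m : Fin t → ℝ}
    (hg : ∀ i, IsPiece K (k i) (g i) (m i)) (α : Fin t → ℝ) {N : ℕ} (hN : N ≤ 2 ^ K)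
    {E : ℝ} (hE1 : 1 ≤ E)
    (hE : levelBound k ((∏ j, Q j) • fun i => (α i : UnitAddCircle)) ≤ ENNReal.ofReal E) :
    |∑ n ∈ Finset.range N, (∏ j, f j (n % Q j)) * pieceProd g α 0 n -
      N * ((∏ j, ∑ a ∈ Finset.range (Q j), f j a / Q j) * ∏ i, m i)| ≤
      (∏ j, ∑ a ∈ Finset.range (Q j), |f j a|) * (3 * E) := by
  set q := ∏ j, Q j with hq
  have hq0 : 0 < q := Finset.prod_pos fun j _ => hQ j
  have e1 : ∑ n ∈ Finset.range N, (∏ j, f j (n % Q j)) * pieceProd g α 0 n =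
      ∑ a ∈ Finset.range q, (∏ j, f j (a % Q j)) *
        ∑ n ∈ (Finset.range N).filter (fun n => n % q = a), pieceProd g α 0 n := by
    rw [← Finset.sum_fiberwise_of_maps_to (s := Finset.range N) (t := Finset.range q)
      (g := fun n => n % q) fun n _ => Finset.mem_range.2 (Nat.mod_lt _ hq0)]
    refine Finset.sum_congr rfl fun a _ => ?_
    rw [Finset.mul_sum]
    refine Finset.sum_congr rfl fun n hn => ?_
    congr 1
    refine Finset.prod_congr rfl fun j _ => ?_
    rw [← (Finset.mem_filter.1 hn).2, Nat.mod_mod_of_dvd _ (Finset.dvd_prod_of_mem Q (Finset.mem_univ j))]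
  have e2 : ∏ j, ∑ a ∈ Finset.range (Q j), f j a / Q j =
      (∑ a ∈ Finset.range q, ∏ j, f j (a % Q j)) / q := by
    rw [sum_range_prod_mod Q hQ hcop, hq]
    simp_rw [← Finset.sum_div]
    rw [Finset.prod_div_distrib]
    push_cast
    rfl
  rw [e1, e2, show ∀ S P : ℝ, (N : ℝ) * (S / q * P) = S * (N / q * P) by intros; ring,
    Finset.sum_mul, ← Finset.sum_sub_distrib]
  simp_rw [← mul_sub]
  refine (Finset.abs_sum_le_sum_abs _ _).trans ?_
  rw [← sum_range_prod_mod Q hQ hcop fun j a => |f j a|, ← hq, Finset.sum_mul]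
  refine Finset.sum_le_sum fun a ha => ?_
  rw [abs_mul, Finset.abs_prod]
  exact mul_le_mul_of_nonneg_left
    (abs_sum_progression_sub_le hg α hN (Finset.mem_range.1 ha) hE1 hE)
    (Finset.prod_nonneg fun _ _ => abs_nonneg _)

lemma abs_prod_sub_prod_le {ι : Type*} (S : Finset ι) (x y : ι → ℝ) {e : ℝ} (he : 0 ≤ e)
    (hx : ∀ i, |x i| ≤ 2) (hy : ∀ i, |y i| ≤ 2) (hxy : ∀ i, |x i - y i| ≤ e) :
    |∏ i ∈ S, x i - ∏ i ∈ S, y i| ≤ S.card * 2 ^ S.card * e := by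
  classical
  induction S using Finset.induction_on with
  | empty => simp
  | insert i S hi ih =>
    rw [Finset.prod_insert hi, Finset.prod_insert hi, Finset.card_insert_of_notMem hi]
    have hY : |∏ i ∈ S, y i| ≤ 2 ^ S.card := by
      rw [Finset.abs_prod, ← Finset.prod_const]
      exact Finset.prod_le_prod (fun _ _ => abs_nonneg _) fun i _ => hy i
    have h1 : |x i * (∏ i ∈ S, x i - ∏ i ∈ S, y i)| ≤ 2 * (S.card * 2 ^ S.card * e) := by
      rw [abs_mul]; exact mul_le_mul (hx i) ih (abs_nonneg _) (by norm_num)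
    have h2 : |(x i - y i) * ∏ i ∈ S, y i| ≤ e * 2 ^ S.card := by
      rw [abs_mul]; exact mul_le_mul (hxy i) hY (abs_nonneg _) he
    have h3 := abs_add_le (x i * (∏ i ∈ S, x i - ∏ i ∈ S, y i)) ((x i - y i) * ∏ i ∈ S, y i)
    rw [show x i * (∏ i ∈ S, x i - ∏ i ∈ S, y i) + (x i - y i) * ∏ i ∈ S, y i =
      x i * ∏ i ∈ S, x i - y i * ∏ i ∈ S, y i by ring] at h3
    have h4 : 0 ≤ e * 2 ^ S.card := by positivity
    push_cast
    rw [pow_succ]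
    nlinarith

/-- The constant in the local discrepancy bound. -/
noncomputable def boxConst {s : ℕ} (b : Fin s → ℕ) (t : ℕ) : ℝ :=
  2 ^ t * ((∏ j, (2 * b j : ℝ)) * 3) + s * 2 ^ s * 2

open Classical in
lemma abs_sum_indicator_sub_le {s t : ℕ} {b : Fin s → ℕ} (hb : ∀ i, 2 ≤ b i)
    (hcop : ∀ i j, i ≠ j → Nat.Coprime (b i) (b j)) (α : Fin t → ℝ) {N K : ℕ} (hN2 : 2 ≤ N)
    (hN : N ≤ 2 ^ K) (E : (Fin s → ℕ) → (Fin t → ℕ) → ℝ) (hE1 : ∀ κ k, 1 ≤ E κ k)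
    (hE : ∀ κ ∈ Fintype.piFinset fun _ : Fin s => Finset.range (K + 1),
      ∀ k ∈ Fintype.piFinset fun _ : Fin t => Finset.range (K + 2),
      levelBound k ((∏ j, b j ^ κ j) • fun i => (α i : UnitAddCircle)) ≤ ENNReal.ofReal (E κ k))
    (u v : Fin s → ℝ) (huv : ∀ j, 0 ≤ u j ∧ u j ≤ v j ∧ v j ≤ 1)
    (x y : Fin t → ℝ) (hxy : ∀ i, 0 ≤ x i ∧ x i ≤ y i ∧ y i ≤ 1) :
    |∑ n ∈ Finset.range N, (∏ j, if u j ≤ radInv (b j) n ∧ radInv (b j) n < v j then (1 : ℝ) else 0) *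
        (∏ i, if x i ≤ Int.fract (n * α i) ∧ Int.fract (n * α i) < y i then (1 : ℝ) else 0) -
      N * ((∏ j, (v j - u j)) * ∏ i, (y i - x i))| ≤
      boxConst b t * ∑ κ ∈ Fintype.piFinset fun _ : Fin s => Finset.range (K + 1),
        ∑ k ∈ Fintype.piFinset fun _ : Fin t => Finset.range (K + 2), E κ k := by
  set A := Fintype.piFinset fun _ : Fin s => Finset.range (K + 1) with hA
  set B := Fintype.piFinset fun _ : Fin t => Finset.range (K + 2) with hB
  choose c hc1 hc2 hc3 using fun j => exists_halton_pieces (hb j) K (huv j).1 (huv j).2.1 (huv j).2.2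
  choose g m hg hg1 hg2 using fun i => exists_torus_pieces K (hxy i).1 (hxy i).2.1 (hxy i).2.2
  have hN0 : (0 : ℝ) < N := by positivity
  set P : Fin s → ℝ := fun j => ∑ k ∈ Finset.range (K + 1), ∑ a ∈ Finset.range (b j ^ k),
    c j k a / (b j : ℝ) ^ k with hP
  have hNb (j) : (N : ℝ) ≤ (b j : ℝ) ^ K := by
    have : 2 ^ K ≤ b j ^ K := Nat.pow_le_pow_left (hb j) K
    exact_mod_cast hN.trans this
  have hPe (j) : |(v j - u j) - P j| ≤ 2 / N := by
    refine (hc3 j).trans ?_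
    rw [div_eq_mul_inv]
    gcongr
    exact hNb j
  have hNe : (2 : ℝ) / N ≤ 1 := by
    rw [div_le_one hN0]; exact_mod_cast hN2
  have hV (j) : |v j - u j| ≤ 1 := by
    rw [abs_le]; constructor <;> linarith [(huv j).1, (huv j).2.1, (huv j).2.2]
  have hvol : |(∏ j, P j) - ∏ j, (v j - u j)| ≤ s * 2 ^ s * (2 / N) := by
    have := abs_prod_sub_prod_le Finset.univ P (fun j => v j - u j) (e := 2 / N) (by positivity)
      (fun j => ?_) (fun j => (hV j).trans (by norm_num))
      (fun j => by rw [abs_sub_comm]; exact hPe j)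
    · simpa using this
    · have h1 := abs_le.1 (hPe j)
      have h2 := abs_le.1 (hV j)
      rw [abs_le]; constructor <;> linarith [(huv j).1, (huv j).2.1, (huv j).2.2]
  have hT : |∏ i, (y i - x i)| ≤ 1 := by
    rw [Finset.abs_prod]
    refine Finset.prod_le_one (fun _ _ => abs_nonneg _) fun i _ => ?_
    rw [abs_le]; constructor <;> linarith [(hxy i).1, (hxy i).2.1, (hxy i).2.2]
  have hPexp : ∏ j, P j = ∑ κ ∈ A, ∏ j, ∑ a ∈ Finset.range (b j ^ κ j), c j (κ j) a / (b j : ℝ) ^ κ j := by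
    rw [hP, hA, Finset.prod_univ_sum]
  have hTexp : ∏ i, (y i - x i) = ∑ k ∈ B, ∑ r : Fin t → Bool, ∏ i, m i (k i) (r i) := by
    simp_rw [hg2]
    rw [hB, Finset.prod_univ_sum]
    refine Finset.sum_congr rfl fun k _ => ?_
    rw [Finset.prod_univ_sum, Fintype.piFinset_univ]
  have hcount : ∑ n ∈ Finset.range N,
      (∏ j, if u j ≤ radInv (b j) n ∧ radInv (b j) n < v j then (1 : ℝ) else 0) *
      (∏ i, if x i ≤ Int.fract (n * α i) ∧ Int.fract (n * α i) < y i then (1 : ℝ) else 0) =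
      ∑ κ ∈ A, ∑ k ∈ B, ∑ r : Fin t → Bool, ∑ n ∈ Finset.range N,
        (∏ j, c j (κ j) (n % b j ^ κ j)) * pieceProd (fun i => g i (k i) (r i)) α 0 n := by
    have e (n) (hn : n ∈ Finset.range N) :
        (∏ j, if u j ≤ radInv (b j) n ∧ radInv (b j) n < v j then (1 : ℝ) else 0) *
        (∏ i, if x i ≤ Int.fract (n * α i) ∧ Int.fract (n * α i) < y i then (1 : ℝ) else 0) =
        ∑ κ ∈ A, ∑ k ∈ B, ∑ r : Fin t → Bool,
        (∏ j, c j (κ j) (n % b j ^ κ j)) * pieceProd (fun i => g i (k i) (r i)) α 0 n := by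
      have e1 : (∏ j, if u j ≤ radInv (b j) n ∧ radInv (b j) n < v j then (1 : ℝ) else 0) =
          ∑ κ ∈ A, ∏ j, c j (κ j) (n % b j ^ κ j) := by
        rw [hA, Finset.prod_congr rfl fun j _ => hc2 j n
          ((Finset.mem_range.1 hn).trans_le (by exact_mod_cast hNb j)), Finset.prod_univ_sum]
      have e2 : (∏ i, if x i ≤ Int.fract (n * α i) ∧ Int.fract (n * α i) < y i then (1 : ℝ) else 0) =
          ∑ k ∈ B, ∑ r : Fin t → Bool, pieceProd (fun i => g i (k i) (r i)) α 0 n := by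
        simp_rw [hg1]
        rw [hB, Finset.prod_univ_sum]
        refine Finset.sum_congr rfl fun k _ => ?_
        rw [Finset.prod_univ_sum, Fintype.piFinset_univ]
        refine Finset.sum_congr rfl fun r _ => ?_
        simp [pieceProd]
      rw [e1, e2, Finset.sum_mul]
      simp_rw [Finset.mul_sum]
    rw [Finset.sum_congr rfl e, Finset.sum_comm]
    refine Finset.sum_congr rfl fun κ _ => ?_
    rw [Finset.sum_comm]
    refine Finset.sum_congr rfl fun k _ => ?_
    rw [Finset.sum_comm]
  have hmain : |∑ κ ∈ A, ∑ k ∈ B, ∑ r : Fin t → Bool, (∑ n ∈ Finset.range N,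
        (∏ j, c j (κ j) (n % b j ^ κ j)) * pieceProd (fun i => g i (k i) (r i)) α 0 n -
        N * ((∏ j, ∑ a ∈ Finset.range (b j ^ κ j), c j (κ j) a / (b j : ℝ) ^ κ j) *
          ∏ i, m i (k i) (r i)))| ≤
      2 ^ t * ((∏ j, (2 * b j : ℝ)) * 3) * ∑ κ ∈ A, ∑ k ∈ B, E κ k := by
    refine (Finset.abs_sum_le_sum_abs _ _).trans ?_
    rw [Finset.mul_sum]
    refine Finset.sum_le_sum fun κ hκ => (Finset.abs_sum_le_sum_abs _ _).trans ?_
    rw [Finset.mul_sum]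
    refine Finset.sum_le_sum fun k hk => (Finset.abs_sum_le_sum_abs _ _).trans ?_
    refine (Finset.sum_le_card_nsmul _ _ ((∏ j, (2 * b j : ℝ)) * (3 * E κ k)) fun r _ => ?_).trans ?_
    · have h1 := abs_sum_mod_mul_sub_le (fun j => b j ^ κ j)
        (fun j => pow_pos (by linarith [hb j]) _)
        (fun i j hij => Nat.Coprime.pow _ _ (hcop i j hij)) (fun j => c j (κ j))
        (fun i => hg i (k i) (r i)) α hN (hE1 κ k) (hE κ hκ k hk)
      push_cast at h1
      refine h1.trans (mul_le_mul_of_nonneg_right ?_ (by linarith [hE1 κ k]))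
      exact Finset.prod_le_prod (fun j _ => Finset.sum_nonneg fun _ _ => abs_nonneg _)
        fun j _ => hc1 j (κ j)
    · simp
      apply le_of_eq
      ring
  have hsplit : ∑ κ ∈ A, ∑ k ∈ B, ∑ r : Fin t → Bool, (∑ n ∈ Finset.range N,
        (∏ j, c j (κ j) (n % b j ^ κ j)) * pieceProd (fun i => g i (k i) (r i)) α 0 n -
        N * ((∏ j, ∑ a ∈ Finset.range (b j ^ κ j), c j (κ j) a / (b j : ℝ) ^ κ j) *
          ∏ i, m i (k i) (r i))) = (∑ κ ∈ A, ∑ k ∈ B, ∑ r : Fin t → Bool, ∑ n ∈ Finset.range N,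
        (∏ j, c j (κ j) (n % b j ^ κ j)) * pieceProd (fun i => g i (k i) (r i)) α 0 n) -
        N * ((∏ j, P j) * ∏ i, (y i - x i)) := by
    rw [hPexp, hTexp, Finset.sum_mul, Finset.mul_sum]
    simp_rw [Finset.sum_sub_distrib, Finset.mul_sum]
  rw [hsplit, ← hcount] at hmain
  have hS1 : 1 ≤ ∑ κ ∈ A, ∑ k ∈ B, E κ k := by
    have hA0 : (0 : Fin s → ℕ) ∈ A := Fintype.mem_piFinset.2 fun _ => by simp
    have hB0 : (0 : Fin t → ℕ) ∈ B := Fintype.mem_piFinset.2 fun _ => by simp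
    have hE0 : ∀ κ k, 0 ≤ E κ k := fun κ k => zero_le_one.trans (hE1 κ k)
    exact ((hE1 0 0).trans (Finset.single_le_sum (fun k _ => hE0 0 k) hB0)).trans
      (Finset.single_le_sum (f := fun κ => ∑ k ∈ B, E κ k)
        (fun κ _ => Finset.sum_nonneg fun k _ => hE0 κ k) hA0)
  have hvol2 : |N * ((∏ j, P j) * ∏ i, (y i - x i)) -
      N * ((∏ j, (v j - u j)) * ∏ i, (y i - x i))| ≤ s * 2 ^ s * 2 := by
    rw [← mul_sub, ← sub_mul, abs_mul, abs_mul, abs_of_pos hN0]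
    calc (N : ℝ) * (|∏ j, P j - ∏ j, (v j - u j)| * |∏ i, (y i - x i)|)
        ≤ N * ((s * 2 ^ s * (2 / N)) * 1) := by gcongr
      _ = _ := by field_simp
  have htri := abs_add_le _ _ |>.trans (add_le_add hmain hvol2)
  rw [sub_add_sub_cancel] at htri
  refine htri.trans ?_
  unfold boxConst
  rw [add_mul]
  exact add_le_add le_rfl (le_mul_of_one_le_right (by positivity) hS1)

lemma ae_pi_coe_of_ae {t : ℕ} {P : (Fin t → UnitAddCircle) → Prop} (h : ∀ᵐ β, P β) :
    ∀ᵐ α : Fin t → ℝ, P fun i => (α i : UnitAddCircle) := by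
  have hU : (⋃ z : Fin t → ℤ, Set.univ.pi fun i => Set.Ioc (z i : ℝ) (z i + 1)) = Set.univ := by
    refine Set.eq_univ_of_forall fun α => Set.mem_iUnion.2 ⟨fun i => ⌈α i⌉ - 1, fun i _ => ?_⟩
    push_cast
    constructor
    · linarith [Int.ceil_lt_add_one (α i)]
    · linarith [Int.le_ceil (α i)]
  rw [← Measure.restrict_univ (μ := volume), ← hU, ae_restrict_iUnion_iff]
  intro z
  rw [volume_pi, Measure.restrict_pi_pi]
  have hmp := measurePreserving_pi (fun i => (volume : Measure ℝ).restrict (Set.Ioc (z i : ℝ) (z i + 1)))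
    (fun _ => (volume : Measure UnitAddCircle)) (fun i => UnitAddCircle.measurePreserving_mk (z i))
  exact hmp.quasiMeasurePreserving.ae h

lemma ae_exists_sum_levelBound_le {s : ℕ} (t : ℕ) {b : Fin s → ℕ} (hb : ∀ i, 2 ≤ b i) :
    ∀ᵐ α : Fin t → ℝ, ∀ ε > (0 : ℝ), ∃ C < ⊤, ∀ K : ℕ,
      ∑ κ ∈ Fintype.piFinset fun _ : Fin s => Finset.range (K + 1),
        ∑ k ∈ Fintype.piFinset fun _ : Fin t => Finset.range (K + 2),
          levelBound k ((∏ j, b j ^ κ j) • fun i => (α i : UnitAddCircle)) ≤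
        C * ((K + 2 : ℕ) : ℝ≥0∞) ^ ((s : ℝ) + t + ε) := by
  refine ae_pi_coe_of_ae (P := fun β => ∀ ε > (0 : ℝ), ∃ C < ⊤, ∀ K : ℕ,
      ∑ κ ∈ Fintype.piFinset fun _ : Fin s => Finset.range (K + 1),
        ∑ k ∈ Fintype.piFinset fun _ : Fin t => Finset.range (K + 2),
          levelBound k ((∏ j, b j ^ κ j) • β) ≤ C * ((K + 2 : ℕ) : ℝ≥0∞) ^ ((s : ℝ) + t + ε)) ?_
  refine ae_exists_sum_le volume (fun κ k β => levelBound k ((∏ j, b j ^ κ j) • β)) (fun κ k => ?_)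
    fun p hp hp1 => ?_
  · refine (measurable_levelBound k).comp ?_
    have : Continuous fun β : Fin t → UnitAddCircle => (∏ j, b j ^ κ j) • β := by fun_prop
    exact this.measurable
  · obtain ⟨C, hC, h⟩ := exists_lintegral_levelBound_rpow_le t hp hp1
    exact ⟨C, hC, fun κ k => h k _ (Finset.prod_pos fun j _ => pow_pos (by linarith [hb j]) _)⟩

lemma exists_clog_add_two_le {p : ℝ} (hp : 0 ≤ p) : ∃ C > 0, ∀ N : ℕ, 2 ≤ N →
    ((Nat.clog 2 N + 2 : ℕ) : ℝ) ^ p ≤ C * Real.log N ^ p := by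
  have h2 : 0 < Real.log 2 := Real.log_pos (by norm_num)
  refine ⟨(4 / Real.log 2) ^ p, by positivity, fun N hN => ?_⟩
  have hN0 : (0 : ℝ) < N := by positivity
  have hlN : Real.log 2 ≤ Real.log N := Real.log_le_log (by norm_num) (by exact_mod_cast hN)
  have hlN0 : 0 ≤ Real.log N := h2.le.trans hlN
  rw [← Real.mul_rpow (by positivity) hlN0]
  refine Real.rpow_le_rpow (by positivity) ?_ hp
  have hlt : (2 : ℕ) ^ (Nat.clog 2 N - 1) < N := Nat.pow_pred_clog_lt_self (by norm_num) (by omega)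
  have hpos : 0 < Nat.clog 2 N := Nat.clog_pos (by norm_num) hN
  have h3 : ((Nat.clog 2 N - 1 : ℕ) : ℝ) * Real.log 2 ≤ Real.log N := by
    rw [← Real.log_pow]
    exact Real.log_le_log (by positivity) (by exact_mod_cast hlt.le)
  have h4 : ((Nat.clog 2 N - 1 : ℕ) : ℝ) ≤ Real.log N / Real.log 2 := by
    rwa [le_div_iff₀ h2]
  have h5 : 1 ≤ Real.log N / Real.log 2 := by rwa [le_div_iff₀ h2, one_mul]
  have h6 : ((Nat.clog 2 N + 2 : ℕ) : ℝ) = ((Nat.clog 2 N - 1 : ℕ) : ℝ) + 3 := by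
    rw [Nat.cast_sub hpos]; push_cast; ring
  rw [h6, show 4 / Real.log 2 * Real.log N = 4 * (Real.log N / Real.log 2) by ring]
  linarith

open Classical in
lemma abs_card_div_sub_le {s t : ℕ} (x : ℕ → Fin s → ℝ) (z : ℕ → Fin t → ℝ) {N : ℕ} (hN : 0 < N)
    (u v : Fin (s + t) → ℝ) {R : ℝ}
    (h : |∑ n ∈ Finset.range N,
        (∏ j, if u (Fin.castAdd t j) ≤ x n j ∧ x n j < v (Fin.castAdd t j) then (1 : ℝ) else 0) *
        (∏ i, if u (Fin.natAdd s i) ≤ z n i ∧ z n i < v (Fin.natAdd s i) then (1 : ℝ) else 0) -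
      N * ((∏ j, (v (Fin.castAdd t j) - u (Fin.castAdd t j))) *
        ∏ i, (v (Fin.natAdd s i) - u (Fin.natAdd s i)))| ≤ R) :
    |(Nat.card {n : ℕ // n < N ∧ ∀ i, u i ≤ Fin.append (x n) (z n) i ∧
        Fin.append (x n) (z n) i < v i} : ℝ) / N - ∏ i, (v i - u i)| ≤ R / N := by
  have hN0 : (0 : ℝ) < N := by exact_mod_cast hN
  have hc : (Nat.card {n : ℕ // n < N ∧ ∀ i, u i ≤ Fin.append (x n) (z n) i ∧
      Fin.append (x n) (z n) i < v i} : ℝ) = ∑ n ∈ Finset.range N,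
        (∏ j, if u (Fin.castAdd t j) ≤ x n j ∧ x n j < v (Fin.castAdd t j) then (1 : ℝ) else 0) *
        (∏ i, if u (Fin.natAdd s i) ≤ z n i ∧ z n i < v (Fin.natAdd s i) then (1 : ℝ) else 0) := by
    rw [Nat.subtype_card ((Finset.range N).filter fun n => ∀ i, u i ≤ Fin.append (x n) (z n) i ∧
      Fin.append (x n) (z n) i < v i) (by simp), Finset.card_filter]
    push_cast
    refine Finset.sum_congr rfl fun n _ => ?_
    rw [Finset.prod_ite_zero, Finset.prod_ite_zero, ite_zero_mul_ite_zero]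
    simp [Fin.forall_fin_add]
  rw [hc, Fin.prod_univ_add, div_sub' hN0.ne', abs_div, abs_of_pos hN0]
  gcongr

theorem stmt9 (s t : ℕ) (b : Fin s → ℕ) (hb : ∀ i, 2 ≤ b i)
    (hcop : ∀ i j, i ≠ j → Nat.Coprime (b i) (b j)) :
    ∀ᵐ α ∂(volume : Measure (Fin t → ℝ)), ∀ ε > (0 : ℝ), ∃ C > 0, ∀ N : ℕ, 2 ≤ N →
      disc (fun n => Fin.append (fun j : Fin s => radInv (b j) n)
          (fun i : Fin t => Int.fract (n * α i))) N
        ≤ C * Real.log N ^ ((s : ℝ) + t + ε) / N := by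
  filter_upwards [ae_exists_sum_levelBound_le t hb] with α hα ε hε
  obtain ⟨C, hC, hsum⟩ := hα ε hε
  have hp : 0 ≤ (s : ℝ) + t + ε := by positivity
  obtain ⟨D, hD, hlog⟩ := exists_clog_add_two_le hp
  have hb0 : 0 ≤ boxConst b t := by unfold boxConst; positivity
  refine ⟨boxConst b t * (C.toReal * D) + 1, by positivity, fun N hN => ?_⟩
  have hlog0 : 0 ≤ Real.log N := Real.log_natCast_nonneg N
  set K := Nat.clog 2 N
  set A := Fintype.piFinset fun _ : Fin s => Finset.range (K + 1) with hA
  set B := Fintype.piFinset fun _ : Fin t => Finset.range (K + 2) with hB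
  set L : (Fin s → ℕ) → (Fin t → ℕ) → ℝ≥0∞ := fun κ k =>
    levelBound k ((∏ j, b j ^ κ j) • fun i => (α i : UnitAddCircle)) with hL
  set E : (Fin s → ℕ) → (Fin t → ℕ) → ℝ := fun κ k => max 1 (L κ k).toReal with hE
  have hSlt : ∑ κ ∈ A, ∑ k ∈ B, L κ k < ⊤ :=
    (hsum K).trans_lt (ENNReal.mul_lt_top hC (ENNReal.rpow_lt_top_of_nonneg hp (by simp)))
  have hLlt : ∀ κ ∈ A, ∀ k ∈ B, L κ k < ⊤ := fun κ hκ k hk =>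
    (ENNReal.sum_lt_top.1 (ENNReal.sum_lt_top.1 hSlt κ hκ) k hk)
  have hEL : ∀ κ ∈ A, ∀ k ∈ B, E κ k = (L κ k).toReal := fun κ hκ k hk => by
    refine max_eq_right ?_
    rw [← ENNReal.toReal_one]
    exact ENNReal.toReal_mono (hLlt κ hκ k hk).ne ((one_le_returnCount _ _).trans le_self_add)
  have hEsum : ∑ κ ∈ A, ∑ k ∈ B, E κ k ≤ C.toReal * D * Real.log N ^ ((s : ℝ) + t + ε) := by
    have h1 : ∑ κ ∈ A, ∑ k ∈ B, E κ k = (∑ κ ∈ A, ∑ k ∈ B, L κ k).toReal := by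
      rw [ENNReal.toReal_sum fun κ hκ => (ENNReal.sum_lt_top.1 hSlt κ hκ).ne]
      refine Finset.sum_congr rfl fun κ hκ => ?_
      rw [ENNReal.toReal_sum fun k hk => (hLlt κ hκ k hk).ne]
      exact Finset.sum_congr rfl fun k hk => hEL κ hκ k hk
    have h2 := ENNReal.toReal_mono
      (ENNReal.mul_lt_top hC (ENNReal.rpow_lt_top_of_nonneg hp (by simp))).ne (hsum K)
    rw [ENNReal.toReal_mul, ← ENNReal.toReal_rpow, ENNReal.toReal_natCast] at h2
    rw [h1, mul_assoc]
    exact h2.trans (mul_le_mul_of_nonneg_left (hlog N hN) ENNReal.toReal_nonneg)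
  refine Real.sSup_le ?_ (by positivity)
  rintro _ ⟨u, v, huv, rfl⟩
  refine abs_card_div_sub_le (fun n j => radInv (b j) n) (fun n i => Int.fract (n * α i))
    (by omega) u v ?_
  have hmain := abs_sum_indicator_sub_le hb hcop α hN (Nat.le_pow_clog (by norm_num) N) E
    (fun _ _ => le_max_left _ _)
    (fun κ hκ k hk => by
      rw [hEL κ hκ k hk, ENNReal.ofReal_toReal (hLlt κ hκ k hk).ne])
    (fun j => u (Fin.castAdd t j)) (fun j => v (Fin.castAdd t j)) (fun j => huv _)
    (fun i => u (Fin.natAdd s i)) (fun i => v (Fin.natAdd s i)) (fun i => huv _)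
  refine hmain.trans ((mul_le_mul_of_nonneg_left hEsum hb0).trans ?_)
  rw [← mul_assoc]
  exact mul_le_mul_of_nonneg_right (by linarith) (by positivity)
end

section
/- Let b_1,…,b_s be s distinct primes, let t ≥ 1, and let N be a prime different from b_1,…,b_s. Let H_N = (x_n)_{n=0}^{N−1} be the (s+1)-dimensional Hammersley point set x_n = (n/N, ψ_{b_1}(n),…,ψ_{b_s}(n)). Then there exists a generating vector g = (g_1,…,g_t) ∈ {1,…,N−1}^t and a constant c > 0 depending only on s, t and b_1,…,b_s (not on N) such that the point set S_N = ((x_n, y_n))_{n=0}^{N−1} in [0,1)^{s+t+1}, with y_n = ({n g_1/N},…,{n g_t/N}), satisfies D_N(S_N) ≤ c · (log N)^{s+t+1} / N. -/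
open Real

section
open Finset

/-- The reversal of the `m` lowest base-`b` digits of a natural number. -/
def revDigits (b : ℕ) : ℕ → ℕ → ℕ
  | 0, _ => 0
  | m + 1, n => b * revDigits b m n + n / b ^ m % b

theorem revDigits_lt {b : ℕ} (hb : 2 ≤ b) (m n : ℕ) : revDigits b m n < b ^ m := by
  induction m with
  | zero => simp [revDigits]
  | succ m ih =>
    have h1 : n / b ^ m % b < b := Nat.mod_lt _ (by omega)
    rw [revDigits, pow_succ]
    nlinarith

theorem exists_revDigits_eq_iff {b : ℕ} (hb : 2 ≤ b) (m p : ℕ) (hp : p < b ^ m) :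
    ∃ r < b ^ m, ∀ n, revDigits b m n = p ↔ n % b ^ m = r := by
  induction m generalizing p with
  | zero =>
    refine ⟨0, by simp, fun n => ?_⟩
    have : p = 0 := by simpa using hp
    simp [revDigits, this, Nat.mod_one]
  | succ m ih =>
    have hb0 : 0 < b := by omega
    obtain ⟨r, hr, h⟩ := ih (p / b) (by
      rw [Nat.div_lt_iff_lt_mul hb0, ← pow_succ]; exact hp)
    have he : p % b < b := Nat.mod_lt _ hb0
    refine ⟨r + b ^ m * (p % b), ?_, fun n => ?_⟩
    · rw [pow_succ]; nlinarith
    · have h1 : n / b ^ m % b < b := Nat.mod_lt _ hb0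
      have h2 : n % b ^ m < b ^ m := Nat.mod_lt _ (by positivity)
      rw [Nat.mod_pow_succ, revDigits]
      have e1 : b * revDigits b m n + n / b ^ m % b = p ↔
          revDigits b m n = p / b ∧ n / b ^ m % b = p % b := by
        constructor
        · rintro rfl
          simp [Nat.mul_add_div hb0, Nat.div_eq_of_lt h1]
        · rintro ⟨h3, h4⟩
          rw [h3, h4, Nat.div_add_mod]
      rw [e1, h n]
      constructor
      · rintro ⟨h3, h4⟩
        rw [h3, h4]
      · intro h3
        have h4 := congrArg (· % b ^ m) h3
        have h5 := congrArg (· / b ^ m) h3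
        have hpos : 0 < b ^ m := by positivity
        simp only [Nat.add_mul_mod_self_left, Nat.mod_mod, Nat.mod_eq_of_lt hr] at h4
        simp only [Nat.add_mul_div_left _ _ hpos, Nat.div_eq_of_lt hr, Nat.div_eq_of_lt h2,
          zero_add] at h5
        exact ⟨h4, h5⟩

theorem revDigits_div_pow {b : ℕ} (hb : 2 ≤ b) (m n : ℕ) :
    (revDigits b m n : ℝ) / (b : ℝ) ^ m =
      ∑ i ∈ range m, ((n / b ^ i % b : ℕ) : ℝ) / (b : ℝ) ^ (i + 1) := by
  have hb0 : (b : ℝ) ≠ 0 := by positivity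
  induction m with
  | zero => simp [revDigits]
  | succ m ih =>
    rw [sum_range_succ, ← ih, revDigits]
    push_cast
    field_simp
    ring

theorem abs_sum_revDigits_lt_sub_le {b : ℕ} (hb : 2 ≤ b) (S : Finset ℕ) (w : ℕ → ℝ) (μ : ℝ)
    (E : ℕ → ℝ) (m : ℕ)
    (h : ∀ k ≤ m, ∀ r < b ^ k,
      |∑ n ∈ S with n % b ^ k = r, w n - μ * ((b : ℝ) ^ k)⁻¹| ≤ E k)
    (p : ℕ) (hp : p ≤ b ^ m) :
    |∑ n ∈ S with revDigits b m n < p, w n - μ * (p / (b : ℝ) ^ m)| ≤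
      b * ∑ k ∈ range (m + 1), E k := by
  have hb0 : 0 < b := by omega
  have hbR : (1 : ℝ) ≤ b := by exact_mod_cast hb0
  induction m generalizing p with
  | zero =>
    have h0 := h 0 le_rfl 0 (by simp)
    have hE : 0 ≤ E 0 := (abs_nonneg _).trans h0
    simp only [pow_zero, Nat.mod_one, filter_true, inv_one, mul_one] at h0
    simp only [pow_zero] at hp
    interval_cases p
    · simpa using by positivity
    · simp [revDigits]
      exact h0.trans (le_mul_of_one_le_left hE hbR)
  | succ m ih =>
    have ih' := ih (fun k hk => h k (by omega)) (p / b) (by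
      rw [pow_succ] at hp
      exact Nat.div_le_of_le_mul (by rwa [mul_comm]))
    have hd : p % b < b := Nat.mod_lt _ hb0
    have hE : 0 ≤ E (m + 1) :=
      (abs_nonneg _).trans (h (m + 1) le_rfl 0 (by positivity))
    obtain ⟨r, hr⟩ : ∃ r : ℕ → ℕ, ∀ e < p % b, r e < b ^ (m + 1) ∧
        ∀ n, (revDigits b m n = p / b ∧ n / b ^ m % b = e) ↔ n % b ^ (m + 1) = r e := by
      have : ∀ e, ∃ r, e < p % b → r < b ^ (m + 1) ∧
        ∀ n, (revDigits b m n = p / b ∧ n / b ^ m % b = e) ↔ n % b ^ (m + 1) = r := by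
        intro e
        by_cases he : e < p % b
        · have hlt : b * (p / b) + e < b ^ (m + 1) := by
            have := Nat.div_add_mod p b
            omega
          obtain ⟨r, h1, h2⟩ := exists_revDigits_eq_iff hb (m + 1) _ hlt
          refine ⟨r, fun _ => ⟨h1, fun n => ?_⟩⟩
          rw [← h2 n, revDigits]
          have h3 : n / b ^ m % b < b := Nat.mod_lt _ hb0
          constructor
          · rintro ⟨h4, h5⟩; rw [h4, h5]
          · intro h4
            have h5 := congrArg (· % b) h4
            have h6 := congrArg (· / b) h4
            simpa [Nat.mul_add_div hb0, Nat.div_eq_of_lt h3, Nat.div_eq_of_lt (he.trans hd),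
              Nat.mod_eq_of_lt (he.trans hd)] using And.intro h6 h5
        · exact ⟨0, fun h => absurd h he⟩
      choose r hr using this
      exact ⟨r, hr⟩
    have key : ∑ n ∈ S with revDigits b (m + 1) n < p, w n =
        ∑ n ∈ S with revDigits b m n < p / b, w n +
        ∑ e ∈ range (p % b), ∑ n ∈ S with n % b ^ (m + 1) = r e, w n := by
      simp only [sum_filter]
      rw [sum_comm, ← sum_add_distrib]
      refine sum_congr rfl fun n _ => ?_
      have h3 : n / b ^ m % b < b := Nat.mod_lt _ hb0
      have e1 : ∑ e ∈ range (p % b), (if n % b ^ (m + 1) = r e then w n else 0) =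
          if revDigits b m n = p / b ∧ n / b ^ m % b < p % b then w n else 0 := by
        rw [sum_congr rfl fun e he => by
          rw [if_congr ((hr e (mem_range.1 he)).2 n).symm rfl rfl]]
        by_cases h4 : revDigits b m n = p / b
        · simp [h4, sum_ite_eq]
        · simp [h4]
      have e2 : revDigits b (m + 1) n < p ↔ revDigits b m n < p / b ∨
          (revDigits b m n = p / b ∧ n / b ^ m % b < p % b) := by
        rw [revDigits]
        have h5 := Nat.div_add_mod p b
        generalize p / b = P at *
        generalize p % b = e at *
        subst h5
        generalize revDigits b m n = R at *
        generalize n / b ^ m % b = f at *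
        rcases lt_trichotomy R P with h6 | h6 | h6
        · simp only [h6, true_or, iff_true]
          nlinarith
        · subst h6; simp
        · simp only [h6.ne', h6.not_gt, false_and, or_self, iff_false, not_lt]
          nlinarith
      rw [e1, if_congr e2 rfl rfl]
      by_cases h6 : revDigits b m n < p / b
      · simp [h6, h6.ne]
      · simp [h6]
    rw [key, sum_range_succ, mul_add]
    have hmain : μ * ((p : ℝ) / (b : ℝ) ^ (m + 1)) = μ * (((p / b : ℕ) : ℝ) / (b : ℝ) ^ m) +
        ∑ _e ∈ range (p % b), μ * ((b : ℝ) ^ (m + 1))⁻¹ := by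
      have h5 : ((b * (p / b) + p % b : ℕ) : ℝ) = p := by rw [Nat.div_add_mod p b]
      rw [← h5]
      push_cast
      simp only [sum_const, card_range, nsmul_eq_mul]
      field_simp
      ring
    rw [hmain, add_sub_add_comm, ← sum_sub_distrib]
    refine (abs_add_le _ _).trans (add_le_add ih' ?_)
    refine (abs_sum_le_sum_abs _ _).trans ?_
    calc _ ≤ ∑ _e ∈ range (p % b), E (m + 1) :=
          sum_le_sum fun e he => h (m + 1) le_rfl _ (hr e (mem_range.1 he)).1
      _ ≤ _ := by
        simp only [sum_const, card_range, nsmul_eq_mul]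
        gcongr

theorem abs_sum_revDigits_Ico_sub_le {b : ℕ} (hb : 2 ≤ b) (S : Finset ℕ) (w : ℕ → ℝ) (μ : ℝ)
    (E : ℕ → ℝ) (m : ℕ)
    (h : ∀ k ≤ m, ∀ r < b ^ k,
      |∑ n ∈ S with n % b ^ k = r, w n - μ * ((b : ℝ) ^ k)⁻¹| ≤ E k)
    (p q : ℕ) (hpq : p ≤ q) (hq : q ≤ b ^ m) :
    |∑ n ∈ S with p ≤ revDigits b m n ∧ revDigits b m n < q, w n -
        μ * (((q : ℝ) - p) / (b : ℝ) ^ m)| ≤ 2 * b * ∑ k ∈ range (m + 1), E k := by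
  have h1 := abs_sum_revDigits_lt_sub_le hb S w μ E m h p (hpq.trans hq)
  have h2 := abs_sum_revDigits_lt_sub_le hb S w μ E m h q hq
  have e : ∑ n ∈ S with p ≤ revDigits b m n ∧ revDigits b m n < q, w n =
      ∑ n ∈ S with revDigits b m n < q, w n - ∑ n ∈ S with revDigits b m n < p, w n := by
    simp only [sum_filter]
    rw [← sum_sub_distrib]
    refine sum_congr rfl fun n _ => ?_
    split_ifs <;> first | omega | simp
  rw [e]
  rw [abs_le] at *
  have e2 : μ * (((q : ℝ) - p) / (b : ℝ) ^ m) =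
    μ * (q / (b : ℝ) ^ m) - μ * (p / (b : ℝ) ^ m) := by ring
  rw [e2]
  constructor <;> linarith

theorem abs_sum_forall_revDigits_sub_le {s : ℕ} (b : Fin s → ℕ) (hb : ∀ i, 2 ≤ b i)
    (m : Fin s → ℕ) (S : Finset ℕ) (w : ℕ → ℝ) (μ : ℝ) (E : (Fin s → ℕ) → ℝ)
    (h : ∀ k : Fin s → ℕ, (∀ i, k i ≤ m i) → ∀ r : Fin s → ℕ, (∀ i, r i < b i ^ k i) →
      |∑ n ∈ S with ∀ i, n % b i ^ k i = r i, w n - μ * ∏ i, ((b i : ℝ) ^ k i)⁻¹| ≤ E k)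
    (p q : Fin s → ℕ) (hpq : ∀ i, p i ≤ q i) (hq : ∀ i, q i ≤ b i ^ m i) :
    |∑ n ∈ S with ∀ i, p i ≤ revDigits (b i) (m i) n ∧ revDigits (b i) (m i) n < q i, w n -
        μ * ∏ i, (((q i : ℝ) - p i) / (b i : ℝ) ^ m i)| ≤
      (∏ i, (2 * b i : ℝ)) * ∑ k ∈ Fintype.piFinset fun i => range (m i + 1), E k := by
  induction s generalizing S μ with
  | zero =>
    have := h (fun _ => 0) (fun i => i.elim0) (fun _ => 0) (fun i => i.elim0)
    simp at this ⊢
    convert this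
  | succ s ih =>
    have h1 : ∀ k0 ≤ m 0, ∀ r0 < b 0 ^ k0,
        |∑ n ∈ S with (∀ i : Fin s, p i.succ ≤ revDigits (b i.succ) (m i.succ) n ∧
            revDigits (b i.succ) (m i.succ) n < q i.succ) ∧ n % b 0 ^ k0 = r0, w n -
          (μ * ∏ i : Fin s, (((q i.succ : ℝ) - p i.succ) / (b i.succ : ℝ) ^ m i.succ)) *
            ((b 0 : ℝ) ^ k0)⁻¹| ≤
        (∏ i : Fin s, (2 * b i.succ : ℝ)) * ∑ k ∈ Fintype.piFinset fun i : Fin s =>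
          range (m i.succ + 1), E (Fin.cons k0 k) := by
      intro k0 hk0 r0 hr0
      have := ih (fun i => b i.succ) (fun i => hb _) (fun i => m i.succ)
        (S.filter fun n => n % b 0 ^ k0 = r0) (μ * ((b 0 : ℝ) ^ k0)⁻¹)
        (fun k => E (Fin.cons k0 k)) ?_ (fun i => p i.succ) (fun i => q i.succ)
        (fun i => hpq _) (fun i => hq _)
      · rw [filter_filter] at this
        convert this using 3
        · refine sum_congr (filter_congr fun n _ => and_comm) fun _ _ => rfl
        · ring
      · intro k hk r hr
        have := h (Fin.cons k0 k) (fun i => by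
          refine Fin.cases ?_ (fun j => ?_) i <;> simp [hk0, hk]) (Fin.cons r0 r) (fun i => by
          refine Fin.cases ?_ (fun j => ?_) i <;> simp [hr0, hr])
        rw [filter_filter]
        simpa only [Fin.forall_fin_succ, Fin.prod_univ_succ, Fin.cons_zero, Fin.cons_succ,
          mul_assoc] using this
    have h2 := abs_sum_revDigits_Ico_sub_le (hb 0) (S.filter fun n =>
        ∀ i : Fin s, p i.succ ≤ revDigits (b i.succ) (m i.succ) n ∧
            revDigits (b i.succ) (m i.succ) n < q i.succ) w _ _ (m 0)
        (fun k hk r hr => by rw [filter_filter]; exact h1 k hk r hr) (p 0) (q 0) (hpq 0) (hq 0)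
    rw [filter_filter] at h2
    have e1 : ∑ k ∈ Fintype.piFinset fun i => range (m i + 1), E k =
        ∑ k0 ∈ range (m 0 + 1), ∑ k ∈ Fintype.piFinset fun i : Fin s =>
          range (m i.succ + 1), E (Fin.cons k0 k) := by
      rw [← sum_product']
      refine sum_nbij' (fun k => (k 0, fun i => k i.succ)) (fun k => Fin.cons k.1 k.2)
        ?_ ?_ ?_ ?_ ?_
      · intro k hk
        simp only [Fintype.mem_piFinset, mem_product] at hk ⊢
        exact ⟨hk 0, fun i => hk _⟩
      · intro k hk
        simp only [Fintype.mem_piFinset, mem_product] at hk ⊢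
        intro i
        refine Fin.cases ?_ (fun j => ?_) i
        · exact hk.1
        · exact hk.2 j
      · intro k hk
        exact Fin.cons_self_tail k
      · intro k hk; rfl
      · intro k hk
        congr 1
        exact (Fin.cons_self_tail k).symm
    rw [e1, Fin.prod_univ_succ, Fin.prod_univ_succ, mul_assoc (2 * b 0 : ℝ), mul_sum]
    convert h2 using 3
    · refine sum_congr (filter_congr fun n _ => ?_) fun _ _ => rfl
      rw [Fin.forall_fin_succ, and_comm]
    · ring

theorem exists_filter_mod_eq_image {M : ℕ} (r A B : ℕ) (hr : r < M) (hAB : A ≤ B) :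
    ∃ k₀ k₁ : ℕ, k₀ ≤ k₁ ∧ (Ico A B).filter (fun n => n % M = r) =
      (Ico k₀ k₁).image (fun k => r + M * k) ∧
      |((k₁ : ℝ) - k₀) - ((B : ℝ) - A) * (M : ℝ)⁻¹| ≤ 1 := by
  have hM : 0 < M := by omega
  have hMR : (0 : ℝ) < M := by exact_mod_cast hM
  have key : ∀ X : ℕ, ∃ k : ℕ, (∀ j, k ≤ j ↔ X ≤ r + M * j) ∧ X ≤ r + M * k ∧
      M * k + r + 1 ≤ X + M := by
    intro X
    have h1 := Nat.div_add_mod (X + M - 1 - r) M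
    have h2 : (X + M - 1 - r) % M < M := Nat.mod_lt _ hM
    set k := (X + M - 1 - r) / M
    refine ⟨k, fun j => ⟨fun h => ?_, fun h => ?_⟩, by omega, by omega⟩
    · have := Nat.mul_le_mul_left M h
      omega
    · by_contra! hj
      have := Nat.mul_le_mul_left M (Nat.succ_le_of_lt hj)
      rw [Nat.mul_succ] at this
      omega
  obtain ⟨k₀, h0, h0', h0''⟩ := key A
  obtain ⟨k₁, h1, h1', h1''⟩ := key B
  refine ⟨k₀, k₁, (h0 _).2 (hAB.trans h1'), ?_, ?_⟩
  · ext n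
    simp only [mem_filter, mem_Ico, mem_image]
    constructor
    · rintro ⟨⟨h2, h3⟩, h4⟩
      have h5 := Nat.mod_add_div n M
      rw [h4] at h5
      refine ⟨n / M, ⟨(h0 _).2 (by omega), ?_⟩, h5⟩
      rw [← not_le, h1]
      omega
    · rintro ⟨k, ⟨h2, h3⟩, rfl⟩
      rw [← not_le, h1] at h3
      rw [h0] at h2
      exact ⟨⟨h2, by omega⟩, by simp [Nat.mod_eq_of_lt hr]⟩
  · have e : ((k₁ : ℝ) - k₀) - ((B : ℝ) - A) * (M : ℝ)⁻¹ =
        ((M * k₁ - B) - (M * k₀ - A)) / M := by field_simp; ring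
    rw [e, abs_le, le_div_iff₀ hMR, div_le_iff₀ hMR]
    have a0 : (A : ℝ) ≤ r + M * k₀ := by exact_mod_cast h0'
    have a1 : (B : ℝ) ≤ r + M * k₁ := by exact_mod_cast h1'
    have a2 : (M * k₀ + r + 1 : ℝ) ≤ A + M := by exact_mod_cast h0''
    have a3 : (M * k₁ + r + 1 : ℝ) ≤ B + M := by exact_mod_cast h1''
    constructor <;> linarith

theorem norm_sum_Ico_pow_le {z : ℂ} (hz : ‖z‖ = 1) (h1 : z ≠ 1) {k₀ k₁ : ℕ} (h : k₀ ≤ k₁) :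
    ‖∑ k ∈ Ico k₀ k₁, z ^ k‖ ≤ 2 / ‖z - 1‖ := by
  rw [geom_sum_Ico h1 h, norm_div]
  gcongr
  refine (norm_sub_le _ _).trans ?_
  simp [hz]
  norm_num

/-- An upper bound for the sums of `ZMod.stdAddChar (n * a)` over at most `N` consecutive `n`. -/
noncomputable def charSumBound (N : ℕ) [NeZero N] (a : ZMod N) : ℝ :=
  if a = 0 then N else 2 / ‖ZMod.stdAddChar a - 1‖

section
variable {N : ℕ} [NeZero N]

theorem charSumBound_nonneg (a : ZMod N) : 0 ≤ charSumBound N a := by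
  unfold charSumBound
  split_ifs <;> positivity

theorem stdAddChar_natCast_mul (n : ℕ) (a : ZMod N) :
    ZMod.stdAddChar ((n : ZMod N) * a) = ZMod.stdAddChar a ^ n := by
  rw [← nsmul_eq_mul, AddChar.map_nsmul_eq_pow]

theorem stdAddChar_ne_one {a : ZMod N} (ha : a ≠ 0) : ZMod.stdAddChar a ≠ 1 := by
  intro h
  exact ha (ZMod.injective_stdAddChar (h.trans (AddChar.map_zero_eq_one _).symm))

theorem stdAddChar_sum {ι : Type*} (s : Finset ι) (f : ι → ZMod N) :
    ZMod.stdAddChar (∑ i ∈ s, f i) = ∏ i ∈ s, ZMod.stdAddChar (f i) := by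
  classical
  induction s using Finset.induction_on with
  | empty => simp
  | insert i s hi ih => rw [sum_insert hi, prod_insert hi, AddChar.map_add_eq_mul, ih]

theorem norm_stdAddChar (a : ZMod N) : ‖ZMod.stdAddChar a‖ = 1 := by
  exact AddChar.norm_apply _ _

theorem norm_sum_stdAddChar_le {M r A B : ℕ} (hr : r < M) (hAB : A ≤ B) (hB : B ≤ N)
    (a : ZMod N) :
    ‖∑ n ∈ Ico A B with n % M = r, ZMod.stdAddChar ((n : ZMod N) * a)‖ ≤
      charSumBound N (M * a) := by
  unfold charSumBound
  split_ifs with h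
  · refine (norm_sum_le _ _).trans ?_
    simp only [norm_stdAddChar, sum_const, nsmul_eq_mul, mul_one, Nat.cast_le]
    refine (card_filter_le _ _).trans ?_
    simp
    omega
  · obtain ⟨k₀, k₁, hk, he, -⟩ := exists_filter_mod_eq_image r A B hr hAB
    have hM : M ≠ 0 := by omega
    rw [he, sum_image (by intro x _ y _ hxy; simpa [hM] using hxy)]
    have : ∀ k : ℕ, ZMod.stdAddChar (((r + M * k : ℕ) : ZMod N) * a) =
        ZMod.stdAddChar ((r : ZMod N) * a) * ZMod.stdAddChar ((M : ZMod N) * a) ^ k := by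
      intro k
      rw [← stdAddChar_natCast_mul, ← AddChar.map_add_eq_mul]
      congr 1
      push_cast
      ring
    simp only [this]
    rw [← mul_sum, norm_mul, norm_stdAddChar, one_mul]
    exact norm_sum_Ico_pow_le (norm_stdAddChar _) (stdAddChar_ne_one h) hk

theorem norm_sum_Ico_stdAddChar_neg_le {p q : ℕ} (hpq : p ≤ q) (hq : q ≤ N) (a : ZMod N) :
    ‖∑ n ∈ Ico p q, ZMod.stdAddChar (-((n : ZMod N) * a))‖ ≤ charSumBound N a := by
  have h := norm_sum_stdAddChar_le (N := N) (M := 1) (r := 0) (by omega) hpq hq a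
  simp only [Nat.mod_one, filter_true, Nat.cast_one, one_mul] at h
  convert h using 1
  rw [← RCLike.norm_conj, map_sum]
  refine congrArg _ (sum_congr rfl fun n _ => ?_)
  rw [AddChar.map_neg_eq_conj]
  simp

theorem ite_mod_eq_sum_stdAddChar {p q : ℕ} (hq : q ≤ N) (y : ℕ) :
    (if p ≤ y % N ∧ y % N < q then 1 else 0 : ℂ) =
      ∑ h : ZMod N, ((∑ x ∈ Ico p q, ZMod.stdAddChar (-((x : ZMod N) * h))) / N) *
        ZMod.stdAddChar (h * (y : ZMod N)) := by
  have hN : (N : ℂ) ≠ 0 := by exact_mod_cast NeZero.ne N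
  have e : ∑ h : ZMod N, ((∑ x ∈ Ico p q, ZMod.stdAddChar (-((x : ZMod N) * h))) / N) *
        ZMod.stdAddChar (h * (y : ZMod N)) =
      (∑ x ∈ Ico p q, ∑ h : ZMod N, ZMod.stdAddChar (h * (y - x : ZMod N))) / N := by
    rw [sum_comm, sum_div]
    refine sum_congr rfl fun h _ => ?_
    rw [div_mul_eq_mul_div, sum_mul]
    congr 1
    refine sum_congr rfl fun x _ => ?_
    rw [← AddChar.map_add_eq_mul]
    congr 1
    ring
  rw [e]
  have e2 : ∀ x ∈ Ico p q, ∑ h : ZMod N, (ZMod.stdAddChar (h * (y - x : ZMod N)) : ℂ) =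
      if y % N = x then (N : ℂ) else 0 := by
    intro x hx
    rw [AddChar.sum_mulShift _ (ZMod.isPrimitive_stdAddChar N), ZMod.card]
    have hx' : x < N := (mem_Ico.1 hx).2.trans_le hq
    have : ((y : ZMod N) - x = 0) ↔ y % N = x := by
      rw [sub_eq_zero, ZMod.natCast_eq_natCast_iff', Nat.mod_eq_of_lt hx']
    simp [this]
  rw [sum_congr rfl e2]
  simp only [sum_ite_eq, mem_Ico]
  split_ifs <;> simp [hN]

/-- The total weight of the nonzero frequencies in the Fourier expansion of a lattice point count
along a residue class modulo `M`. -/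
noncomputable def fourierError (N : ℕ) [NeZero N] {t : ℕ} (g : Fin t → ZMod N) (M : ℕ) : ℝ :=
  ∑ h : Fin t → ZMod N with h ≠ 0,
    (∏ i, charSumBound N (h i) / N) * charSumBound N (M * ∑ i, h i * g i)

theorem abs_sum_mod_eq_sub_le {t M r A B : ℕ} (g : Fin t → ℕ) (hr : r < M) (hAB : A ≤ B)
    (hB : B ≤ N) (p q : Fin t → ℕ) (hpq : ∀ i, p i ≤ q i) (hq : ∀ i, q i ≤ N) :
    |∑ n ∈ Ico A B with n % M = r,
        (if ∀ i, p i ≤ n * g i % N ∧ n * g i % N < q i then (1 : ℝ) else 0) -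
      ((B : ℝ) - A) * (∏ i, ((q i : ℝ) - p i) / N) * (M : ℝ)⁻¹| ≤
    1 + fourierError N (fun i => (g i : ZMod N)) M := by
  set S := (Ico A B).filter fun n => n % M = r with hS
  set c : Fin t → ZMod N → ℂ := fun i h =>
    (∑ x ∈ Ico (p i) (q i), ZMod.stdAddChar (-((x : ZMod N) * h))) / N with hc
  have hNpos : (0 : ℝ) < N := by exact_mod_cast NeZero.pos N
  have hcb : ∀ i h, ‖c i h‖ ≤ charSumBound N h / N := by
    intro i h
    rw [hc, norm_div, Complex.norm_natCast]
    gcongr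
    exact norm_sum_Ico_stdAddChar_neg_le (hpq i) (hq i) h
  have hc0 : ∀ i, c i 0 = ((((q i : ℝ) - p i) / N : ℝ) : ℂ) := by
    intro i
    simp [hc, Nat.cast_sub (hpq i)]
  have expand : ((∑ n ∈ S,
      (if ∀ i, p i ≤ n * g i % N ∧ n * g i % N < q i then (1 : ℝ) else 0) : ℝ) : ℂ) =
      ∑ h : Fin t → ZMod N, (∏ i, c i (h i)) *
        ∑ n ∈ S, ZMod.stdAddChar ((n : ZMod N) * ∑ i, h i * (g i : ZMod N)) := by
    rw [Complex.ofReal_sum]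
    simp only [mul_sum (s := S)]
    rw [sum_comm]
    refine sum_congr rfl fun n _ => ?_
    have e1 : (if ∀ i, p i ≤ n * g i % N ∧ n * g i % N < q i then (1 : ℂ) else 0) =
        ∏ i, if p i ≤ n * g i % N ∧ n * g i % N < q i then (1 : ℂ) else 0 := by
      rw [prod_ite_zero]
      simp
    rw [apply_ite Complex.ofReal, Complex.ofReal_one, Complex.ofReal_zero, e1,
      prod_congr rfl fun i _ => ite_mod_eq_sum_stdAddChar (hq i) (n * g i),
      prod_univ_sum, Fintype.piFinset_univ]
    refine sum_congr rfl fun h _ => ?_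
    rw [prod_mul_distrib]
    congr 1
    rw [mul_sum, stdAddChar_sum]
    refine prod_congr rfl fun i _ => ?_
    congr 1
    push_cast
    ring
  have split : ((∑ n ∈ S,
      (if ∀ i, p i ≤ n * g i % N ∧ n * g i % N < q i then (1 : ℝ) else 0) : ℝ) : ℂ) -
      (((∏ i, ((q i : ℝ) - p i) / N) * (#S : ℝ) : ℝ) : ℂ) =
      ∑ h : Fin t → ZMod N with h ≠ 0, (∏ i, c i (h i)) *
        ∑ n ∈ S, ZMod.stdAddChar ((n : ZMod N) * ∑ i, h i * (g i : ZMod N)) := by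
    rw [expand, filter_ne', ← add_sum_erase univ _ (mem_univ (0 : Fin t → ZMod N))]
    simp [hc0]
  have b1 : |∑ n ∈ S, (if ∀ i, p i ≤ n * g i % N ∧ n * g i % N < q i then (1 : ℝ) else 0) -
      (∏ i, ((q i : ℝ) - p i) / N) * (#S : ℝ)| ≤ fourierError N (fun i => (g i : ZMod N)) M := by
    rw [← Real.norm_eq_abs, ← Complex.norm_real, Complex.ofReal_sub, split]
    refine (norm_sum_le _ _).trans (sum_le_sum fun h _ => ?_)
    rw [norm_mul, norm_prod]
    refine mul_le_mul (prod_le_prod (fun _ _ => norm_nonneg _) fun i _ => hcb i _)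
      (norm_sum_stdAddChar_le hr hAB hB _) (norm_nonneg _)
      (prod_nonneg fun i _ => div_nonneg (charSumBound_nonneg _) hNpos.le)
  have b2 : |(∏ i, ((q i : ℝ) - p i) / N) * (#S : ℝ) -
      ((B : ℝ) - A) * (∏ i, ((q i : ℝ) - p i) / N) * (M : ℝ)⁻¹| ≤ 1 := by
    obtain ⟨k₀, k₁, hk, he, hb⟩ := exists_filter_mod_eq_image r A B hr hAB
    have hM : M ≠ 0 := by omega
    have hcard : (#S : ℝ) = (k₁ : ℝ) - k₀ := by
      rw [hS, he, card_image_of_injective _ (by intro x y hxy; simpa [hM] using hxy), Nat.card_Ico,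
        Nat.cast_sub hk]
    have e : (∏ i, ((q i : ℝ) - p i) / N) * (#S : ℝ) -
      ((B : ℝ) - A) * (∏ i, ((q i : ℝ) - p i) / N) * (M : ℝ)⁻¹ =
      (∏ i, ((q i : ℝ) - p i) / N) * (((k₁ : ℝ) - k₀) - ((B : ℝ) - A) * (M : ℝ)⁻¹) := by
      rw [hcard]; ring
    have h0 : ∀ i, 0 ≤ ((q i : ℝ) - p i) / N := fun i =>
      div_nonneg (sub_nonneg.2 (by exact_mod_cast hpq i)) hNpos.le
    rw [e, abs_mul, abs_of_nonneg (prod_nonneg fun i _ => h0 i)]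
    refine mul_le_one₀ (prod_le_one (fun i _ => h0 i) fun i _ => ?_) (abs_nonneg _) hb
    rw [div_le_one hNpos]
    have : (q i : ℝ) ≤ N := by exact_mod_cast hq i
    have : (0 : ℝ) ≤ p i := by positivity
    linarith
  have := abs_sub_le (∑ n ∈ S,
    (if ∀ i, p i ≤ n * g i % N ∧ n * g i % N < q i then (1 : ℝ) else 0))
    ((∏ i, ((q i : ℝ) - p i) / N) * (#S : ℝ))
    (((B : ℝ) - A) * (∏ i, ((q i : ℝ) - p i) / N) * (M : ℝ)⁻¹)
  linarith

end

theorem inv_sin_pi_mul_le {x : ℝ} (h0 : 0 < x) (h1 : x < 1) :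
    1 / |Real.sin (Real.pi * x)| ≤ (1 / x + 1 / (1 - x)) / 2 := by
  have key : ∀ y : ℝ, 0 < y → y ≤ 1 / 2 → 2 * y ≤ Real.sin (Real.pi * y) := by
    intro y hy hy'
    have := Real.mul_le_sin (x := Real.pi * y) (by positivity) (by nlinarith [Real.pi_pos])
    have e : 2 / Real.pi * (Real.pi * y) = 2 * y := by field_simp
    linarith
  have hx : 0 < 1 / x := by positivity
  have hx' : 0 < 1 / (1 - x) := one_div_pos.2 (by linarith)
  rcases le_total x (1 / 2) with h | h
  · calc 1 / |Real.sin (Real.pi * x)| ≤ 1 / (2 * x) :=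
          one_div_le_one_div_of_le (by linarith) ((key x h0 h).trans (le_abs_self _))
      _ = (1 / x) / 2 := by field_simp
      _ ≤ _ := by linarith
  · have e : Real.sin (Real.pi * x) = Real.sin (Real.pi * (1 - x)) := by
      rw [mul_sub, mul_one, Real.sin_pi_sub]
    have h2 : (1 - x) ≠ 0 := by linarith
    calc 1 / |Real.sin (Real.pi * x)| ≤ 1 / (2 * (1 - x)) := by
          rw [e]
          exact one_div_le_one_div_of_le (by linarith)
            ((key _ (by linarith) (by linarith)).trans (le_abs_self _))
      _ = (1 / (1 - x)) / 2 := by field_simp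
      _ ≤ _ := by linarith

section
variable {N : ℕ} [NeZero N]

theorem charSumBound_natCast_le {j : ℕ} (h0 : 0 < j) (hj : j < N) :
    charSumBound N j ≤ N / 2 * (1 / (j : ℝ) + 1 / ((N : ℝ) - j)) := by
  have hN : (0 : ℝ) < N := by exact_mod_cast NeZero.pos N
  have hj0 : (j : ZMod N) ≠ 0 := by
    rw [Ne, ZMod.natCast_eq_zero_iff]
    exact Nat.not_dvd_of_pos_of_lt h0 hj
  have hjR : (0 : ℝ) < j := by exact_mod_cast h0
  have hjN : (j : ℝ) < N := by exact_mod_cast hj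
  have hjN' : (N : ℝ) - j ≠ 0 := by linarith
  have e1 : ‖(ZMod.stdAddChar (j : ZMod N) : ℂ) - 1‖ = 2 * |Real.sin (Real.pi * (j / N))| := by
    have := ZMod.stdAddChar_coe (N := N) (j : ℤ)
    rw [Int.cast_natCast] at this
    rw [this]
    have e : (2 * Real.pi * Complex.I * ((j : ℤ) : ℂ) / N : ℂ) =
        Complex.I * ((2 * Real.pi * j / N : ℝ) : ℂ) := by push_cast; ring
    rw [e, Complex.norm_exp_I_mul_ofReal_sub_one, norm_mul, Real.norm_eq_abs, Real.norm_eq_abs,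
      abs_two]
    congr 3
    ring
  rw [charSumBound, if_neg hj0, e1]
  have := inv_sin_pi_mul_le (x := j / N) (by positivity) ((div_lt_one hN).2 hjN)
  calc _ = 1 / |Real.sin (Real.pi * (j / N))| := by
        rw [← div_div]; norm_num
    _ ≤ _ := this
    _ = _ := by
      have : (1 - (j : ℝ) / N) = ((N : ℝ) - j) / N := by field_simp
      rw [this]
      field_simp

theorem sum_charSumBound_le : ∑ a : ZMod N, charSumBound N a ≤ N * (2 + Real.log N) := by
  have e : ∑ a : ZMod N, charSumBound N a = ∑ j ∈ range N, charSumBound N (j : ZMod N) := by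
    refine sum_nbij' ZMod.val (fun j => (j : ZMod N)) ?_ ?_ ?_ ?_ ?_
    · intro a _; exact mem_range.2 (ZMod.val_lt a)
    · intro j _; exact mem_univ _
    · intro a _; simp
    · intro j hj; exact ZMod.val_cast_of_lt (mem_range.1 hj)
    · intro a _; simp
  rw [e]
  obtain ⟨n, hn⟩ : ∃ n, N = n + 1 := ⟨N - 1, by have := NeZero.pos N; omega⟩
  have hr : range N = range (n + 1) := by rw [hn]
  have hNR : (N : ℝ) = n + 1 := by rw [hn]; push_cast; rfl
  rw [hr, sum_range_succ']
  have h0 : charSumBound N ((0 : ℕ) : ZMod N) = N := by simp [charSumBound]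
  have h1 : ∑ j ∈ range n, charSumBound N ((j + 1 : ℕ) : ZMod N) ≤
      ∑ j ∈ range n, (N : ℝ) / 2 * (((j : ℝ) + 1)⁻¹ + (((n - 1 - j : ℕ) : ℝ) + 1)⁻¹) := by
    refine sum_le_sum fun j hj => ?_
    have hj' := mem_range.1 hj
    refine (charSumBound_natCast_le (by omega) (by omega)).trans (le_of_eq ?_)
    rw [one_div, one_div]
    have : ((n - 1 - j : ℕ) : ℝ) + 1 = (N : ℝ) - (j + 1 : ℕ) := by
      rw [hNR, eq_sub_iff_add_eq]
      have : n - 1 - j + 1 + (j + 1) = n + 1 := by omega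
      exact_mod_cast this
    rw [this]
    push_cast
    rfl
  rw [← mul_sum, sum_add_distrib,
    sum_range_reflect (fun i : ℕ => ((i : ℝ) + 1)⁻¹) n] at h1
  have h2 : ∑ j ∈ range n, ((j : ℝ) + 1)⁻¹ ≤ 1 + Real.log N := by
    have := harmonic_le_one_add_log n
    have e : ((harmonic n : ℚ) : ℝ) = ∑ j ∈ range n, ((j : ℝ) + 1)⁻¹ := by
      simp [harmonic]
    rw [e] at this
    rcases Nat.eq_zero_or_pos n with rfl | hn0
    · simp [hn]
    · refine this.trans ?_
      gcongr
      omega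
  have hN : (0 : ℝ) < N := by exact_mod_cast NeZero.pos N
  rw [h0]
  nlinarith

theorem card_mul_sum_comp_eq {G H : Type*} [AddGroup G] [Fintype G] [AddGroup H] [Fintype H]
    (φ : G →+ H) (hφ : Function.Surjective φ) (F : H → ℝ) :
    (Fintype.card H : ℝ) * ∑ g, F (φ g) = Fintype.card G * ∑ a, F a := by
  have h1 : ∀ c : H, ∑ g, F (φ g) = ∑ g, F (φ g + c) := by
    intro c
    obtain ⟨x, rfl⟩ := hφ c
    simp only [← map_add]
    exact (Equiv.sum_comp (Equiv.addRight x) (fun g => F (φ g))).symm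
  have h2 : ∀ g : G, ∑ c, F (φ g + c) = ∑ a, F a := fun g =>
    Equiv.sum_comp (Equiv.addLeft (φ g)) F
  calc _ = ∑ _c : H, ∑ g, F (φ g) := by simp
    _ = ∑ c : H, ∑ g, F (φ g + c) := sum_congr rfl fun c _ => h1 c
    _ = ∑ g : G, ∑ c, F (φ g + c) := sum_comm
    _ = _ := by simp [h2]

theorem sum_fourierError_le (hN : N.Prime) {t M : ℕ} (hM : N.Coprime M) :
    ∑ g : Fin t → ZMod N, fourierError N g M ≤
      (N : ℝ) ^ t * ((∑ a : ZMod N, charSumBound N a) / N) ^ (t + 1) := by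
  have := Fact.mk hN
  have hN0 : (0 : ℝ) < N := by exact_mod_cast hN.pos
  set T := ∑ a : ZMod N, charSumBound N a with hT
  have hT0 : 0 ≤ T := sum_nonneg fun _ _ => charSumBound_nonneg _
  have hM0 : (M : ZMod N) ≠ 0 := by
    rw [Ne, ZMod.natCast_eq_zero_iff]
    exact (Nat.Prime.coprime_iff_not_dvd hN).1 hM
  have h1 : ∀ h : Fin t → ZMod N, h ≠ 0 →
      ∑ g : Fin t → ZMod N, charSumBound N (M * ∑ i, h i * g i) = (N : ℝ) ^ t * (T / N) := by
    intro h hh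
    obtain ⟨i₀, hi₀⟩ := Function.ne_iff.1 hh
    let φ : (Fin t → ZMod N) →+ ZMod N :=
      { toFun := fun g => M * ∑ i, h i * g i
        map_zero' := by simp
        map_add' := fun x y => by simp [mul_add, sum_add_distrib] }
    have hφ : Function.Surjective φ := by
      intro c
      refine ⟨Pi.single i₀ (c / (M * h i₀)), ?_⟩
      have hi : h i₀ ≠ 0 := hi₀
      change (M : ZMod N) * ∑ i, h i * (Pi.single i₀ (c / (M * h i₀)) : Fin t → ZMod N) i = c
      rw [sum_eq_single i₀ (fun j _ hj => by simp [hj]) (by simp)]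
      simp only [Pi.single_eq_same]
      field_simp
    have := card_mul_sum_comp_eq φ hφ (charSumBound N)
    simp only [ZMod.card, Fintype.card_fun, Fintype.card_fin, Nat.cast_pow] at this
    rw [mul_div_assoc', eq_div_iff hN0.ne', mul_comm]
    exact this
  have hD : ∀ a : ZMod N, 0 ≤ charSumBound N a / N := fun a =>
    div_nonneg (charSumBound_nonneg a) hN0.le
  calc ∑ g : Fin t → ZMod N, fourierError N g M
      = ∑ h : Fin t → ZMod N with h ≠ 0, (∏ i, charSumBound N (h i) / N) *
          ((N : ℝ) ^ t * (T / N)) := by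
        simp only [fourierError]
        rw [sum_comm]
        refine sum_congr rfl fun h hh => ?_
        rw [← mul_sum, h1 h (mem_filter.1 hh).2]
    _ ≤ ∑ h : Fin t → ZMod N, (∏ i, charSumBound N (h i) / N) * ((N : ℝ) ^ t * (T / N)) :=
        sum_le_sum_of_subset_of_nonneg (filter_subset _ _) fun h _ _ =>
          mul_nonneg (prod_nonneg fun i _ => hD _) (by positivity)
    _ = _ := by
        rw [← sum_mul]
        have := prod_univ_sum (fun _ : Fin t => (univ : Finset (ZMod N)))
          (fun _ a => charSumBound N a / N)
        rw [Fintype.piFinset_univ] at this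
        rw [← this, ← sum_div, prod_const, card_univ, Fintype.card_fin]
        ring

theorem exists_sum_fourierError_le (hN : N.Prime) {κ : Type*} (P : Finset κ) (M : κ → ℕ)
    (hM : ∀ k ∈ P, N.Coprime (M k)) (t : ℕ) :
    ∃ g : Fin t → ℕ, (∀ i, 1 ≤ g i ∧ g i ≤ N - 1) ∧
      ∑ k ∈ P, fourierError N (fun i => (g i : ZMod N)) (M k) ≤
        #P * (2 ^ t * (2 + Real.log N) ^ (t + 1)) := by
  have := Fact.mk hN
  have hN0 : (0 : ℝ) < N := by exact_mod_cast hN.pos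
  have hfe : ∀ (g : Fin t → ZMod N) M, 0 ≤ fourierError N g M := fun g M =>
    sum_nonneg fun h _ => mul_nonneg
      (prod_nonneg fun i _ => div_nonneg (charSumBound_nonneg _) hN0.le) (charSumBound_nonneg _)
  set U : Finset (Fin t → ZMod N) := Fintype.piFinset fun _ => univ.erase 0 with hU
  have hUcard : (N : ℝ) ^ t ≤ 2 ^ t * #U := by
    have : #U = (N - 1) ^ t := by simp [hU, ZMod.card]
    rw [this, Nat.cast_pow, ← mul_pow]
    gcongr
    have := hN.two_le
    have h : N ≤ 2 * (N - 1) := by omega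
    exact_mod_cast h
  have hUne : U.Nonempty := ⟨fun _ => 1, by simp [hU]⟩
  have hsum : ∑ g ∈ U, ∑ k ∈ P, fourierError N g (M k) ≤
      ∑ _g ∈ U, #P * (2 ^ t * (2 + Real.log N) ^ (t + 1)) := by
    calc ∑ g ∈ U, ∑ k ∈ P, fourierError N g (M k)
        ≤ ∑ g, ∑ k ∈ P, fourierError N g (M k) :=
          sum_le_sum_of_subset_of_nonneg (subset_univ _) fun g _ _ => sum_nonneg fun k _ => hfe _ _
      _ = ∑ k ∈ P, ∑ g, fourierError N g (M k) := sum_comm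
      _ ≤ ∑ _k ∈ P, (N : ℝ) ^ t * (2 + Real.log N) ^ (t + 1) := by
          refine sum_le_sum fun k hk => (sum_fourierError_le hN (hM k hk)).trans ?_
          gcongr
          · exact div_nonneg (sum_nonneg fun _ _ => charSumBound_nonneg _) hN0.le
          · rw [div_le_iff₀ hN0, mul_comm]
            exact sum_charSumBound_le
      _ = #P * (N : ℝ) ^ t * (2 + Real.log N) ^ (t + 1) := by
          rw [sum_const, nsmul_eq_mul]; ring
      _ ≤ #P * (2 ^ t * #U) * (2 + Real.log N) ^ (t + 1) := by
          have : 0 ≤ Real.log N := Real.log_natCast_nonneg N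
          gcongr
      _ = _ := by rw [sum_const, nsmul_eq_mul]; ring
  obtain ⟨g, hg, hle⟩ := exists_le_of_sum_le hUne hsum
  refine ⟨fun i => (g i).val, fun i => ⟨?_, ?_⟩, by simpa using hle⟩
  · have : g i ≠ 0 := by simpa [hU] using (Fintype.mem_piFinset.1 hg) i
    exact Nat.one_le_iff_ne_zero.2 (by simpa [ZMod.val_eq_zero] using this)
  · exact Nat.le_sub_one_of_lt (ZMod.val_lt (g i))

end

theorem exists_forall_mod_eq_iff {s : ℕ} (c : Fin s → ℕ)
    (hc : Pairwise fun i j => (c i).Coprime (c j)) (r : Fin s → ℕ) (hr : ∀ i, r i < c i) :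
    ∃ R < ∏ i, c i, ∀ n, (∀ i, n % c i = r i) ↔ n % ∏ i, c i = R := by
  have hc0 : ∀ i ∈ (univ : Finset (Fin s)), c i ≠ 0 := fun i _ => by have := hr i; omega
  have hpp : Set.Pairwise ((univ : Finset (Fin s)) : Set (Fin s))
      (Function.onFun Nat.Coprime c) := fun i _ j _ hij => hc hij
  set R := Nat.chineseRemainderOfFinset r c univ hc0 hpp with hR
  have hlt : (R : ℕ) < ∏ i, c i := Nat.chineseRemainderOfFinset_lt_prod r c hc0 hpp
  refine ⟨R, hlt, fun n => ?_⟩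
  have h1 : n ≡ R [MOD ∏ i, c i] ↔ ∀ i, n ≡ R [MOD c i] := by
    have := Nat.modEq_list_map_prod_iff (a := n) (b := R) (s := c) (l := univ.toList)
      (List.Nodup.pairwise_of_forall_ne (nodup_toList _) fun i _ j _ hij => hc hij)
    simpa [Finset.prod_map_toList] using this
  have h2 : n % ∏ i, c i = R ↔ n ≡ R [MOD ∏ i, c i] := by
    rw [Nat.ModEq, Nat.mod_eq_of_lt hlt]
  rw [h2, h1]
  refine forall_congr' fun i => ?_
  have h3 := R.2 i (mem_univ i)
  rw [Nat.ModEq, Nat.mod_eq_of_lt (hr i)] at h3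
  rw [Nat.ModEq, h3]

theorem abs_sum_box_sub_le {N : ℕ} [NeZero N] {s t : ℕ} (b : Fin s → ℕ) (hb : ∀ i, 2 ≤ b i)
    (hco : Pairwise fun i j => (b i).Coprime (b j)) (m : Fin s → ℕ) (g : Fin t → ℕ)
    {A B : ℕ} (hAB : A ≤ B) (hB : B ≤ N)
    (p q : Fin s → ℕ) (hpq : ∀ i, p i ≤ q i) (hq : ∀ i, q i ≤ b i ^ m i)
    (p' q' : Fin t → ℕ) (hpq' : ∀ i, p' i ≤ q' i) (hq' : ∀ i, q' i ≤ N) :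
    |∑ n ∈ Ico A B with ∀ i, p i ≤ revDigits (b i) (m i) n ∧ revDigits (b i) (m i) n < q i,
        (if ∀ i, p' i ≤ n * g i % N ∧ n * g i % N < q' i then (1 : ℝ) else 0) -
      ((B : ℝ) - A) * (∏ i, ((q' i : ℝ) - p' i) / N) *
        ∏ i, (((q i : ℝ) - p i) / (b i : ℝ) ^ m i)| ≤
    (∏ i, (2 * b i : ℝ)) * ∑ k ∈ Fintype.piFinset fun i => range (m i + 1),
      (1 + fourierError N (fun i => (g i : ZMod N)) (∏ i, b i ^ k i)) := by
  refine abs_sum_forall_revDigits_sub_le b hb m _ _ _ _ (fun k _ r hr => ?_) p q hpq hq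
  obtain ⟨R, hR, hiff⟩ := exists_forall_mod_eq_iff (fun i => b i ^ k i)
    (fun i j hij => Nat.Coprime.pow _ _ (hco hij)) r hr
  have := abs_sum_mod_eq_sub_le g hR hAB hB p' q' hpq' hq'
  rw [filter_congr fun n _ => hiff n, prod_inv_distrib]
  simpa using this

theorem exists_grid_Ico {P : ℕ} (hP : 0 < P) {u v : ℝ} (hu : 0 ≤ u) (huv : u ≤ v) (hv : v ≤ 1) :
    ∃ p q : ℕ, p ≤ q ∧ q ≤ P ∧
      (∀ x : ℕ, (u ≤ (x : ℝ) / P ∧ (x : ℝ) / P < v) ↔ (p ≤ x ∧ x < q)) ∧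
      |((q : ℝ) - p) / P - (v - u)| ≤ 1 / P := by
  have hPR : (0 : ℝ) < P := by exact_mod_cast hP
  refine ⟨⌈u * P⌉₊, ⌈v * P⌉₊, Nat.ceil_mono (by gcongr), ?_, fun x => ?_, ?_⟩
  · exact Nat.ceil_le.2 (by nlinarith)
  · rw [Nat.ceil_le, Nat.lt_ceil, le_div_iff₀ hPR, div_lt_iff₀ hPR]
  · have h1 := Nat.le_ceil (u * P)
    have h2 := Nat.le_ceil (v * P)
    have h3 := Nat.ceil_lt_add_one (mul_nonneg hu hPR.le)
    have h4 := Nat.ceil_lt_add_one (mul_nonneg (hu.trans huv) hPR.le)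
    have e : ((⌈v * P⌉₊ : ℝ) - ⌈u * P⌉₊) / P - (v - u) =
        ((⌈v * P⌉₊ - v * P) - (⌈u * P⌉₊ - u * P)) / P := by field_simp; ring
    rw [e, abs_div, abs_of_pos hPR]
    gcongr
    rw [abs_le]
    constructor <;> linarith

theorem abs_prod_sub_prod_le_s10 {ι : Type*} (S : Finset ι) (x y : ι → ℝ)
    (hx0 : ∀ i, 0 ≤ x i) (hx1 : ∀ i, x i ≤ 1) (hy0 : ∀ i, 0 ≤ y i) (hy1 : ∀ i, y i ≤ 1) :
    |∏ i ∈ S, x i - ∏ i ∈ S, y i| ≤ ∑ i ∈ S, |x i - y i| := by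
  classical
  induction S using Finset.induction_on with
  | empty => simp
  | insert j S hj ih =>
    rw [prod_insert hj, prod_insert hj, sum_insert hj]
    have e : x j * ∏ i ∈ S, x i - y j * ∏ i ∈ S, y i =
        (x j - y j) * ∏ i ∈ S, x i + y j * (∏ i ∈ S, x i - ∏ i ∈ S, y i) := by ring
    rw [e]
    refine (abs_add_le _ _).trans (add_le_add ?_ ?_)
    · rw [abs_mul]
      refine mul_le_of_le_one_right (abs_nonneg _) ?_
      rw [abs_of_nonneg (prod_nonneg fun i _ => hx0 i)]
      exact prod_le_one (fun i _ => hx0 i) fun i _ => hx1 i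
    · rw [abs_mul, abs_of_nonneg (hy0 j)]
      exact (mul_le_of_le_one_left (abs_nonneg _) (hy1 j)).trans ih

theorem radInv_eq_revDigits_div {b m n : ℕ} (hb : 2 ≤ b) (hn : n < b ^ m) :
    radInv b n = (revDigits b m n : ℝ) / (b : ℝ) ^ m := by
  have hlen : (Nat.digits b n).length ≤ m := (Nat.digits_length_le_iff (by omega) n).2 hn
  rw [revDigits_div_pow hb, radInv]
  simp only [← Nat.getD_digits _ _ hb]
  refine sum_subset (range_subset_range.2 hlen) fun i _ hi => ?_
  rw [List.getD_eq_default _ _ (by simpa using hi)]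
  simp

theorem two_thirds_le_log_natCast {N : ℕ} (hN : 2 ≤ N) : 2 / 3 ≤ Real.log N := by
  have h1 : Real.log 2 ≤ Real.log N := Real.log_le_log (by norm_num) (by exact_mod_cast hN)
  linarith [Real.log_two_gt_d9]

theorem clog_add_one_le {b N : ℕ} (hb : 2 ≤ b) (hN : 2 ≤ N) :
    (Nat.clog b N : ℝ) + 1 ≤ 5 * Real.log N := by
  have h1 := Nat.pow_pred_clog_lt_self (b := b) (by omega) (x := N) (by omega)
  have h0 := Nat.clog_pos (b := b) (n := N) (by omega) (by omega)
  obtain ⟨k, hk⟩ : ∃ k, Nat.clog b N = k + 1 := ⟨Nat.clog b N - 1, by omega⟩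
  rw [hk] at h1 ⊢
  have h2 : 2 ^ k ≤ N := (Nat.pow_le_pow_left hb k).trans h1.le
  have h3 : (k : ℝ) * Real.log 2 ≤ Real.log N := by
    rw [← Real.log_pow]
    exact Real.log_le_log (by positivity) (by exact_mod_cast h2)
  have h4 := two_thirds_le_log_natCast hN
  have h5 := Real.log_two_gt_d9
  have hk0 : (0 : ℝ) ≤ k := by positivity
  push_cast
  nlinarith

theorem card_mul_error_le {s t : ℕ} {L : ℝ} (hL : 2 / 3 ≤ L) {C c : ℝ} (hC : 0 ≤ C)
    (hc : c ≤ (5 * L) ^ s) :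
    C * (c * (1 + 2 ^ t * (2 + L) ^ (t + 1))) + (s + t + 1 : ℕ) ≤
      (C * (5 ^ s * (2 ^ (t + 1) + 2 ^ t * 4 ^ (t + 1))) + (s + t + 1 : ℕ) * 2 ^ (s + t + 1)) *
        L ^ (s + t + 1) := by
  have h1 : ∀ n, (1 : ℝ) ≤ (2 * L) ^ n := fun n => one_le_pow₀ (by linarith)
  have h2 : (2 + L) ^ (t + 1) ≤ (4 * L) ^ (t + 1) := by gcongr; linarith
  calc C * (c * (1 + 2 ^ t * (2 + L) ^ (t + 1))) + (s + t + 1 : ℕ)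
      ≤ C * ((5 * L) ^ s * ((2 * L) ^ (t + 1) + 2 ^ t * (4 * L) ^ (t + 1))) +
          (s + t + 1 : ℕ) * (2 * L) ^ (s + t + 1) := by
        gcongr
        · exact h1 _
        · exact le_mul_of_one_le_right (by positivity) (h1 _)
    _ = _ := by
        simp only [mul_pow]
        ring

theorem disc_le_of_forall {ι : Type*} [Fintype ι] (z : ℕ → ι → ℝ) (N : ℕ) {K : ℝ} (hK : 0 ≤ K)
    (h : ∀ u v : ι → ℝ, (∀ i, 0 ≤ u i ∧ u i ≤ v i ∧ v i ≤ 1) →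
      |(Nat.card {n : ℕ // n < N ∧ ∀ i, u i ≤ z n i ∧ z n i < v i} : ℝ) / N -
        ∏ i, (v i - u i)| ≤ K) :
    disc z N ≤ K := by
  refine Real.sSup_le ?_ hK
  rintro _ ⟨u, v, huv, rfl⟩
  exact h u v huv

theorem disc_hammersley_append_le {N s t : ℕ} [NeZero N] (b : Fin s → ℕ) (hb : ∀ i, 2 ≤ b i)
    (hco : Pairwise fun i j => (b i).Coprime (b j)) (g : Fin t → ℕ) :
    disc (fun n => Fin.append
        (Fin.cons ((n : ℝ) / N) (fun j : Fin s => radInv (b j) n))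
        (fun i : Fin t => Int.fract ((n : ℝ) * g i / N))) N ≤
      ((∏ i, (2 * b i : ℝ)) * ∑ k ∈ Fintype.piFinset fun i => range (Nat.clog (b i) N + 1),
        (1 + fourierError N (fun i => (g i : ZMod N)) (∏ i, b i ^ k i)) +
        (s + t + 1 : ℕ)) / N := by
  have hN0 : 0 < N := NeZero.pos N
  have hN : (0 : ℝ) < N := by exact_mod_cast hN0
  set m : Fin s → ℕ := fun i => Nat.clog (b i) N with hm
  have hNm : ∀ i, N ≤ b i ^ m i := fun i => Nat.le_pow_clog (by have := hb i; omega) N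
  set K := (∏ i, (2 * b i : ℝ)) * ∑ k ∈ Fintype.piFinset fun i => range (m i + 1),
        (1 + fourierError N (fun i => (g i : ZMod N)) (∏ i, b i ^ k i)) with hK
  have hbox := fun {A B : ℕ} => abs_sum_box_sub_le (N := N) (A := A) (B := B) b hb hco m g
  have hK0 : 0 ≤ K := (abs_nonneg _).trans
    (hbox (A := 0) (B := 0) le_rfl hN0.le 0 0 (fun _ => le_rfl) (fun _ => Nat.zero_le _)
      0 0 (fun _ => le_rfl) fun _ => Nat.zero_le _)
  refine disc_le_of_forall _ _ (by positivity) fun u v huv => ?_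
  set P : Fin (s + 1 + t) → ℕ := Fin.append (Fin.cons N fun i => b i ^ m i) fun _ => N with hP
  have hNP : ∀ i, N ≤ P i := by
    intro i
    refine Fin.addCases (fun j => ?_) (fun j => ?_) i
    · refine Fin.cases ?_ (fun l => ?_) j
      · simp [hP]
      · simpa [hP] using hNm l
    · simp [hP]
  have hgrid := fun i => exists_grid_Ico (P := P i) (hN0.trans_le (hNP i)) (huv i).1 (huv i).2.1
    (huv i).2.2
  choose p q hpq hqP hiff hlen using hgrid
  set i₀ : Fin (s + 1 + t) := Fin.castAdd t 0
  have hP0 : P i₀ = N := by simp [hP, i₀]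
  have hP1 : ∀ j : Fin s, P (Fin.castAdd t j.succ) = b j ^ m j := fun j => by simp [hP]
  have hP2 : ∀ j : Fin t, P (Fin.natAdd (s + 1) j) = N := fun j => by simp [hP]
  have hcard : (Nat.card {n : ℕ // n < N ∧ ∀ i, u i ≤ (Fin.append
        (Fin.cons ((n : ℝ) / N) (fun j : Fin s => radInv (b j) n))
        (fun i : Fin t => Int.fract ((n : ℝ) * g i / N)) : Fin (s + 1 + t) → ℝ) i ∧ (Fin.append
        (Fin.cons ((n : ℝ) / N) (fun j : Fin s => radInv (b j) n))
        (fun i : Fin t => Int.fract ((n : ℝ) * g i / N)) : Fin (s + 1 + t) → ℝ) i < v i} : ℝ) =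
      ∑ n ∈ Ico (p i₀) (q i₀) with ∀ j : Fin s,
        p (Fin.castAdd t j.succ) ≤ revDigits (b j) (m j) n ∧
          revDigits (b j) (m j) n < q (Fin.castAdd t j.succ),
        (if ∀ j : Fin t, p (Fin.natAdd (s + 1) j) ≤ n * g j % N ∧
          n * g j % N < q (Fin.natAdd (s + 1) j) then (1 : ℝ) else 0) := by
    rw [sum_boole, filter_filter]
    congr 1
    refine Nat.subtype_card _ fun n => ?_
    have hlt : n ∈ Ico (p i₀) (q i₀) → n < N := fun h =>
      (mem_Ico.1 h).2.trans_le (hP0 ▸ hqP i₀)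
    have hforall : ∀ Q : Fin (s + 1 + t) → Prop, (∀ i, Q i) ↔
        Q i₀ ∧ (∀ j : Fin s, Q (Fin.castAdd t j.succ)) ∧ ∀ j : Fin t, Q (Fin.natAdd (s + 1) j) := by
      intro Q
      refine ⟨fun h => ⟨h _, fun _ => h _, fun _ => h _⟩, fun ⟨h0, h1, h2⟩ i => ?_⟩
      refine Fin.addCases (fun j => ?_) h2 i
      exact Fin.cases h0 h1 j
    have key : n < N → ((∀ i, u i ≤ (Fin.append
        (Fin.cons ((n : ℝ) / N) (fun j : Fin s => radInv (b j) n))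
        (fun i : Fin t => Int.fract ((n : ℝ) * g i / N)) : Fin (s + 1 + t) → ℝ) i ∧ (Fin.append
        (Fin.cons ((n : ℝ) / N) (fun j : Fin s => radInv (b j) n))
        (fun i : Fin t => Int.fract ((n : ℝ) * g i / N)) : Fin (s + 1 + t) → ℝ) i < v i) ↔
        n ∈ Ico (p i₀) (q i₀) ∧ (∀ j : Fin s,
          p (Fin.castAdd t j.succ) ≤ revDigits (b j) (m j) n ∧
          revDigits (b j) (m j) n < q (Fin.castAdd t j.succ)) ∧
        ∀ j : Fin t, p (Fin.natAdd (s + 1) j) ≤ n * g j % N ∧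
          n * g j % N < q (Fin.natAdd (s + 1) j)) := by
      intro hn
      rw [hforall]
      refine and_congr ?_ (and_congr (forall_congr' fun j => ?_) (forall_congr' fun j => ?_))
      · have := hiff i₀ n
        rw [hP0] at this
        simpa [i₀] using this
      · have := hiff (Fin.castAdd t j.succ) (revDigits (b j) (m j) n)
        rw [hP1, Nat.cast_pow, ← radInv_eq_revDigits_div (hb j) (hn.trans_le (hNm j))] at this
        simpa using this
      · have := hiff (Fin.natAdd (s + 1) j) (n * g j % N)
        rw [hP2, ← Int.fract_div_natCast_eq_div_natCast_mod, Nat.cast_mul] at this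
        simpa using this
    rw [mem_filter]
    constructor
    · rintro ⟨h1, h2⟩
      exact ⟨hlt h1, (key (hlt h1)).2 ⟨h1, h2⟩⟩
    · rintro ⟨h1, h2⟩
      exact (key h1).1 h2
  rw [hcard]
  have h1 := hbox (A := p i₀) (B := q i₀) (hpq _) (hP0 ▸ hqP i₀)
    (fun j => p (Fin.castAdd t j.succ)) (fun j => q (Fin.castAdd t j.succ)) (fun _ => hpq _)
    (fun j => hP1 j ▸ hqP _)
    (fun j => p (Fin.natAdd (s + 1) j)) (fun j => q (Fin.natAdd (s + 1) j)) (fun _ => hpq _)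
    (fun j => hP2 j ▸ hqP _)
  generalize (∑ n ∈ Ico (p i₀) (q i₀) with ∀ j : Fin s,
        p (Fin.castAdd t j.succ) ≤ revDigits (b j) (m j) n ∧
          revDigits (b j) (m j) n < q (Fin.castAdd t j.succ),
        (if ∀ j : Fin t, p (Fin.natAdd (s + 1) j) ≤ n * g j % N ∧
          n * g j % N < q (Fin.natAdd (s + 1) j) then (1 : ℝ) else 0)) = X at h1 ⊢
  have hP0R : ∀ i, (0 : ℝ) < P i := fun i => by exact_mod_cast hN0.trans_le (hNP i)
  have hprod : ∏ i, ((q i : ℝ) - p i) / P i = (((q i₀ : ℝ) - p i₀) *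
      (∏ j : Fin t, ((q (Fin.natAdd (s + 1) j) : ℝ) - p (Fin.natAdd (s + 1) j)) / N) *
      ∏ j : Fin s, (((q (Fin.castAdd t j.succ) : ℝ) - p (Fin.castAdd t j.succ)) /
        (b j : ℝ) ^ m j)) / N := by
    rw [Fin.prod_univ_add, Fin.prod_univ_succ]
    simp only [hP1, hP2, Nat.cast_pow]
    change ((q i₀ : ℝ) - p i₀) / P i₀ * _ * _ = _
    rw [hP0]
    ring
  have h2 : |∏ i, ((q i : ℝ) - p i) / P i - ∏ i, (v i - u i)| ≤ (s + t + 1 : ℕ) / N := by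
    have hqp : ∀ i, (p i : ℝ) ≤ q i := fun i => by exact_mod_cast hpq i
    refine (abs_prod_sub_prod_le_s10 _ _ _
      (fun i => div_nonneg (sub_nonneg.2 (hqp i)) (hP0R i).le) (fun i => ?_)
      (fun i => sub_nonneg.2 (huv i).2.1) (fun i => ?_)).trans ?_
    · rw [div_le_one (hP0R i)]
      have : (q i : ℝ) ≤ P i := by exact_mod_cast hqP i
      have : (0 : ℝ) ≤ p i := by positivity
      linarith
    · linarith [(huv i).1, (huv i).2.2]
    · calc _ ≤ ∑ _i : Fin (s + 1 + t), 1 / (N : ℝ) := by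
            refine sum_le_sum fun i _ => (hlen i).trans ?_
            exact one_div_le_one_div_of_le hN (by exact_mod_cast hNP i)
        _ = _ := by
            simp only [sum_const, card_univ, Fintype.card_fin, nsmul_eq_mul]
            push_cast
            ring
  have h3 : |X / N - ∏ i, ((q i : ℝ) - p i) / P i| ≤ K / N := by
    rw [hprod, ← sub_div, abs_div, abs_of_pos hN]
    gcongr
  rw [add_div]
  exact (abs_sub_le _ _ _).trans (add_le_add h3 h2)

end

theorem stmt10 (s t : ℕ) (ht : 1 ≤ t) (b : Fin s → ℕ) (hb : ∀ i, Nat.Prime (b i))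
    (hdist : Function.Injective b) :
    ∃ c > 0, ∀ N : ℕ, N.Prime → (∀ i, N ≠ b i) →
      ∃ g : Fin t → ℕ, (∀ i, 1 ≤ g i ∧ g i ≤ N - 1) ∧
        disc (fun n => Fin.append
            (Fin.cons ((n : ℝ) / N) (fun j : Fin s => radInv (b j) n))
            (fun i : Fin t => Int.fract ((n : ℝ) * g i / N))) N
          ≤ c * Real.log N ^ (s + t + 1) / N := by
  refine ⟨(∏ i, (2 * b i : ℝ)) * (5 ^ s * (2 ^ (t + 1) + 2 ^ t * 4 ^ (t + 1))) +
    (s + t + 1 : ℕ) * 2 ^ (s + t + 1), by positivity, fun N hN hNb => ?_⟩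
  have : NeZero N := ⟨hN.ne_zero⟩
  have hco : Pairwise fun i j => (b i).Coprime (b j) := fun i j hij =>
    (Nat.coprime_primes (hb i) (hb j)).2 (hdist.ne hij)
  have hb2 : ∀ i, 2 ≤ b i := fun i => (hb i).two_le
  obtain ⟨g, hg, hle⟩ := exists_sum_fourierError_le hN
    (Fintype.piFinset fun i => Finset.range (Nat.clog (b i) N + 1)) (fun k => ∏ i, b i ^ k i)
    (fun k _ => Nat.Coprime.prod_right fun i _ =>
      Nat.Coprime.pow_right _ ((Nat.coprime_primes hN (hb i)).2 (hNb i))) t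
  refine ⟨g, hg, (disc_hammersley_append_le b hb2 hco g).trans ?_⟩
  gcongr
  have hcard :
      ((Finset.card (Fintype.piFinset fun i => Finset.range (Nat.clog (b i) N + 1)) : ℕ) : ℝ) ≤
      (5 * Real.log N) ^ s := by
    rw [Fintype.card_piFinset]
    push_cast [Finset.card_range]
    calc _ ≤ ∏ _i : Fin s, 5 * Real.log N :=
          Finset.prod_le_prod (fun i _ => by positivity)
            fun i _ => clog_add_one_le (hb2 i) hN.two_le
      _ = _ := by simp
  refine le_trans ?_ (card_mul_error_le (two_thirds_le_log_natCast hN.two_le)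
    (Finset.prod_nonneg fun i _ => by positivity) hcard)
  gcongr
  rw [Finset.sum_add_distrib, mul_add, mul_one, Finset.sum_const, nsmul_eq_mul, mul_one]
  gcongr
end
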